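/- arXiv:2603.07063 — 3 statements merged into one kernel-verified Lean document; each statement's English description precedes it below -/
import Mathlib

section
/- Existence of a C^{1,α} center manifold: there exists a C^{1,α} map ϖ_c : X_c → X_su with ϖ_c(0) = 0 and Dϖ_c(0) = 0 whose graph ℳ_c := {x_c + ϖ_c(x_c) : x_c ∈ X_c} is invariant under F, i.e. F(ℳ_c) = ℳ_c. -/
noncomputable section

open Filter Topology

abbrev Euc (d : ℕ) : Type := EuclideanSpace ℝ (Fin d)

/-- A triple of complementary projections realizing the splitting
`ℝ^d = X_s ⊕ X_c ⊕ X_u`. -/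
structure TripleProj (d : ℕ) where
  πs : Euc d →L[ℝ] Euc d
  πc : Euc d →L[ℝ] Euc d
  πu : Euc d →L[ℝ] Euc d
  idem_s : πs.comp πs = πs
  idem_c : πc.comp πc = πc
  idem_u : πu.comp πu = πu
  comp_sc : πs.comp πc = 0
  comp_cs : πc.comp πs = 0
  comp_su : πs.comp πu = 0
  comp_us : πu.comp πs = 0
  comp_cu : πc.comp πu = 0
  comp_uc : πu.comp πc = 0
  sum_eq : πs + πc + πu = ContinuousLinearMap.id ℝ (Euc d)

/-- The kernel `G` acts boundedly, with constant `M`, on two-sided sequences of growth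
`O(μ ^ |n|)`. -/
def WeightedKernelBound {V : Type*} [NormedAddCommGroup V] [NormedSpace ℝ V]
    (G : ℤ → ℤ → V →L[ℝ] V) (μ M : ℝ) : Prop :=
  ∀ n : ℤ, Summable (fun j : ℤ => ‖G n j‖ * μ ^ j.natAbs) ∧
    ∑' j : ℤ, ‖G n j‖ * μ ^ j.natAbs ≤ M * μ ^ n.natAbs

section Kernel

variable {V : Type*} [NormedAddCommGroup V] [NormedSpace ℝ V]
  {G : ℤ → ℤ → V →L[ℝ] V} {μ M : ℝ}

theorem WeightedKernelBound.nonneg (hG : WeightedKernelBound G μ M) (hμ : 1 ≤ μ) : 0 ≤ M := by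
  have h := (hG 0).2
  have h0 : 0 ≤ ∑' j : ℤ, ‖G 0 j‖ * μ ^ j.natAbs := tsum_nonneg fun j => by positivity
  simpa using h0.trans h

theorem WeightedKernelBound.summable_and_norm_tsum_le [CompleteSpace V]
    (hG : WeightedKernelBound G μ M)
    {h : ℤ → V} {R : ℝ} (hh : ∀ j, ‖h j‖ ≤ R * μ ^ j.natAbs) (n : ℤ) :
    Summable (fun j => G n j (h j)) ∧ ‖∑' j, G n j (h j)‖ ≤ M * R * μ ^ n.natAbs := by
  have hR : 0 ≤ R := by simpa using (norm_nonneg _).trans (hh 0)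
  have hle : ∀ j, ‖G n j (h j)‖ ≤ R * (‖G n j‖ * μ ^ j.natAbs) := fun j => by
    calc ‖G n j (h j)‖ ≤ ‖G n j‖ * ‖h j‖ := (G n j).le_opNorm _
      _ ≤ ‖G n j‖ * (R * μ ^ j.natAbs) := by gcongr; exact hh j
      _ = _ := by ring
  have hs : Summable fun j => R * (‖G n j‖ * μ ^ j.natAbs) := (hG n).1.mul_left R
  refine ⟨Summable.of_norm_bounded hs hle, ?_⟩
  calc ‖∑' j, G n j (h j)‖ ≤ ∑' j, R * (‖G n j‖ * μ ^ j.natAbs) :=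
        tsum_of_norm_bounded hs.hasSum hle
    _ = R * ∑' j, ‖G n j‖ * μ ^ j.natAbs := tsum_mul_left
    _ ≤ R * (M * μ ^ n.natAbs) := by gcongr; exact (hG n).2
    _ = _ := by ring

/-- A sequence of weighted growth solving a linear-type summation equation with small Lipschitz
part is controlled by the inhomogeneity. -/
theorem WeightedKernelBound.norm_le_of_hasSum [CompleteSpace V]
    (hG : WeightedKernelBound G μ M)
    (hμ : 1 ≤ μ) {δ B a R : ℝ} (hδ : 0 ≤ δ) (hR : 0 ≤ R) (hMδ : M * δ ≤ 1 / 2) {r b h : ℤ → V}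
    (hB : ∀ n, ‖r n‖ ≤ B * μ ^ n.natAbs) (hb : ∀ n, ‖b n‖ ≤ a * μ ^ n.natAbs)
    (hh : ∀ j, ‖h j‖ ≤ δ * ‖r j‖ + R * μ ^ j.natAbs)
    (hr : ∀ n, HasSum (fun j => G n j (h j)) (r n - b n)) (n : ℤ) :
    ‖r n‖ ≤ 2 * (a + M * R) * μ ^ n.natAbs := by
  have step : ∀ B, (∀ n, ‖r n‖ ≤ B * μ ^ n.natAbs) →
      ∀ n, ‖r n‖ ≤ (B / 2 + (a + M * R)) * μ ^ n.natAbs := by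
    intro B hB n
    have hB0 : 0 ≤ B := by simpa using (norm_nonneg _).trans (hB 0)
    have h1 : ∀ j, ‖h j‖ ≤ (δ * B + R) * μ ^ j.natAbs := fun j => by
      have := mul_le_mul_of_nonneg_left (hB j) hδ
      linarith [hh j]
    have h2 := (hG.summable_and_norm_tsum_le h1 n).2
    rw [(hr n).tsum_eq] at h2
    have h3 : ‖r n‖ ≤ ‖r n - b n‖ + ‖b n‖ := norm_le_norm_sub_add _ _
    have h4 : M * (δ * B + R) * μ ^ n.natAbs ≤ (B / 2 + M * R) * μ ^ n.natAbs := by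
      gcongr
      nlinarith
    linarith [hb n]
  have iter : ∀ k : ℕ, ∀ n, ‖r n‖ ≤ (B * (1 / 2) ^ k + 2 * (a + M * R)) * μ ^ n.natAbs := by
    have hc : 0 ≤ a + M * R := by
      have ha : 0 ≤ a := by simpa using (norm_nonneg _).trans (hb 0)
      have hM := hG.nonneg hμ
      positivity
    intro k
    induction k with
    | zero =>
      intro n
      refine (hB n).trans ?_
      gcongr
      linarith
    | succ k ih =>
      intro n
      refine (step _ ih n).trans (le_of_eq ?_)
      ring
  have hlim : Tendsto (fun k : ℕ => (B * (1 / 2 : ℝ) ^ k + 2 * (a + M * R)) * μ ^ n.natAbs) atTop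
      (𝓝 ((B * 0 + 2 * (a + M * R)) * μ ^ n.natAbs)) :=
    (((tendsto_pow_atTop_nhds_zero_of_lt_one (by norm_num) (by norm_num)).const_mul B).add_const
      _).mul_const _
  rw [mul_zero, zero_add] at hlim
  exact ge_of_tendsto' hlim fun k => iter k n

theorem WeightedKernelBound.exists_hasSum [CompleteSpace V]
    (hG : WeightedKernelBound G μ M)
    (hμ : 1 ≤ μ) {δ a : ℝ} (hδ : 0 ≤ δ) (hMδ : M * δ ≤ 1 / 2) {b : ℤ → V} {φ : ℤ → V → V}
    (hb : ∀ n, ‖b n‖ ≤ a * μ ^ n.natAbs) (hφ0 : ∀ j, φ j 0 = 0)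
    (hφ : ∀ j v w, ‖φ j v - φ j w‖ ≤ δ * ‖v - w‖) :
    ∃ x : ℤ → V, (∃ B : ℝ, ∀ n, ‖x n‖ ≤ B * μ ^ n.natAbs) ∧
      ∀ n, HasSum (fun j => G n j (φ j (x j))) (x n - b n) := by
  have hμ0 : ∀ n : ℤ, 0 < μ ^ n.natAbs := fun n => by positivity
  have hcancel : ∀ (n : ℤ) (c : ℝ) (v : V), ‖v‖ ≤ c * μ ^ n.natAbs →
      ‖(μ ^ n.natAbs)⁻¹ • v‖ ≤ c := fun n c v hv => by
    rw [norm_smul, norm_inv, Real.norm_of_nonneg (hμ0 n).le, inv_mul_le_iff₀ (hμ0 n), mul_comm]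
    exact hv
  have hφu : ∀ (u : BoundedContinuousFunction ℤ V) (j : ℤ),
      ‖φ j (μ ^ j.natAbs • u j)‖ ≤ (δ * ‖u‖) * μ ^ j.natAbs := fun u j => by
    have h1 := hφ j (μ ^ j.natAbs • u j) 0
    rw [hφ0, sub_zero, sub_zero, norm_smul, Real.norm_of_nonneg (hμ0 j).le] at h1
    refine h1.trans ?_
    rw [mul_assoc, mul_comm ‖u‖]
    have := u.norm_coe_le_norm j
    gcongr
  have hS := fun (u : BoundedContinuousFunction ℤ V) (n : ℤ) =>
    hG.summable_and_norm_tsum_le (hφu u) n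
  let T : BoundedContinuousFunction ℤ V → BoundedContinuousFunction ℤ V := fun u =>
    BoundedContinuousFunction.ofNormedAddCommGroupDiscrete
      (fun n => (μ ^ n.natAbs)⁻¹ • (b n + ∑' j, G n j (φ j (μ ^ j.natAbs • u j))))
      (a + M * (δ * ‖u‖)) (fun n => by
        apply hcancel
        refine (norm_add_le _ _).trans ?_
        rw [add_mul]
        exact add_le_add (hb n) (hS u n).2)
  have hT : ∀ u n, T u n =
      (μ ^ n.natAbs)⁻¹ • (b n + ∑' j, G n j (φ j (μ ^ j.natAbs • u j))) := fun _ _ => rfl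
  have hcontr : ContractingWith (1 / 2) T := by
    refine ⟨by rw [← NNReal.coe_lt_coe]; norm_num, LipschitzWith.of_dist_le_mul fun u v => ?_⟩
    rw [BoundedContinuousFunction.dist_le (by positivity)]
    intro n
    rw [dist_eq_norm, dist_eq_norm, hT, hT, ← smul_sub]
    apply hcancel
    rw [add_sub_add_left_eq_sub, ← (hS u n).1.tsum_sub (hS v n).1]
    simp_rw [← map_sub]
    have hd : ∀ j : ℤ, ‖φ j (μ ^ j.natAbs • u j) - φ j (μ ^ j.natAbs • v j)‖ ≤
        (δ * ‖u - v‖) * μ ^ j.natAbs := fun j => by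
      refine (hφ _ _ _).trans ?_
      rw [← smul_sub, norm_smul, Real.norm_of_nonneg (hμ0 j).le, mul_assoc, mul_comm ‖u - v‖]
      have := (u - v).norm_coe_le_norm j
      rw [BoundedContinuousFunction.sub_apply] at this
      gcongr
    refine (hG.summable_and_norm_tsum_le hd n).2.trans ?_
    refine mul_le_mul_of_nonneg_right ?_ (hμ0 n).le
    have := mul_le_mul_of_nonneg_right hMδ (norm_nonneg (u - v))
    rw [show ((1 / 2 : NNReal) : ℝ) = 1 / 2 by norm_num]
    linarith
  set u := ContractingWith.fixedPoint T hcontr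
  have hu : T u = u := hcontr.fixedPoint_isFixedPt
  refine ⟨fun n => μ ^ n.natAbs • u n, ⟨‖u‖, fun n => ?_⟩, fun n => ?_⟩
  · rw [norm_smul, Real.norm_of_nonneg (hμ0 n).le, mul_comm]
    have := u.norm_coe_le_norm n
    gcongr
  · have h1 : μ ^ n.natAbs • u n = b n + ∑' j, G n j (φ j (μ ^ j.natAbs • u j)) := by
      conv_lhs => rw [← hu, hT]
      rw [smul_inv_smul₀ (hμ0 n).ne']
    simp only [h1, add_sub_cancel_left]
    convert (hS u n).1.hasSum using 1

theorem WeightedKernelBound.compL (hG : WeightedKernelBound G μ M) (hμ : 1 ≤ μ) :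
    WeightedKernelBound (fun n j => ContinuousLinearMap.compL ℝ V V V (G n j)) μ M := by
  intro n
  have hle : ∀ j : ℤ, ‖ContinuousLinearMap.compL ℝ V V V (G n j)‖ * μ ^ j.natAbs ≤
      ‖G n j‖ * μ ^ j.natAbs := fun j => by
    gcongr
    refine ContinuousLinearMap.opNorm_le_bound _ (norm_nonneg _) fun T => ?_
    exact ContinuousLinearMap.opNorm_comp_le _ _
  have hs : Summable fun j : ℤ => ‖ContinuousLinearMap.compL ℝ V V V (G n j)‖ * μ ^ j.natAbs :=
    Summable.of_nonneg_of_le (fun j => by positivity) hle (hG n).1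
  exact ⟨hs, (hs.tsum_le_tsum hle (hG n).1).trans (hG n).2⟩

theorem WeightedKernelBound.of_le_geometric {C q : ℝ} (hq0 : 0 ≤ q) (hq1 : q < 1) (hμ : 1 ≤ μ)
    (h : ∀ n j : ℤ, ‖G n j‖ * μ ^ j.natAbs ≤ C * q ^ (n - j).natAbs * μ ^ n.natAbs) :
    WeightedKernelBound G μ (C * ∑' m : ℤ, q ^ m.natAbs) := by
  have hsum : Summable fun m : ℤ => q ^ m.natAbs := by
    refine Summable.of_nat_of_neg ?_ ?_ <;> simpa using summable_geometric_of_lt_one hq0 hq1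
  intro n
  have hs : HasSum (fun j : ℤ => C * q ^ (n - j).natAbs * μ ^ n.natAbs)
      ((C * ∑' m : ℤ, q ^ m.natAbs) * μ ^ n.natAbs) :=
    (((Equiv.subLeft n).hasSum_iff.mpr hsum.hasSum).mul_left C).mul_right _
  have hs' : Summable fun j : ℤ => ‖G n j‖ * μ ^ j.natAbs :=
    Summable.of_nonneg_of_le (fun j => by positivity) (h n) hs.summable
  exact ⟨hs', (hs'.tsum_le_tsum (h n) hs.summable).trans_eq hs.tsum_eq⟩

end Kernel

section Green

variable {d : ℕ}

/-- The combination of projections entering the Green kernel of `x ↦ x (n + 1) - A (x n)`: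
the stable part is summed from `-∞`, the center part from `0`, the unstable part from `+∞`. -/
def greenCoeff (P : TripleProj d) (n j : ℤ) : Euc d →L[ℝ] Euc d :=
  (if j < n then P.πs else 0) +
    (if 0 ≤ j ∧ j < n then P.πc else if n ≤ j ∧ j < 0 then -P.πc else 0) +
    (if n ≤ j then -P.πu else 0)

/-- The Green kernel of the difference operator `x ↦ x (n + 1) - A (x n)`. -/
def greenKernel (P : TripleProj d) (A : Euc d ≃L[ℝ] Euc d) (n j : ℤ) : Euc d →L[ℝ] Euc d :=
  ((A ^ (n - 1 - j) : Euc d ≃L[ℝ] Euc d) : Euc d →L[ℝ] Euc d).comp (greenCoeff P n j)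

theorem greenCoeff_succ (P : TripleProj d) (n j : ℤ) :
    greenCoeff P (n + 1) j =
      greenCoeff P n j + if j = n then ContinuousLinearMap.id ℝ (Euc d) else 0 := by
  unfold greenCoeff
  rw [← P.sum_eq]
  rcases lt_trichotomy j n with h | rfl | h
  · rw [if_pos (show j < n + 1 by omega), if_pos h, if_neg (show ¬ n + 1 ≤ j by omega),
      if_neg (show ¬ n ≤ j by omega), if_neg h.ne, add_zero]
    split_ifs <;> first | omega | abel
  · rw [if_pos (show j < j + 1 by omega), if_neg (lt_irrefl _),
      if_neg (show ¬ j + 1 ≤ j by omega), if_pos le_rfl, if_pos rfl]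
    split_ifs <;> first | omega | abel
  · rw [if_neg (show ¬ j < n + 1 by omega), if_neg (show ¬ j < n by omega),
      if_pos (show n + 1 ≤ j by omega), if_pos h.le, if_neg h.ne', add_zero]
    split_ifs <;> first | omega | abel

theorem comp_greenCoeff_zero (P : TripleProj d) (j : ℤ) :
    P.πc.comp (greenCoeff P 0 j) = 0 := by
  unfold greenCoeff
  rw [if_neg (show ¬ (0 ≤ j ∧ j < 0) by omega), if_neg (show ¬ (0 ≤ j ∧ j < 0) by omega)]
  split_ifs <;> simp [P.comp_cs, P.comp_cu]

theorem zpow_apply_comm {A : Euc d ≃L[ℝ] Euc d} {Q : Euc d →L[ℝ] Euc d}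
    (h : (A : Euc d →L[ℝ] Euc d).comp Q = Q.comp (A : Euc d →L[ℝ] Euc d)) (m : ℤ) (x : Euc d) :
    (A ^ m) (Q x) = Q ((A ^ m) x) := by
  have hA : ∀ x, A (Q x) = Q (A x) := fun x => by simpa using DFunLike.congr_fun h x
  have hA' : ∀ x, A⁻¹ (Q x) = Q (A⁻¹ x) := fun x => by
    change A.symm (Q x) = Q (A.symm x)
    rw [ContinuousLinearEquiv.symm_apply_eq, hA, ContinuousLinearEquiv.apply_symm_apply]
  induction m generalizing x with
  | zero => rfl
  | succ i ih =>
    rw [zpow_add_one]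
    change (A ^ (i : ℤ)) (A (Q x)) = Q ((A ^ (i : ℤ)) (A x))
    rw [hA, ih]
  | pred i ih =>
    rw [zpow_sub_one]
    change (A ^ (-i : ℤ)) (A⁻¹ (Q x)) = Q ((A ^ (-i : ℤ)) (A⁻¹ x))
    rw [hA', ih]

theorem coe_zpow_natCast (A : Euc d ≃L[ℝ] Euc d) (m : ℕ) :
    ((A ^ (m : ℤ) : Euc d ≃L[ℝ] Euc d) : Euc d →L[ℝ] Euc d) = (A : Euc d →L[ℝ] Euc d) ^ m := by
  induction m with
  | zero => rfl
  | succ m ih =>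
    rw [pow_succ, ← ih]
    push_cast
    rw [zpow_add_one]
    rfl

theorem coe_zpow_neg_natCast (A : Euc d ≃L[ℝ] Euc d) (m : ℕ) :
    ((A ^ (-(m : ℤ)) : Euc d ≃L[ℝ] Euc d) : Euc d →L[ℝ] Euc d) =
      (A.symm : Euc d →L[ℝ] Euc d) ^ m := by
  rw [← coe_zpow_natCast, zpow_neg, ← inv_zpow]
  rfl

/-- A trichotomy for `A` with respect to `P`: contraction by `θ` forwards on the stable part and
backwards on the unstable part, and growth at most `ν ^ |m|` on the center part. -/
structure HasTrichotomy (P : TripleProj d) (A : Euc d ≃L[ℝ] Euc d) (K θ ν : ℝ) : Prop where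
  stable : ∀ m : ℕ,
    ‖((A ^ (m : ℤ) : Euc d ≃L[ℝ] Euc d) : Euc d →L[ℝ] Euc d).comp P.πs‖ ≤ K * θ ^ m
  unstable : ∀ m : ℕ,
    ‖((A ^ (-(m : ℤ)) : Euc d ≃L[ℝ] Euc d) : Euc d →L[ℝ] Euc d).comp P.πu‖ ≤ K * θ ^ m
  center : ∀ m : ℤ,
    ‖((A ^ m : Euc d ≃L[ℝ] Euc d) : Euc d →L[ℝ] Euc d).comp P.πc‖ ≤ K * ν ^ m.natAbs
  theta_pos : 0 < θ
  theta_lt_one : θ < 1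
  one_le_nu : 1 ≤ ν

variable {P : TripleProj d} {A : Euc d ≃L[ℝ] Euc d} {K θ ν : ℝ}

theorem HasTrichotomy.const_nonneg (h : HasTrichotomy P A K θ ν) : 0 ≤ K := by
  simpa using (norm_nonneg _).trans (h.stable 0)

theorem HasTrichotomy.norm_greenKernel_mul_le (h : HasTrichotomy P A K θ ν) {μ q : ℝ}
    (hμ : 1 ≤ μ) (hq : 0 ≤ q) (hθ : θ * μ ≤ q) (hν : ν ≤ q * μ) (n j : ℤ) :
    ‖greenKernel P A n j‖ * μ ^ j.natAbs ≤
      (2 * (K / θ) + K * ν) * q ^ (n - j).natAbs * μ ^ n.natAbs := by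
  have hK := h.const_nonneg
  have hθ0 := h.theta_pos
  have hν1 := h.one_le_nu
  have hμ0 : 0 < μ := by linarith
  set Am := ((A ^ (n - 1 - j) : Euc d ≃L[ℝ] Euc d) : Euc d →L[ℝ] Euc d) with hAm
  have hyp : θ ^ (n - j).natAbs * μ ^ j.natAbs ≤ q ^ (n - j).natAbs * μ ^ n.natAbs := by
    calc θ ^ (n - j).natAbs * μ ^ j.natAbs
        ≤ θ ^ (n - j).natAbs * μ ^ ((n - j).natAbs + n.natAbs) := by
          gcongr
          omega
      _ = (θ * μ) ^ (n - j).natAbs * μ ^ n.natAbs := by rw [pow_add, mul_pow]; ring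
      _ ≤ _ := by gcongr
  have hs : ‖Am.comp (if j < n then P.πs else 0)‖ * μ ^ j.natAbs ≤
      (K / θ) * q ^ (n - j).natAbs * μ ^ n.natAbs := by
    split_ifs with hj
    · obtain ⟨m, hm⟩ : ∃ m : ℕ, n - 1 - j = m := ⟨(n - 1 - j).toNat, by omega⟩
      have hm' : (n - j).natAbs = m + 1 := by omega
      have := h.stable m
      rw [← hm, ← hAm] at this
      calc _ ≤ K * θ ^ m * μ ^ j.natAbs := by gcongr
        _ = K / θ * (θ ^ (n - j).natAbs * μ ^ j.natAbs) := by
          rw [hm', pow_succ]; field_simp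
        _ ≤ K / θ * (q ^ (n - j).natAbs * μ ^ n.natAbs) := by gcongr
        _ = _ := by ring
    · rw [ContinuousLinearMap.comp_zero, norm_zero, zero_mul]
      positivity
  have hu : ‖Am.comp (if n ≤ j then -P.πu else 0)‖ * μ ^ j.natAbs ≤
      (K / θ) * q ^ (n - j).natAbs * μ ^ n.natAbs := by
    split_ifs with hj
    · obtain ⟨m, hm⟩ : ∃ m : ℕ, n - 1 - j = -(m : ℤ) := ⟨(j + 1 - n).toNat, by omega⟩
      have hm' : m = (n - j).natAbs + 1 := by omega
      have := h.unstable m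
      rw [← hm, ← hAm] at this
      rw [ContinuousLinearMap.comp_neg, norm_neg]
      calc _ ≤ K * θ ^ m * μ ^ j.natAbs := by gcongr
        _ = K * θ * (θ ^ (n - j).natAbs * μ ^ j.natAbs) := by
          rw [hm', pow_succ]; ring
        _ ≤ K / θ * (q ^ (n - j).natAbs * μ ^ n.natAbs) := by
          gcongr
          rw [le_div_iff₀ hθ0, mul_assoc]
          have := h.theta_lt_one
          nlinarith [mul_nonneg hK hθ0.le]
        _ = _ := by ring
    · rw [ContinuousLinearMap.comp_zero, norm_zero, zero_mul]
      positivity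
  have hc0 : (n - j).natAbs + j.natAbs = n.natAbs →
      ‖Am.comp P.πc‖ * μ ^ j.natAbs ≤ K * ν * q ^ (n - j).natAbs * μ ^ n.natAbs := by
    intro hn
    have h1 : ‖Am.comp P.πc‖ ≤ K * (ν * ν ^ (n - j).natAbs) := by
      refine (h.center _).trans ?_
      rw [← pow_succ']
      gcongr
      omega
    calc _ ≤ K * (ν * ν ^ (n - j).natAbs) * μ ^ j.natAbs := by gcongr
      _ ≤ K * (ν * (q * μ) ^ (n - j).natAbs) * μ ^ j.natAbs := by gcongr
      _ = _ := by rw [← hn, pow_add, mul_pow]; ring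
  have hc : ‖Am.comp (if 0 ≤ j ∧ j < n then P.πc else
      if n ≤ j ∧ j < 0 then -P.πc else 0)‖ * μ ^ j.natAbs ≤
      K * ν * q ^ (n - j).natAbs * μ ^ n.natAbs := by
    split_ifs with h1 h2
    · exact hc0 (by omega)
    · rw [ContinuousLinearMap.comp_neg, norm_neg]
      exact hc0 (by omega)
    · rw [ContinuousLinearMap.comp_zero, norm_zero, zero_mul]
      positivity
  have hsum : ‖greenKernel P A n j‖ ≤ ‖Am.comp (if j < n then P.πs else 0)‖ +
      ‖Am.comp (if 0 ≤ j ∧ j < n then P.πc else if n ≤ j ∧ j < 0 then -P.πc else 0)‖ +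
      ‖Am.comp (if n ≤ j then -P.πu else 0)‖ := by
    rw [greenKernel, greenCoeff, ContinuousLinearMap.comp_add, ContinuousLinearMap.comp_add]
    exact norm_add₃_le
  calc _ ≤ _ * μ ^ j.natAbs := mul_le_mul_of_nonneg_right hsum (by positivity)
    _ ≤ _ := by
      rw [add_mul, add_mul]
      linarith

theorem projCenter_greenKernel_zero
    (hAc : (A : Euc d →L[ℝ] Euc d).comp P.πc = P.πc.comp (A : Euc d →L[ℝ] Euc d))
    (j : ℤ) (v : Euc d) : P.πc (greenKernel P A 0 j v) = 0 := by
  have h := DFunLike.congr_fun (comp_greenCoeff_zero P j) v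
  simp only [ContinuousLinearMap.comp_apply, zero_apply] at h
  simp only [greenKernel, ContinuousLinearMap.comp_apply, ContinuousLinearEquiv.coe_coe]
  rw [← zpow_apply_comm hAc, h, map_zero]

theorem hasSum_greenKernel_succ {h : ℤ → Euc d} {n : ℤ} {y : Euc d}
    (hy : HasSum (fun j => greenKernel P A n j (h j)) y) :
    HasSum (fun j => greenKernel P A (n + 1) j (h j)) (A y + h n) := by
  have h1 := (hy.mapL (A : Euc d →L[ℝ] Euc d)).add (hasSum_ite_eq n (h n))
  refine h1.congr_fun fun j => ?_
  simp only [greenKernel, greenCoeff_succ, ContinuousLinearMap.comp_apply,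
    ContinuousLinearEquiv.coe_coe, add_apply, map_add]
  have hz : A ^ (n + 1 - 1 - j) = A * A ^ (n - 1 - j) := by
    rw [← zpow_one_add]; congr 1; ring
  rw [hz]
  refine congrArg₂ (· + ·) rfl ?_
  by_cases hj : j = n
  · subst hj
    rw [if_pos rfl, if_pos rfl, ← hz, show j + 1 - 1 - j = 0 by ring, zpow_zero]
    rfl
  · rw [if_neg hj, if_neg hj]
    simp

theorem HasTrichotomy.eq_zero_of_orbit (h : HasTrichotomy P A K θ ν)
    (hAs : (A : Euc d →L[ℝ] Euc d).comp P.πs = P.πs.comp (A : Euc d →L[ℝ] Euc d))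
    (hAu : (A : Euc d →L[ℝ] Euc d).comp P.πu = P.πu.comp (A : Euc d →L[ℝ] Euc d))
    {μ B : ℝ} (hμ : 1 ≤ μ) (hθ : θ * μ < 1) {z : ℤ → Euc d} (hz : ∀ n, z (n + 1) = A (z n))
    (hB : ∀ n, ‖z n‖ ≤ B * μ ^ n.natAbs) (hc : P.πc (z 0) = 0) (n : ℤ) : z n = 0 := by
  have hK := h.const_nonneg
  have hθ0 := h.theta_pos
  have horb : ∀ m n : ℤ, z (n + m) = (A ^ m) (z n) := by
    intro m
    induction m with
    | zero => intro n; rw [add_zero]; rfl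
    | succ i ih =>
      intro n
      rw [← add_assoc, hz, ih, add_comm (i : ℤ), zpow_one_add]
      rfl
    | pred i ih =>
      intro n
      have h1 := hz (n + (-(i : ℤ) - 1))
      rw [show n + (-(i : ℤ) - 1) + 1 = n + -i by ring, ih] at h1
      rw [show -(i : ℤ) - 1 = -1 + -i by ring, zpow_add, zpow_neg_one]
      change _ = A.symm ((A ^ (-(i : ℤ))) (z n))
      rw [h1, show -(i : ℤ) - 1 = -1 + -i by ring, ContinuousLinearEquiv.symm_apply_apply]
  have hlim : Tendsto (fun m : ℕ => K * B * (θ * μ) ^ m) atTop (𝓝 0) := by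
    simpa using (tendsto_pow_atTop_nhds_zero_of_lt_one (by positivity) hθ).const_mul (K * B)
  have hs : P.πs (z 0) = 0 := by
    rw [← norm_le_zero_iff]
    refine ge_of_tendsto' hlim fun m => ?_
    have h1 := horb m (-m)
    rw [neg_add_cancel] at h1
    rw [h1, ← zpow_apply_comm hAs]
    have h2 := ContinuousLinearMap.le_of_opNorm_le _ (h.stable m) (z (-m))
    refine h2.trans ?_
    have h3 := hB (-m)
    rw [Int.natAbs_neg, Int.natAbs_natCast] at h3
    calc _ ≤ K * θ ^ m * (B * μ ^ m) := by gcongr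
      _ = _ := by rw [mul_pow]; ring
  have hu : P.πu (z 0) = 0 := by
    rw [← norm_le_zero_iff]
    refine ge_of_tendsto' hlim fun m => ?_
    have h1 := horb (-m) m
    rw [add_neg_cancel] at h1
    rw [h1, ← zpow_apply_comm hAu]
    have h2 := ContinuousLinearMap.le_of_opNorm_le _ (h.unstable m) (z m)
    refine h2.trans ?_
    have h3 := hB m
    rw [Int.natAbs_natCast] at h3
    calc _ ≤ K * θ ^ m * (B * μ ^ m) := by gcongr
      _ = _ := by rw [mul_pow]; ring
  have h0 : z 0 = 0 := by
    have h1 := DFunLike.congr_fun P.sum_eq (z 0)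
    simp only [add_apply, hs, hc, hu, ContinuousLinearMap.id_apply] at h1
    simpa using h1.symm
  have := horb n 0
  rwa [zero_add, h0, map_zero] at this

end Green


section CenterManifold

theorem norm_sub_sub_fderiv_le_of_holder {V : Type*} [NormedAddCommGroup V] [NormedSpace ℝ V]
    {f : V → V} {δ α : ℝ} (hδ : 0 ≤ δ) (hα : 0 ≤ α) (hf : Differentiable ℝ f)
    (hH : ∀ x y, ‖fderiv ℝ f x - fderiv ℝ f y‖ ≤ δ * ‖x - y‖ ^ α) (v w : V) :
    ‖f v - f w - fderiv ℝ f w (v - w)‖ ≤ δ * ‖v - w‖ ^ α * ‖v - w‖ := by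
  refine (convex_closedBall w ‖v - w‖).norm_image_sub_le_of_norm_fderiv_le'
    (fun x _ => hf x) (fun x hx => ?_) (Metric.mem_closedBall_self (norm_nonneg _))
    (by rw [mem_closedBall_iff_norm])
  rw [mem_closedBall_iff_norm] at hx
  refine (hH x w).trans ?_
  gcongr

theorem tendsto_const_mul_norm_sub_rpow {V : Type*} [SeminormedAddCommGroup V] {α : ℝ}
    (hα : 0 < α) (C : ℝ) (x : V) : Tendsto (fun y => C * ‖y - x‖ ^ α) (𝓝 x) (𝓝 0) := by
  have h := ((tendsto_norm_sub_self x).rpow_const (Or.inr hα.le)).const_mul C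
  rwa [Real.zero_rpow hα.ne', mul_zero] at h

theorem hasFDerivAt_of_norm_le_rpow {V W : Type*} [NormedAddCommGroup V] [NormedSpace ℝ V]
    [NormedAddCommGroup W] [NormedSpace ℝ W] {g : V → W} {g' : V →L[ℝ] W} {x : V} {C α : ℝ}
    (hα : 0 < α) (h : ∀ y, ‖g y - g x - g' (y - x)‖ ≤ C * ‖y - x‖ ^ α * ‖y - x‖) :
    HasFDerivAt g g' x := by
  refine .of_isLittleO (Asymptotics.isLittleO_iff.mpr fun c hc => ?_)
  filter_upwards [(tendsto_const_mul_norm_sub_rpow hα C x).eventually_lt_const hc] with y hy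
  exact (h y).trans (by gcongr)

theorem contDiff_one_of_holder {V W : Type*} [NormedAddCommGroup V] [NormedSpace ℝ V]
    [NormedAddCommGroup W] [NormedSpace ℝ W] {g : V → W} {g' : V → V →L[ℝ] W} {C α : ℝ}
    (hα : 0 < α) (hg : ∀ x, HasFDerivAt g (g' x) x)
    (hH : ∀ x y, ‖g' x - g' y‖ ≤ C * ‖x - y‖ ^ α) : ContDiff ℝ 1 g := by
  rw [contDiff_one_iff_hasFDerivAt]
  refine ⟨g', continuous_iff_continuousAt.mpr fun x => ?_, hg⟩
  rw [ContinuousAt, tendsto_iff_norm_sub_tendsto_zero]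
  exact squeeze_zero (fun _ => norm_nonneg _) (fun y => hH y x)
    (tendsto_const_mul_norm_sub_rpow hα C x)

variable {d : ℕ} {P : TripleProj d} {A : Euc d ≃L[ℝ] Euc d} {K θ ν : ℝ}

theorem HasTrichotomy.exists_centerManifold (h : HasTrichotomy P A K θ ν)
    (hAs : (A : Euc d →L[ℝ] Euc d).comp P.πs = P.πs.comp (A : Euc d →L[ℝ] Euc d))
    (hAc : (A : Euc d →L[ℝ] Euc d).comp P.πc = P.πc.comp (A : Euc d →L[ℝ] Euc d))
    (hAu : (A : Euc d →L[ℝ] Euc d).comp P.πu = P.πu.comp (A : Euc d →L[ℝ] Euc d))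
    {γ α M δ : ℝ} (hγ : 1 ≤ γ) (hν : ν ≤ γ) (hθ : θ * γ < 1) (hα : 0 < α)
    (hG : WeightedKernelBound (greenKernel P A) γ M)
    (hG' : WeightedKernelBound (greenKernel P A) (γ ^ (1 + α)) M)
    (hδ : 0 ≤ δ) (hMδ : M * δ ≤ 1 / 2) {F f : Euc d → Euc d} (hF : ∀ x, F x = A x + f x)
    (hf0 : f 0 = 0) (hDf0 : fderiv ℝ f 0 = 0) (hfd : Differentiable ℝ f)
    (hDf : ∀ x, ‖fderiv ℝ f x‖ ≤ δ)
    (hDfH : ∀ x y, ‖fderiv ℝ f x - fderiv ℝ f y‖ ≤ δ * ‖x - y‖ ^ α) :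
    ∃ wc : Euc d → Euc d,
      ContDiff ℝ 1 wc ∧
      (∃ C : ℝ, ∀ x y, ‖fderiv ℝ wc x - fderiv ℝ wc y‖ ≤ C * ‖x - y‖ ^ α) ∧
      wc 0 = 0 ∧ fderiv ℝ wc 0 = 0 ∧
      (∀ x, P.πc (wc x) = 0) ∧ (∀ x, wc x = wc (P.πc x)) ∧
      F '' ((fun c => c + wc c) '' Set.range ⇑P.πc)
        = (fun c => c + wc c) '' Set.range ⇑P.πc := by
  have hK := h.const_nonneg
  have hγ0 : 0 < γ := by linarith
  have hM := hG.nonneg hγ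
  have hγ' : 1 ≤ γ ^ (1 + α) := Real.one_le_rpow hγ (by linarith)
  have hweight : ∀ k : ℕ, (γ ^ k) ^ α * γ ^ k = (γ ^ (1 + α)) ^ k := fun k => by
    rw [add_comm, Real.rpow_add_one hγ0.ne', mul_pow, ← Real.rpow_natCast γ k,
      ← Real.rpow_mul hγ0.le, ← Real.rpow_natCast (γ ^ α) k, ← Real.rpow_mul hγ0.le,
      mul_comm α]
  have hweight_le : ∀ k : ℕ, γ ^ k ≤ (γ ^ (1 + α)) ^ k := fun k => by
    gcongr
    exact Real.self_le_rpow_of_one_le hγ (by linarith)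
  have hproj : ∀ ξ, P.πc (P.πc ξ) = P.πc ξ := fun ξ => DFunLike.congr_fun P.idem_c ξ
  set G := greenKernel P A with hGdef
  set L : ℤ → Euc d →L[ℝ] Euc d := fun n =>
    ((A ^ n : Euc d ≃L[ℝ] Euc d) : Euc d →L[ℝ] Euc d).comp P.πc with hLdef
  have hL : ∀ n, ‖L n‖ ≤ K * γ ^ n.natAbs := fun n => by
    refine (h.center n).trans ?_
    have := h.one_le_nu
    gcongr
  have hL0 : ∀ ξ, L 0 ξ = P.πc ξ := fun ξ => rfl
  have hLsucc : ∀ n ξ, L (n + 1) ξ = A (L n ξ) := fun n ξ => by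
    simp only [hLdef]
    rw [add_comm, zpow_one_add]
    rfl
  have hLproj : ∀ n ξ, L n (P.πc ξ) = L n ξ := fun n ξ => by
    simp only [hLdef, ContinuousLinearMap.comp_apply, hproj]
  have hLap : ∀ n ξ, ‖L n ξ‖ ≤ K * ‖ξ‖ * γ ^ n.natAbs := fun n ξ => by
    refine ((L n).le_of_opNorm_le (hL n) ξ).trans (le_of_eq ?_)
    ring
  have hfLip : ∀ v w, ‖f v - f w‖ ≤ δ * ‖v - w‖ := fun v w =>
    convex_univ.norm_image_sub_le_of_norm_fderiv_le (fun x _ => hfd x) (fun x _ => hDf x)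
      (Set.mem_univ w) (Set.mem_univ v)
  -- comparison of two solutions of the summation equation
  have hcmp : ∀ (x₁ x₂ b₁ b₂ : ℤ → Euc d) (B₁ B₂ a : ℝ), (∀ n, ‖x₁ n‖ ≤ B₁ * γ ^ n.natAbs) →
      (∀ n, ‖x₂ n‖ ≤ B₂ * γ ^ n.natAbs) →
      (∀ n, HasSum (fun j => G n j (f (x₁ j))) (x₁ n - b₁ n)) →
      (∀ n, HasSum (fun j => G n j (f (x₂ j))) (x₂ n - b₂ n)) →
      (∀ n, ‖b₁ n - b₂ n‖ ≤ a * γ ^ n.natAbs) →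
      ∀ n, ‖x₁ n - x₂ n‖ ≤ 2 * a * γ ^ n.natAbs := by
    intro x₁ x₂ b₁ b₂ B₁ B₂ a h₁ h₂ hs₁ hs₂ hb n
    have := hG.norm_le_of_hasSum hγ hδ le_rfl hMδ (r := fun n => x₁ n - x₂ n)
      (b := fun n => b₁ n - b₂ n) (h := fun j => f (x₁ j) - f (x₂ j)) (B := B₁ + B₂) (a := a)
      (R := 0) (fun n => ?_) hb (fun j => ?_) (fun n => ?_) n
    · simpa using this
    · rw [add_mul]
      exact (norm_sub_le _ _).trans (add_le_add (h₁ n) (h₂ n))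
    · simpa using hfLip (x₁ j) (x₂ j)
    · simp only [map_sub]
      rw [sub_sub_sub_comm]
      exact (hs₁ n).sub (hs₂ n)
  have hex : ∀ ξ, ∃ x : ℤ → Euc d, (∃ B : ℝ, ∀ n, ‖x n‖ ≤ B * γ ^ n.natAbs) ∧
      ∀ n, HasSum (fun j => G n j (f (x j))) (x n - L n ξ) := fun ξ =>
    hG.exists_hasSum hγ hδ hMδ (b := fun n => L n ξ) (φ := fun _ => f) (fun n => hLap n ξ)
      (fun _ => hf0) (fun _ => hfLip)
  choose x hxB hx using hex
  have huniq : ∀ (y : ℤ → Euc d) (B : ℝ) (ξ : Euc d), (∀ n, ‖y n‖ ≤ B * γ ^ n.natAbs) →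
      (∀ n, HasSum (fun j => G n j (f (y j))) (y n - L n ξ)) → y = x ξ := by
    intro y B ξ hB hy
    obtain ⟨B', hB'⟩ := hxB ξ
    funext n
    have := hcmp y (x ξ) _ _ B B' 0 hB hB' hy (hx ξ) (fun n => by simp) n
    rw [mul_zero, zero_mul, norm_le_zero_iff, sub_eq_zero] at this
    exact this
  have hxLip : ∀ ξ η n, ‖x ξ n - x η n‖ ≤ 2 * K * ‖ξ - η‖ * γ ^ n.natAbs := by
    intro ξ η n
    obtain ⟨B, hB⟩ := hxB ξ
    obtain ⟨B', hB'⟩ := hxB η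
    rw [mul_assoc 2]
    refine hcmp (x ξ) (x η) _ _ B B' _ hB hB' (hx ξ) (hx η) (fun n => ?_) n
    rw [← map_sub]
    exact hLap n _
  have hxproj : ∀ ξ, x (P.πc ξ) = x ξ := fun ξ => by
    obtain ⟨B, hB⟩ := hxB (P.πc ξ)
    refine huniq _ B ξ hB fun n => ?_
    rw [← hLproj]
    exact hx _ n
  have hx0 : ∀ n, x 0 n = 0 := fun n => by
    rw [← huniq (fun _ => 0) 0 0 (fun n => by simp) (fun n => by simp [hf0])]
  -- the derivative of the solution with respect to the center coordinate
  have hexY : ∀ ξ, ∃ Y : ℤ → Euc d →L[ℝ] Euc d, (∃ B : ℝ, ∀ n, ‖Y n‖ ≤ B * γ ^ n.natAbs) ∧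
      ∀ n, HasSum (fun j => ContinuousLinearMap.compL ℝ (Euc d) (Euc d) (Euc d) (G n j)
        ((fderiv ℝ f (x ξ j)).comp (Y j))) (Y n - L n) := fun ξ =>
    (hG.compL hγ).exists_hasSum hγ hδ hMδ (b := L)
      (φ := fun j T => (fderiv ℝ f (x ξ j)).comp T) hL
      (fun _ => ContinuousLinearMap.comp_zero _) (fun j S T => by
        rw [← ContinuousLinearMap.comp_sub]
        refine (ContinuousLinearMap.opNorm_comp_le _ _).trans ?_
        gcongr
        exact hDf _)
  choose Y hYB hY using hexY
  have hYle : ∀ ξ n, ‖Y ξ n‖ ≤ 2 * K * γ ^ n.natAbs := by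
    intro ξ n
    obtain ⟨B, hB⟩ := hYB ξ
    have := (hG.compL hγ).norm_le_of_hasSum hγ hδ le_rfl hMδ (a := K) (R := 0) hB hL
      (fun j => ?_) (hY ξ) n
    · simpa using this
    · rw [zero_mul, add_zero]
      refine (ContinuousLinearMap.opNorm_comp_le _ _).trans ?_
      gcongr
      exact hDf _
  have hpow : ∀ ξ η j, ‖x ξ j - x η j‖ ^ α ≤ (2 * K * ‖ξ - η‖) ^ α * (γ ^ j.natAbs) ^ α := by
    intro ξ η j
    rw [← Real.mul_rpow (by positivity) (by positivity)]
    exact Real.rpow_le_rpow (norm_nonneg _) (hxLip ξ η j) hα.le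
  have hYH : ∀ ξ η n, ‖Y ξ n - Y η n‖ ≤
      2 * (0 + M * (δ * (2 * K * ‖ξ - η‖) ^ α * (2 * K))) * (γ ^ (1 + α)) ^ n.natAbs := by
    intro ξ η n
    refine (hG'.compL hγ').norm_le_of_hasSum hγ' hδ (by positivity) hMδ
      (r := fun n => Y ξ n - Y η n) (b := fun _ => 0)
      (h := fun j => (fderiv ℝ f (x ξ j)).comp (Y ξ j) - (fderiv ℝ f (x η j)).comp (Y η j))
      (B := 2 * K + 2 * K) (fun n => ?_) (fun n => by simp) (fun j => ?_) (fun n => ?_) n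
    · refine (norm_sub_le _ _).trans ?_
      rw [add_mul]
      have := hweight_le n.natAbs
      refine add_le_add ((hYle ξ n).trans ?_) ((hYle η n).trans ?_) <;> gcongr
    · have hsplit : (fderiv ℝ f (x ξ j)).comp (Y ξ j) - (fderiv ℝ f (x η j)).comp (Y η j) =
          (fderiv ℝ f (x ξ j)).comp (Y ξ j - Y η j) +
            (fderiv ℝ f (x ξ j) - fderiv ℝ f (x η j)).comp (Y η j) := by
        rw [ContinuousLinearMap.comp_sub, ContinuousLinearMap.sub_comp]
        abel
      rw [hsplit]
      refine (norm_add_le _ _).trans (add_le_add ?_ ?_)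
      · refine (ContinuousLinearMap.opNorm_comp_le _ _).trans ?_
        gcongr
        exact hDf _
      · refine (ContinuousLinearMap.opNorm_comp_le _ _).trans ?_
        rw [← hweight]
        calc _ ≤ (δ * ((2 * K * ‖ξ - η‖) ^ α * (γ ^ j.natAbs) ^ α)) *
              (2 * K * γ ^ j.natAbs) := by
              gcongr
              · refine (hDfH _ _).trans ?_
                gcongr
                exact hpow ξ η j
              · exact hYle η j
          _ = _ := by ring
    · have := (hY ξ n).sub (hY η n)
      simp only [← map_sub] at this
      rwa [sub_sub_sub_cancel_right, ← sub_zero (Y ξ n - Y η n)] at this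
  have hxD : ∀ ξ η n, ‖x η n - x ξ n - Y ξ n (η - ξ)‖ ≤
      2 * (0 + M * (δ * (2 * K * ‖η - ξ‖) ^ α * (2 * K * ‖η - ξ‖))) *
        (γ ^ (1 + α)) ^ n.natAbs := by
    intro ξ η n
    refine hG'.norm_le_of_hasSum hγ' hδ (by positivity) hMδ
      (r := fun n => x η n - x ξ n - Y ξ n (η - ξ)) (b := fun _ => 0)
      (h := fun j => f (x η j) - f (x ξ j) - fderiv ℝ f (x ξ j) (Y ξ j (η - ξ)))
      (B := 2 * K * ‖η - ξ‖ + 2 * K * ‖η - ξ‖) (fun n => ?_) (fun n => by simp)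
      (fun j => ?_) (fun n => ?_) n
    · refine (norm_sub_le _ _).trans ?_
      rw [add_mul]
      have := hweight_le n.natAbs
      refine add_le_add ((hxLip η ξ n).trans (by gcongr)) ?_
      refine ((Y ξ n).le_of_opNorm_le (hYle ξ n) _).trans ?_
      rw [mul_right_comm]
      gcongr
    · have hsplit : f (x η j) - f (x ξ j) - fderiv ℝ f (x ξ j) (Y ξ j (η - ξ)) =
          fderiv ℝ f (x ξ j) (x η j - x ξ j - Y ξ j (η - ξ)) +
            (f (x η j) - f (x ξ j) - fderiv ℝ f (x ξ j) (x η j - x ξ j)) := by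
        rw [map_sub (fderiv ℝ f (x ξ j)) (x η j - x ξ j)]
        abel
      rw [hsplit]
      refine (norm_add_le _ _).trans (add_le_add ?_ ?_)
      · exact (fderiv ℝ f (x ξ j)).le_of_opNorm_le (hDf _) _
      · refine (norm_sub_sub_fderiv_le_of_holder hδ hα.le hfd hDfH _ _).trans ?_
        rw [← hweight]
        calc _ ≤ (δ * ((2 * K * ‖η - ξ‖) ^ α * (γ ^ j.natAbs) ^ α)) *
              (2 * K * ‖η - ξ‖ * γ ^ j.natAbs) := by
              gcongr
              · exact hpow η ξ j
              · exact hxLip η ξ j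
          _ = _ := by ring
    · have h1 := (hY ξ n).mapL (ContinuousLinearMap.apply ℝ (Euc d) (η - ξ))
      have h2 := ((hx η n).sub (hx ξ n)).sub h1
      simp only [ContinuousLinearMap.apply_apply, ContinuousLinearMap.compL_apply,
        ContinuousLinearMap.comp_apply, sub_apply, map_sub (L n), ← map_sub (G n _)] at h2
      have he : x η n - x ξ n - Y ξ n (η - ξ) - 0 = x η n - L n η - (x ξ n - L n ξ) -
          (Y ξ n (η - ξ) - (L n η - L n ξ)) := by abel
      rw [he]
      exact h2
  have hYderiv : ∀ ξ, HasFDerivAt (fun ξ => x ξ 0 - P.πc ξ) (Y ξ 0 - P.πc) ξ := by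
    intro ξ
    refine HasFDerivAt.sub ?_ P.πc.hasFDerivAt
    refine hasFDerivAt_of_norm_le_rpow (C := 2 * (M * (δ * (2 * K) ^ α * (2 * K)))) hα
      fun η => (hxD ξ η 0).trans (le_of_eq ?_)
    rw [Real.mul_rpow (by positivity) (norm_nonneg _), Int.natAbs_zero, pow_zero]
    ring
  have hHolder : ∀ ξ η, ‖(Y ξ 0 - P.πc) - (Y η 0 - P.πc)‖ ≤
      2 * (M * (δ * (2 * K) ^ α * (2 * K))) * ‖ξ - η‖ ^ α := by
    intro ξ η
    rw [sub_sub_sub_cancel_right]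
    refine (hYH ξ η 0).trans (le_of_eq ?_)
    rw [Real.mul_rpow (by positivity) (norm_nonneg _), Int.natAbs_zero, pow_zero]
    ring
  have hπ : ∀ ξ, P.πc (x ξ 0 - P.πc ξ) = 0 := by
    intro ξ
    have h1 := (hx ξ 0).mapL P.πc
    simp only [hGdef, projCenter_greenKernel_zero hAc, hL0] at h1
    exact h1.unique hasSum_zero
  -- solutions of the summation equation are exactly the orbits of slow growth
  have horbit : ∀ ξ n, x ξ (n + 1) = F (x ξ n) := by
    intro ξ n
    have h1 := (hx ξ (n + 1)).unique (hasSum_greenKernel_succ (hx ξ n))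
    rw [hLsucc, map_sub] at h1
    rw [hF, ← sub_eq_zero]
    rw [← sub_eq_zero] at h1
    rw [← h1]
    abel
  have hslow : ∀ (y : ℤ → Euc d) (B : ℝ), (∀ n, ‖y n‖ ≤ B * γ ^ n.natAbs) →
      (∀ n, y (n + 1) = F (y n)) → y = x (y 0) := by
    intro y B hB hy
    have hfy : ∀ j, ‖f (y j)‖ ≤ δ * B * γ ^ j.natAbs := fun j => by
      have h1 := hfLip (y j) 0
      rw [hf0, sub_zero, sub_zero] at h1
      have := mul_le_mul_of_nonneg_left (hB j) hδ
      linarith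
    have hS := fun n => hG.summable_and_norm_tsum_le hfy n
    set S : ℤ → Euc d := fun n => ∑' j, G n j (f (y j)) with hSdef
    have hSS : ∀ n, HasSum (fun j => G n j (f (y j))) (S n) := fun n => (hS n).1.hasSum
    have hz : ∀ n, y n - L n (y 0) - S n = 0 := by
      refine h.eq_zero_of_orbit hAs hAu hγ hθ (B := B + K * ‖y 0‖ + M * (δ * B))
        (fun n => ?_) (fun n => ?_) ?_
      · rw [(hSS (n + 1)).unique (hasSum_greenKernel_succ (hSS n)), hy, hLsucc, hF, map_sub,
          map_sub]
        abel
      · rw [add_mul, add_mul]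
        exact (norm_sub_le _ _).trans (add_le_add ((norm_sub_le _ _).trans
          (add_le_add (hB n) (hLap n _))) (hS n).2)
      · have h1 := (hSS 0).mapL P.πc
        simp only [hGdef, projCenter_greenKernel_zero hAc] at h1
        rw [map_sub, map_sub, h1.unique hasSum_zero, hL0, hproj, sub_self, sub_zero]
    refine huniq y B (y 0) hB fun n => ?_
    rw [sub_eq_zero.mp (hz n)]
    exact hSS n
  have hshift : ∀ (ξ : Euc d) (k : ℤ), ∃ η, ∀ n, x η n = x ξ (n + k) := by
    intro ξ k
    obtain ⟨B, hB⟩ := hxB ξ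
    have hB0 : 0 ≤ B := by simpa using (norm_nonneg _).trans (hB 0)
    have := hslow (fun n => x ξ (n + k)) (B * γ ^ k.natAbs) (fun n => ?_) (fun n => ?_)
    · exact ⟨_, fun n => (congrFun this n).symm⟩
    · refine (hB _).trans ?_
      rw [mul_assoc, ← pow_add]
      gcongr
      omega
    · rw [← horbit]
      congr 1
      ring
  have hset : (fun c => c + (x c 0 - P.πc c)) '' Set.range ⇑P.πc =
      Set.range fun ξ => x ξ 0 := by
    rw [← Set.range_comp]
    congr 1
    funext ξ
    simp only [Function.comp_apply, hproj, hxproj]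
    abel
  refine ⟨fun ξ => x ξ 0 - P.πc ξ, contDiff_one_of_holder hα hYderiv hHolder,
    ⟨2 * (M * (δ * (2 * K) ^ α * (2 * K))), fun ξ η => ?_⟩, by simp [hx0], ?_, hπ, fun ξ => ?_, ?_⟩
  · rw [(hYderiv ξ).fderiv, (hYderiv η).fderiv]
    exact hHolder ξ η
  · rw [(hYderiv 0).fderiv]
    have h1 := hY 0 0
    simp only [hx0, hDf0, ContinuousLinearMap.zero_comp, map_zero] at h1
    exact h1.unique hasSum_zero
  · simp only [hproj, hxproj]
  · rw [hset]
    ext v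
    constructor
    · rintro ⟨_, ⟨ξ, rfl⟩, rfl⟩
      obtain ⟨η, hη⟩ := hshift ξ 1
      exact ⟨η, by simp only [hη]; exact horbit ξ 0⟩
    · rintro ⟨ξ, rfl⟩
      obtain ⟨η, hη⟩ := hshift ξ (-1)
      refine ⟨_, ⟨η, rfl⟩, ?_⟩
      simp only [← horbit, hη]
      rfl

end CenterManifold

/-- Existence of a `C^{1,α}` center manifold for a partially hyperbolic
`C^{1,α}` diffeomorphism `F(x) = Ax + f(x)` with sufficiently small nonlinearity. -/
theorem center_manifold_exists
    {d : ℕ} (P : TripleProj d) (A : Euc d ≃L[ℝ] Euc d)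
    (hAs : (A : Euc d →L[ℝ] Euc d).comp P.πs = P.πs.comp (A : Euc d →L[ℝ] Euc d))
    (hAc : (A : Euc d →L[ℝ] Euc d).comp P.πc = P.πc.comp (A : Euc d →L[ℝ] Euc d))
    (hAu : (A : Euc d →L[ℝ] Euc d).comp P.πu = P.πu.comp (A : Euc d →L[ℝ] Euc d))
    (lsm lsp lum lup : ℝ)
    (hl1 : 0 < lsm) (hl2 : lsm < lsp) (hl3 : lsp < 1) (hl4 : 1 < lum) (hl5 : lum < lup)
    -- the eigenvalues of the stable block lie in `(lsm, lsp)` :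
    (hSf : ∃ K : ℝ, ∀ n : ℕ, ‖((A : Euc d →L[ℝ] Euc d) ^ n).comp P.πs‖ ≤ K * lsp ^ n)
    (hSb : ∃ K : ℝ, ∀ n : ℕ, ‖((A.symm : Euc d →L[ℝ] Euc d) ^ n).comp P.πs‖ ≤ K * (1 / lsm) ^ n)
    -- the eigenvalues of the unstable block lie in `(lum, lup)` :
    (hUf : ∃ K : ℝ, ∀ n : ℕ, ‖((A : Euc d →L[ℝ] Euc d) ^ n).comp P.πu‖ ≤ K * lup ^ n)
    (hUb : ∃ K : ℝ, ∀ n : ℕ, ‖((A.symm : Euc d →L[ℝ] Euc d) ^ n).comp P.πu‖ ≤ K * (1 / lum) ^ n)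
    -- all eigenvalues of the center block have modulus `1` :
    (hC : ∀ ε > (0 : ℝ), ∃ K : ℝ, ∀ n : ℕ,
      ‖((A : Euc d →L[ℝ] Euc d) ^ n).comp P.πc‖ ≤ K * (1 + ε) ^ n ∧
      ‖((A.symm : Euc d →L[ℝ] Euc d) ^ n).comp P.πc‖ ≤ K * (1 + ε) ^ n)
    (α : ℝ) (hα0 : 0 < α) (hα1 : α ≤ 1) :
    ∃ δ₀ > (0 : ℝ), ∀ (F f : Euc d → Euc d) (δf : ℝ), 0 < δf → δf ≤ δ₀ →
      (∀ x, F x = A x + f x) → Function.Bijective F →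
      f 0 = 0 → fderiv ℝ f 0 = 0 → ContDiff ℝ 1 f →
      (∀ x, ‖fderiv ℝ f x‖ ≤ δf) →
      (∀ x y, ‖fderiv ℝ f x - fderiv ℝ f y‖ ≤ δf * ‖x - y‖ ^ α) →
      ∃ wc : Euc d → Euc d,
        -- `wc` is `C^{1,α}`
        ContDiff ℝ 1 wc ∧
        (∃ C : ℝ, ∀ x y, ‖fderiv ℝ wc x - fderiv ℝ wc y‖ ≤ C * ‖x - y‖ ^ α) ∧
        wc 0 = 0 ∧ fderiv ℝ wc 0 = 0 ∧
        -- `wc` maps `X_c` into `X_su` and depends only on the center component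
        (∀ x, P.πc (wc x) = 0) ∧ (∀ x, wc x = wc (P.πc x)) ∧
        -- the graph of `wc` over `X_c` is invariant under `F`
        F '' ((fun c => c + wc c) '' Set.range ⇑P.πc)
          = (fun c => c + wc c) '' Set.range ⇑P.πc := by
  obtain ⟨Ks, hKs⟩ := hSf
  obtain ⟨Ku, hKu⟩ := hUb
  set θ := max lsp (1 / lum)
  have hθ0 : 0 < θ := lt_max_of_lt_left (hl1.trans hl2)
  have hθ1 : θ < 1 := max_lt hl3 (by rw [div_lt_one (by linarith)]; exact hl4)
  obtain ⟨t, ht⟩ : ∃ t, t = (1 - θ) / 4 := ⟨_, rfl⟩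
  have ht0 : 0 < t := by linarith
  obtain ⟨Kc, hKc⟩ := hC (t / 2) (by linarith)
  have hKs0 : 0 ≤ Ks := by simpa using (norm_nonneg _).trans (hKs 0)
  have hKu0 : 0 ≤ Ku := by simpa using (norm_nonneg _).trans (hKu 0)
  have hKc0 : 0 ≤ Kc := by simpa using (norm_nonneg _).trans (hKc 0).1
  have htri : HasTrichotomy P A (Ks + Ku + Kc) θ (1 + t / 2) :=
    { stable := fun m => by
        rw [coe_zpow_natCast]
        refine (hKs m).trans ?_
        have h1 : 0 ≤ lsp := by linarith
        gcongr
        · linarith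
        · exact le_max_left _ _
      unstable := fun m => by
        rw [coe_zpow_neg_natCast]
        refine (hKu m).trans ?_
        have h1 : 0 ≤ 1 / lum := by positivity
        gcongr
        · linarith
        · exact le_max_right _ _
      center := fun m => by
        have h1 : Kc * (1 + t / 2) ^ m.natAbs ≤ (Ks + Ku + Kc) * (1 + t / 2) ^ m.natAbs := by
          gcongr
          linarith
        refine le_trans ?_ h1
        obtain hm | hm := Int.natAbs_eq m
        · rw [hm, coe_zpow_natCast, Int.natAbs_natCast]
          exact (hKc _).1
        · rw [hm, coe_zpow_neg_natCast, Int.natAbs_neg, Int.natAbs_natCast]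
          exact (hKc _).2
      theta_pos := hθ0
      theta_lt_one := hθ1
      one_le_nu := by linarith }
  have hγ : 1 ≤ 1 + t := by linarith
  have hθγ : θ * (1 + t) ^ 2 < 1 := by
    rw [show θ = 1 - 4 * t by linarith]
    nlinarith [pow_pos ht0 2, pow_pos ht0 3]
  set q := max (θ * (1 + t) ^ 2) ((1 + t / 2) / (1 + t))
  have hq0 : 0 ≤ q := le_max_of_le_left (by positivity)
  have hq1 : q < 1 := max_lt hθγ (by rw [div_lt_one (by linarith)]; linarith)
  set M := (2 * ((Ks + Ku + Kc) / θ) + (Ks + Ku + Kc) * (1 + t / 2)) *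
    ∑' m : ℤ, q ^ m.natAbs
  have hbound : ∀ μ, 1 + t ≤ μ → μ ≤ (1 + t) ^ 2 →
      WeightedKernelBound (greenKernel P A) μ M := fun μ h1 h2 =>
    .of_le_geometric hq0 hq1 (hγ.trans h1) fun n j =>
      htri.norm_greenKernel_mul_le (hγ.trans h1) hq0 ((by gcongr : θ * μ ≤ θ * (1 + t) ^ 2).trans
        (le_max_left _ _)) (by
          have h3 : (1 + t / 2) / (1 + t) ≤ q := le_max_right _ _
          rw [div_le_iff₀ (by linarith)] at h3
          exact h3.trans (by gcongr)) n j
  have hG := hbound (1 + t) le_rfl (by nlinarith)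
  have hG' := hbound ((1 + t) ^ (1 + α)) (Real.self_le_rpow_of_one_le hγ (by linarith)) (by
    rw [← Real.rpow_natCast]
    refine Real.rpow_le_rpow_of_exponent_le hγ ?_
    push_cast
    linarith)
  have hM := hG.nonneg hγ
  refine ⟨1 / (2 * (M + 1)), by positivity, ?_⟩
  intro F f δf hδ hδ₀ hF _ hf0 hDf0 hf hDf hDfH
  refine htri.exists_centerManifold hAs hAc hAu hγ (by linarith) ?_ hα0 hG hG' hδ.le ?_ hF hf0 hDf0
    (hf.differentiable one_ne_zero) hDf hDfH
  · refine lt_of_le_of_lt ?_ hθγ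
    gcongr
    nlinarith
  · rw [le_div_iff₀ (by positivity)] at hδ₀
    linarith
end
end

section
/- Block-diagonalization along the center manifold: there exists a C^{1,α} diffeomorphism Υ : ℝ^d → ℝ^d with Υ(x_c) = x_c for all x_c ∈ X_c and DΥ(0) = id such that F' := Υ ∘ F ∘ Υ^{−1} satisfies ∂_{x_s}(π_c F')(x_c) = 0 and ∂_{x_u}(π_c F')(x_c) = 0 for all x_c ∈ X_c; moreover F'(x) = Ax + f'(x) where f' satisfies ‖Df'(x)‖ ≤ δ' and ‖Df'(x) − Df'(y)‖ ≤ δ'‖x−y‖^α for a small δ' > 0, X_c remains invariant under F', and ∂_{x_c}(π_su F')(x_c) = 0 for all x_c ∈ X_c. -/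
noncomputable section

open Filter Topology

section SupportingLemmas

open MeasureTheory Module

/-- `h` is bounded by `C` and `α`-Hölder with constant `C`. -/
def BoundedHolder {E V : Type*} [NormedAddCommGroup E] [NormedAddCommGroup V]
    (α C : ℝ) (h : E → V) : Prop :=
  (∀ x, ‖h x‖ ≤ C) ∧ ∀ x y, ‖h x - h y‖ ≤ C * ‖x - y‖ ^ α

namespace BoundedHolder

variable {E V : Type*} [NormedAddCommGroup E] [NormedAddCommGroup V] {α C C₁ C₂ : ℝ}

theorem const_nonneg {h : E → V} (hh : BoundedHolder α C h) : 0 ≤ C :=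
  (norm_nonneg _).trans (hh.1 0)

theorem mono {h : E → V} (hh : BoundedHolder α C₁ h) (hC : C₁ ≤ C₂) : BoundedHolder α C₂ h :=
  ⟨fun x => (hh.1 x).trans hC, fun x y => (hh.2 x y).trans (by gcongr)⟩

theorem add {h₁ h₂ : E → V} (hh₁ : BoundedHolder α C₁ h₁) (hh₂ : BoundedHolder α C₂ h₂) :
    BoundedHolder α (C₁ + C₂) (fun x => h₁ x + h₂ x) := by
  refine ⟨fun x => (norm_add_le _ _).trans (add_le_add (hh₁.1 x) (hh₂.1 x)), fun x y => ?_⟩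
  rw [add_sub_add_comm, add_mul]
  exact (norm_add_le _ _).trans (add_le_add (hh₁.2 x y) (hh₂.2 x y))

theorem neg {h : E → V} (hh : BoundedHolder α C h) : BoundedHolder α C (fun x => -h x) := by
  refine ⟨fun x => by simpa using hh.1 x, fun x y => ?_⟩
  rw [← neg_sub', norm_neg]
  exact hh.2 x y

theorem sub {h₁ h₂ : E → V} (hh₁ : BoundedHolder α C₁ h₁) (hh₂ : BoundedHolder α C₂ h₂) :
    BoundedHolder α (C₁ + C₂) (fun x => h₁ x - h₂ x) := by
  simpa [sub_eq_add_neg] using hh₁.add hh₂.neg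

theorem sum {ι : Type*} (s : Finset ι) {h : ι → E → V} {c : ι → ℝ}
    (hh : ∀ i ∈ s, BoundedHolder α (c i) (h i)) :
    BoundedHolder α (∑ i ∈ s, c i) (fun x => ∑ i ∈ s, h i x) := by
  refine ⟨fun x => norm_sum_le_of_le _ fun i hi => (hh i hi).1 x, fun x y => ?_⟩
  rw [← Finset.sum_sub_distrib, Finset.sum_mul]
  exact norm_sum_le_of_le _ fun i hi => (hh i hi).2 x y

theorem comp_lipschitz {h : E → V} (hh : BoundedHolder α C h) (hα0 : 0 ≤ α) (hα1 : α ≤ 1)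
    {w : E → E} {K : ℝ} (hK : 1 ≤ K) (hw : ∀ x y, ‖w x - w y‖ ≤ K * ‖x - y‖) :
    BoundedHolder α (K * C) (fun x => h (w x)) := by
  have hC := hh.const_nonneg
  refine ⟨fun x => (hh.1 _).trans (le_mul_of_one_le_left hC hK), fun x y => ?_⟩
  calc ‖h (w x) - h (w y)‖ ≤ C * ‖w x - w y‖ ^ α := hh.2 _ _
    _ ≤ C * (K * ‖x - y‖) ^ α := by gcongr; exact hw x y
    _ = C * (K ^ α * ‖x - y‖ ^ α) := by rw [Real.mul_rpow (by linarith) (norm_nonneg _)]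
    _ ≤ C * (K ^ (1 : ℝ) * ‖x - y‖ ^ α) := by gcongr
    _ = K * C * ‖x - y‖ ^ α := by rw [Real.rpow_one]; ring

theorem continuous {h : E → V} (hh : BoundedHolder α C h) (hα0 : 0 < α) : Continuous h := by
  refine continuous_iff_continuousAt.2 fun x => ?_
  rw [ContinuousAt, tendsto_iff_norm_sub_tendsto_zero]
  refine squeeze_zero (fun _ => norm_nonneg _) (fun y => hh.2 y x) ?_
  have : ContinuousAt (fun y : E => C * ‖y - x‖ ^ α) x := by
    refine continuousAt_const.mul (ContinuousAt.rpow_const (by fun_prop) (Or.inr hα0.le))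
  simpa [ContinuousAt, Real.zero_rpow hα0.ne'] using this

section Ring

variable {𝔸 : Type*} [NormedRing 𝔸]

theorem mul {h₁ h₂ : E → 𝔸} (hh₁ : BoundedHolder α C₁ h₁) (hh₂ : BoundedHolder α C₂ h₂) :
    BoundedHolder α (2 * C₁ * C₂) (fun x => h₁ x * h₂ x) := by
  have h₁0 := hh₁.const_nonneg
  have h₂0 := hh₂.const_nonneg
  refine ⟨fun x => ?_, fun x y => ?_⟩
  · calc ‖h₁ x * h₂ x‖ ≤ ‖h₁ x‖ * ‖h₂ x‖ := norm_mul_le _ _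
      _ ≤ C₁ * C₂ := by gcongr; exacts [hh₁.1 x, hh₂.1 x]
      _ ≤ 2 * C₁ * C₂ := by nlinarith [mul_nonneg h₁0 h₂0]
  · have : h₁ x * h₂ x - h₁ y * h₂ y = h₁ x * (h₂ x - h₂ y) + (h₁ x - h₁ y) * h₂ y := by
      noncomm_ring
    rw [this]
    calc _ ≤ ‖h₁ x‖ * ‖h₂ x - h₂ y‖ + ‖h₁ x - h₁ y‖ * ‖h₂ y‖ :=
          (norm_add_le _ _).trans (add_le_add (norm_mul_le _ _) (norm_mul_le _ _))
      _ ≤ C₁ * (C₂ * ‖x - y‖ ^ α) + C₁ * ‖x - y‖ ^ α * C₂ := by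
          gcongr
          exacts [hh₁.1 x, hh₂.2 x y, hh₁.2 x y, hh₂.1 y]
      _ = _ := by ring

theorem const_mul {h : E → 𝔸} (hh : BoundedHolder α C h) (a : 𝔸) :
    BoundedHolder α (‖a‖ * C) (fun x => a * h x) := by
  refine ⟨fun x => (norm_mul_le _ _).trans (by gcongr; exact hh.1 x), fun x y => ?_⟩
  rw [← mul_sub, mul_assoc]
  exact (norm_mul_le _ _).trans (by gcongr; exact hh.2 x y)

theorem mul_const {h : E → 𝔸} (hh : BoundedHolder α C h) (a : 𝔸) :
    BoundedHolder α (C * ‖a‖) (fun x => h x * a) := by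
  refine ⟨fun x => (norm_mul_le _ _).trans (by gcongr; exact hh.1 x), fun x y => ?_⟩
  rw [← sub_mul, mul_right_comm]
  exact (norm_mul_le _ _).trans (by gcongr; exact hh.2 x y)

end Ring

end BoundedHolder

section Mollification

variable {E V : Type*} [NormedAddCommGroup E] [InnerProductSpace ℝ E] [FiniteDimensional ℝ E]
  [MeasurableSpace E] [BorelSpace E] [NormedAddCommGroup V] [NormedSpace ℝ V]

variable (E) in
/-- A smooth probability density supported in the ball of radius `2`. -/
def mollifier : E → ℝ :=
  (⟨1, 2, one_pos, one_lt_two⟩ : ContDiffBump (0 : E)).normed volume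

theorem contDiff_mollifier {n : ℕ∞} : ContDiff ℝ n (mollifier E) := ContDiffBump.contDiff_normed _

theorem integral_mollifier : ∫ y, mollifier E y = 1 := ContDiffBump.integral_normed _

theorem tsupport_mollifier : tsupport (mollifier E) = Metric.closedBall 0 2 :=
  ContDiffBump.tsupport_normed_eq _

/-- The derivative of `x ↦ ℓ x • ∫ y, ρ y • u (x - ℓ x • y)` is integration against this kernel. -/
def mollifierKernel (ℓ : E →L[ℝ] ℝ) (y : E) : E →L[ℝ] ℝ :=
  (fderiv ℝ (mollifier E) y).comp (ContinuousLinearMap.id ℝ E - ℓ.smulRight y) +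
    ((1 - (finrank ℝ E : ℝ)) * mollifier E y) • ℓ

theorem continuous_mollifierKernel (ℓ : E →L[ℝ] ℝ) : Continuous (mollifierKernel ℓ) := by
  have h1 : Continuous (mollifier E) := (contDiff_mollifier (n := 1)).continuous
  have h2 : Continuous (fderiv ℝ (mollifier E)) :=
    (contDiff_mollifier (n := 1)).continuous_fderiv (by simp)
  have h3 : Continuous fun y : E => ℓ.smulRight y :=
    (ContinuousLinearMap.smulRightL ℝ E E ℓ).continuous
  unfold mollifierKernel
  exact (h2.clm_comp (continuous_const.sub h3)).add ((continuous_const.mul h1).smul continuous_const)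

theorem mollifierKernel_eq_zero (ℓ : E →L[ℝ] ℝ) {y : E} (hy : 2 < ‖y‖) :
    mollifierKernel ℓ y = 0 := by
  have hy' : y ∉ tsupport (mollifier E) := by
    simpa [tsupport_mollifier] using hy
  have h2 : fderiv ℝ (mollifier E) y = 0 :=
    image_eq_zero_of_notMem_tsupport fun h => hy' (tsupport_fderiv_subset ℝ h)
  simp [mollifierKernel, image_eq_zero_of_notMem_tsupport hy', h2]

theorem hasCompactSupport_mollifierKernel (ℓ : E →L[ℝ] ℝ) :
    HasCompactSupport (mollifierKernel ℓ) :=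
  HasCompactSupport.intro (isCompact_closedBall (0 : E) 2) fun y hy =>
    mollifierKernel_eq_zero ℓ (by simpa using hy)

theorem integrable_mollifierKernel (ℓ : E →L[ℝ] ℝ) : Integrable (mollifierKernel ℓ) :=
  (continuous_mollifierKernel ℓ).integrable_of_hasCompactSupport
    (hasCompactSupport_mollifierKernel ℓ)

/-- `u` mollified at the point-dependent scale `ℓ x`, multiplied by `ℓ x`. -/
def mollify (ℓ : E →L[ℝ] ℝ) (u : E → V) (x : E) : V :=
  ℓ x • ∫ y, mollifier E y • u (x - ℓ x • y)

/-- The derivative of `mollify ℓ u`. -/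
def mollifyDeriv (ℓ : E →L[ℝ] ℝ) (u : E → V) (x : E) : E →L[ℝ] V :=
  ∫ y, (mollifierKernel ℓ y).smulRight (u (x - ℓ x • y))

theorem integral_eq_smul_integral_rescaled {W : Type*} [NormedAddCommGroup W] [NormedSpace ℝ W]
    (G : E → W) (x : E) {t : ℝ} (ht : t ≠ 0) :
    ∫ y, G y = |t ^ finrank ℝ E|⁻¹ • ∫ z, G (t⁻¹ • (x - z)) := by
  rw [integral_sub_left_eq_self (fun z => G (t⁻¹ • z)) volume x, Measure.integral_comp_smul,
    smul_smul, inv_pow, inv_inv, inv_mul_cancel₀ (abs_ne_zero.2 (pow_ne_zero _ ht)), one_smul]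

theorem mollify_eq {ℓ : E →L[ℝ] ℝ} (u : E → V) {x : E} (hx : ℓ x ≠ 0) :
    mollify ℓ u x = ∫ z, (ℓ x * |ℓ x ^ finrank ℝ E|⁻¹ * mollifier E ((ℓ x)⁻¹ • (x - z))) • u z := by
  rw [mollify, integral_eq_smul_integral_rescaled _ x hx, smul_smul, ← integral_smul]
  simp [smul_smul, hx]

theorem mollifyDeriv_eq {ℓ : E →L[ℝ] ℝ} (u : E → V) {x : E} (hx : ℓ x ≠ 0) :
    mollifyDeriv ℓ u x =
      ∫ z, (|ℓ x ^ finrank ℝ E|⁻¹ • mollifierKernel ℓ ((ℓ x)⁻¹ • (x - z))).smulRight (u z) := by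
  rw [mollifyDeriv, integral_eq_smul_integral_rescaled _ x hx, ← integral_smul]
  congr 1 with z w
  simp [smul_smul, hx]

theorem hasDerivAt_mul_inv_abs_pow (n : ℕ) {t : ℝ} (ht : t ≠ 0) :
    HasDerivAt (fun t : ℝ => t * |t ^ n|⁻¹) ((1 - n) * |t ^ n|⁻¹) t := by
  have h0 : t ^ n ≠ 0 := pow_ne_zero _ ht
  have h1 : HasDerivAt (fun t : ℝ => |t ^ n|) (SignType.sign (t ^ n) * (n * t ^ (n - 1))) t :=
    (hasDerivAt_abs h0).comp t (hasDerivAt_pow n t)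
  refine ((hasDerivAt_id' t).mul (h1.fun_inv (abs_ne_zero.2 h0))).congr_deriv ?_
  have h2 : (SignType.sign (t ^ n) : ℝ) * t ^ n = |t ^ n| := sign_mul_self _
  have h3 : t * (n * t ^ (n - 1)) = n * t ^ n := by
    rcases n with _ | n
    · simp
    · simp [pow_succ]; ring
  have h4 : |t ^ n| ≠ 0 := abs_ne_zero.2 h0
  have h5 : t * ((SignType.sign (t ^ n) : ℝ) * (n * t ^ (n - 1))) = n * |t ^ n| := by
    rw [← h2, ← mul_assoc, mul_comm t, mul_assoc, h3]; ring
  field_simp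
  linear_combination -h5

theorem hasFDerivAt_rescaled_mollifier {ℓ : E →L[ℝ] ℝ} {x : E} (hx : ℓ x ≠ 0) (z : E) :
    HasFDerivAt
      (fun x => ℓ x * |ℓ x ^ finrank ℝ E|⁻¹ * mollifier E ((ℓ x)⁻¹ • (x - z)))
      (|ℓ x ^ finrank ℝ E|⁻¹ • mollifierKernel ℓ ((ℓ x)⁻¹ • (x - z))) x := by
  have h1 := (hasDerivAt_mul_inv_abs_pow (finrank ℝ E) hx).comp_hasFDerivAt x ℓ.hasFDerivAt
  have h2 : HasFDerivAt (fun x => (ℓ x)⁻¹ • (x - z)) _ x :=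
    ((hasDerivAt_inv hx).comp_hasFDerivAt x ℓ.hasFDerivAt).smul
      ((hasFDerivAt_id x).sub_const z)
  have h3 : HasFDerivAt (mollifier E) (fderiv ℝ (mollifier E) ((ℓ x)⁻¹ • (x - z)))
      ((ℓ x)⁻¹ • (x - z)) :=
    ((contDiff_mollifier (n := 1)).differentiable (by simp) _).hasFDerivAt
  have h4 := h1.mul (h3.comp x h2)
  refine h4.congr_fderiv ?_
  ext w
  simp [mollifierKernel]
  field_simp
  simp
  ring

theorem hasFDerivAt_mollify_of_ne_zero {ℓ : E →L[ℝ] ℝ} {u : E → V} (hu : Continuous u) {C : ℝ}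
    (hC : ∀ x, ‖u x‖ ≤ C) {x : E} (hx : ℓ x ≠ 0) :
    HasFDerivAt (mollify ℓ u) (mollifyDeriv ℓ u x) x := by
  have hC0 : 0 ≤ C := (norm_nonneg _).trans (hC 0)
  set n := finrank ℝ E
  obtain ⟨D, hD⟩ := (continuous_mollifierKernel ℓ).bounded_above_of_compact_support
    (hasCompactSupport_mollifierKernel ℓ)
  have hD0 : 0 ≤ D := (norm_nonneg _).trans (hD 0)
  have ht : 0 < |ℓ x| := abs_pos.2 hx
  have hnear : ∀ᶠ y in 𝓝 x, |ℓ x| / 2 < |ℓ y| ∧ |ℓ y| < 2 * |ℓ x| ∧ ‖y - x‖ < 1 := by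
    have hc : ContinuousAt (fun y => |ℓ y|) x := by fun_prop
    have hc' : ContinuousAt (fun y => ‖y - x‖) x := by fun_prop
    exact (hc.eventually (lt_mem_nhds (by linarith))).and
      ((hc.eventually (gt_mem_nhds (by linarith))).and
        (hc'.eventually (gt_mem_nhds (by simp))))
  have hne : ∀ {y : E}, |ℓ x| / 2 < |ℓ y| → ℓ y ≠ 0 := fun h => abs_pos.1 (by linarith)
  have hρ : Continuous (mollifier E) := (contDiff_mollifier (n := 1)).continuous
  have hcont : ∀ y : E, Continuous fun z =>
      (ℓ y * |ℓ y ^ n|⁻¹ * mollifier E ((ℓ y)⁻¹ • (y - z))) • u z := fun y => by fun_prop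
  have key := hasFDerivAt_integral_of_dominated_of_fderiv_le (μ := volume) (𝕜 := ℝ)
    (F := fun y z => (ℓ y * |ℓ y ^ n|⁻¹ * mollifier E ((ℓ y)⁻¹ • (y - z))) • u z)
    (F' := fun y z => (|ℓ y ^ n|⁻¹ • mollifierKernel ℓ ((ℓ y)⁻¹ • (y - z))).smulRight (u z))
    (bound := (Metric.closedBall x (1 + 4 * |ℓ x|)).indicator
      fun _ => ((|ℓ x| / 2) ^ n)⁻¹ * D * C) hnear
    (Eventually.of_forall fun y => (hcont y).aestronglyMeasurable)
    ?_ ?_ (Eventually.of_forall fun z y hy => ?_) ?_ (Eventually.of_forall fun z y hy => ?_)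
  · rw [mollifyDeriv_eq u hx]
    refine key.congr_of_eventuallyEq ?_
    filter_upwards [hnear] with y hy using mollify_eq u (hne hy.1)
  · refine (hcont x).integrable_of_hasCompactSupport
      (HasCompactSupport.intro (isCompact_closedBall x (2 * |ℓ x|)) fun z hz => ?_)
    have hz' : (ℓ x)⁻¹ • (x - z) ∉ tsupport (mollifier E) := by
      rw [tsupport_mollifier, mem_closedBall_zero_iff, not_le, norm_smul, norm_inv,
        Real.norm_eq_abs, ← div_eq_inv_mul, lt_div_iff₀ ht]
      rw [Metric.mem_closedBall, not_le, dist_eq_norm_sub'] at hz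
      exact hz
    simp [image_eq_zero_of_notMem_tsupport hz']
  · have h0 : Continuous fun z => mollifierKernel ℓ ((ℓ x)⁻¹ • (x - z)) :=
      (continuous_mollifierKernel ℓ).comp (by fun_prop)
    have h1 : Continuous fun z => |ℓ x ^ n|⁻¹ • mollifierKernel ℓ ((ℓ x)⁻¹ • (x - z)) :=
      h0.fun_const_smul _
    have h2 : Continuous fun p : (E →L[ℝ] ℝ) × V => p.1.smulRight p.2 :=
      (ContinuousLinearMap.smulRightL ℝ E V).continuous₂
    exact (h2.comp (h1.prodMk hu)).aestronglyMeasurable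
  · rw [ContinuousLinearMap.norm_smulRight_apply, norm_smul, norm_inv, Real.norm_eq_abs, abs_abs,
      abs_pow]
    by_cases hz : z ∈ Metric.closedBall x (1 + 4 * |ℓ x|)
    · rw [Set.indicator_of_mem hz]
      have := hD ((ℓ y)⁻¹ • (y - z))
      have := hC z
      have := hy.1.le
      gcongr
    · rw [Set.indicator_of_notMem hz, mollifierKernel_eq_zero]
      · simp
      · rw [Metric.mem_closedBall, not_le, dist_eq_norm] at hz
        rw [norm_smul, norm_inv, Real.norm_eq_abs, ← div_eq_inv_mul, lt_div_iff₀ (by linarith [hy.1])]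
        have := norm_sub_le_norm_sub_add_norm_sub z y x
        rw [norm_sub_rev z y] at this
        linarith [hy.2.1, hy.2.2]
  · exact (integrable_indicator_iff measurableSet_closedBall).2
      (integrableOn_const (isCompact_closedBall _ _).measure_lt_top.ne)
  · exact (hasFDerivAt_rescaled_mollifier (hne hy.1) z).smul_const (u z)

theorem integral_mollifierKernel {ℓ : E →L[ℝ] ℝ} (hℓ : ℓ ≠ 0) :
    ∫ y, mollifierKernel ℓ y = ℓ := by
  obtain ⟨x, hx⟩ : ∃ x, ℓ x ≠ 0 := by
    by_contra! h
    exact hℓ (ContinuousLinearMap.ext h)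
  have h1 := hasFDerivAt_mollify_of_ne_zero (u := fun _ : E => (1 : ℝ)) (C := 1) continuous_const
    (by simp) hx
  have h2 : mollify ℓ (fun _ : E => (1 : ℝ)) = ℓ := by
    ext y
    simp [mollify, integral_mollifier]
  have h3 : ∀ c : E →L[ℝ] ℝ, c.smulRight (1 : ℝ) = c := fun c => by ext; simp
  rw [h2, mollifyDeriv] at h1
  simp only [h3] at h1
  exact h1.unique ℓ.hasFDerivAt

theorem mollifyDeriv_of_eq_zero [CompleteSpace V] {ℓ : E →L[ℝ] ℝ} (hℓ : ℓ ≠ 0) (u : E → V) {x : E}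
    (hx : ℓ x = 0) : mollifyDeriv ℓ u x = ℓ.smulRight (u x) := by
  have := ContinuousLinearMap.integral_comp_comm
    ((ContinuousLinearMap.smulRightL ℝ E V).flip (u x)) (integrable_mollifierKernel ℓ)
  rw [integral_mollifierKernel hℓ] at this
  simpa [mollifyDeriv, hx] using this

theorem integrable_mollifier : Integrable (mollifier E) :=
  (contDiff_mollifier (n := 1)).continuous.integrable_of_hasCompactSupport
    (by rw [HasCompactSupport, tsupport_mollifier]; exact isCompact_closedBall _ _)

theorem hasFDerivAt_mollify [CompleteSpace V] {ℓ : E →L[ℝ] ℝ} (hℓ : ℓ ≠ 0) {u : E → V}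
    (hu : Continuous u) {C : ℝ} (hC : ∀ x, ‖u x‖ ≤ C) (x : E) :
    HasFDerivAt (mollify ℓ u) (mollifyDeriv ℓ u x) x := by
  by_cases hx : ℓ x = 0
  swap
  · exact hasFDerivAt_mollify_of_ne_zero hu hC hx
  rw [mollifyDeriv_of_eq_zero hℓ u hx]
  have hρ : Continuous (mollifier E) := (contDiff_mollifier (n := 1)).continuous
  have hcont : Continuous fun x => ∫ y, mollifier E y • u (x - ℓ x • y) := by
    refine continuous_of_dominated (bound := fun y => ‖mollifier E y‖ * C)
      (fun x => Continuous.aestronglyMeasurable (by fun_prop))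
      (fun x => Eventually.of_forall fun y => ?_) (integrable_mollifier.norm.mul_const C)
      (Eventually.of_forall fun y => by fun_prop)
    rw [norm_smul]
    gcongr
    exact hC _
  have hval : ∫ y, mollifier E y • u (x - ℓ x • y) = u x := by
    simp [hx, integral_smul_const, integral_mollifier]
  have ho : (fun x' => (∫ y, mollifier E y • u (x' - ℓ x' • y)) - u x) =o[𝓝 x]
      fun _ => (1 : ℝ) := by
    rw [Asymptotics.isLittleO_one_iff]
    simpa [hval] using (hcont.tendsto x).sub_const (u x)
  have hO : (fun x' => ℓ (x' - x)) =O[𝓝 x] fun x' => x' - x := ℓ.isBigO_sub _ _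
  refine .of_isLittleO ?_
  have := hO.norm_right.smul_isLittleO ho
  refine Asymptotics.IsLittleO.of_norm_right ?_
  refine (this.congr (fun x' => ?_) (fun x' => by simp))
  simp [mollify, hx, smul_sub]

theorem boundedHolder_mollifyDeriv (ℓ : E →L[ℝ] ℝ) {α C : ℝ} (hα0 : 0 < α) (hα1 : α ≤ 1)
    {u : E → V} (hu : BoundedHolder α C u) :
    BoundedHolder α ((∫ y, ‖mollifierKernel ℓ y‖) * ((1 + 2 * ‖ℓ‖) * C)) (mollifyDeriv ℓ u) := by
  have hC0 := hu.const_nonneg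
  have hcont := hu.continuous hα0
  have hint := (integrable_mollifierKernel ℓ).norm
  have hK : 1 ≤ 1 + 2 * ‖ℓ‖ := by linarith [norm_nonneg ℓ]
  have hsmul : ∀ {c : E →L[ℝ] ℝ} {v : V} {B : ℝ}, ‖v‖ ≤ B → ‖c.smulRight v‖ ≤ ‖c‖ * B :=
    fun h => by
      rw [ContinuousLinearMap.norm_smulRight_apply]
      gcongr
  have h2 : Continuous fun p : (E →L[ℝ] ℝ) × V => p.1.smulRight p.2 :=
    (ContinuousLinearMap.smulRightL ℝ E V).continuous₂
  have hi : ∀ x, Integrable fun y => (mollifierKernel ℓ y).smulRight (u (x - ℓ x • y)) := by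
    intro x
    refine Integrable.mono' (hint.mul_const C)
      (h2.comp ((continuous_mollifierKernel ℓ).prodMk
        (hcont.comp (by fun_prop)))).aestronglyMeasurable
      (Eventually.of_forall fun y => hsmul (hu.1 _))
  refine ⟨fun x => ?_, fun x x' => ?_⟩
  · rw [← integral_mul_const]
    refine norm_integral_le_of_norm_le (hint.mul_const _) (Eventually.of_forall fun y => hsmul ?_)
    exact (hu.1 _).trans (le_mul_of_one_le_left hC0 hK)
  · rw [mollifyDeriv, mollifyDeriv, ← integral_sub (hi x) (hi x'), mul_assoc, ← integral_mul_const]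
    refine norm_integral_le_of_norm_le (hint.mul_const _) (Eventually.of_forall fun y => ?_)
    by_cases hy : 2 < ‖y‖
    · simp [mollifierKernel_eq_zero ℓ hy]
    have hsub : ∀ (c : E →L[ℝ] ℝ) (v w : V),
        c.smulRight v - c.smulRight w = c.smulRight (v - w) := fun c v w => by
      ext; simp [smul_sub]
    rw [hsub]
    refine hsmul ?_
    have hw : ∀ a b : E, ‖(a - ℓ a • y) - (b - ℓ b • y)‖ ≤ (1 + 2 * ‖ℓ‖) * ‖a - b‖ := by
      intro a b
      have : (a - ℓ a • y) - (b - ℓ b • y) = (a - b) - ℓ (a - b) • y := by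
        rw [map_sub, sub_smul]; abel
      rw [this]
      calc _ ≤ ‖a - b‖ + ‖ℓ (a - b)‖ * ‖y‖ := by
            rw [← norm_smul]; exact norm_sub_le _ _
        _ ≤ ‖a - b‖ + ‖ℓ‖ * ‖a - b‖ * 2 := by
            gcongr
            exacts [ℓ.le_opNorm _, not_lt.1 hy]
        _ = _ := by ring
    exact (hu.comp_lipschitz hα0.le hα1 hK hw).2 x x'

end Mollification

/-- A bounded Hölder field of linear maps, composed with `Q`, is the derivative along `ker Q` of a
`C^{1,α}` map vanishing on `ker Q`. -/
theorem exists_extension_of_jet {E V : Type*} [NormedAddCommGroup E] [InnerProductSpace ℝ E]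
    [FiniteDimensional ℝ E] [NormedAddCommGroup V] [NormedSpace ℝ V] [CompleteSpace V]
    (Q : E →L[ℝ] E) :
    ∃ K : ℝ, ∀ {α C : ℝ} (N : E → E →L[ℝ] V), 0 < α → α ≤ 1 → BoundedHolder α C N →
      ∃ (g : E → V) (g' : E → E →L[ℝ] V), (∀ x, HasFDerivAt g (g' x) x) ∧
        BoundedHolder α (K * C) g' ∧ ∀ x, Q x = 0 → g x = 0 ∧ g' x = (N x).comp Q := by
  classical
  borelize E
  let b := stdOrthonormalBasis ℝ E
  let ℓ : Fin (finrank ℝ E) → E →L[ℝ] ℝ := fun i => (innerSL ℝ (b i)).comp Q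
  let s : Finset (Fin (finrank ℝ E)) := {i | ℓ i ≠ 0}
  have hs : ∀ {i}, i ∈ s → ℓ i ≠ 0 := fun hi => (Finset.mem_filter.1 hi).2
  refine ⟨∑ i ∈ s, (∫ y, ‖mollifierKernel (ℓ i) y‖) * (1 + 2 * ‖ℓ i‖), ?_⟩
  intro α C N hα0 hα1 hN
  let u : Fin (finrank ℝ E) → E → V := fun i x => N x (b i)
  have hb : ∀ i (L : E →L[ℝ] V), ‖L (b i)‖ ≤ ‖L‖ := fun i L => by
    simpa using L.le_opNorm (b i)
  have hu : ∀ i, BoundedHolder α C (u i) := fun i =>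
    ⟨fun x => (hb i _).trans (hN.1 x), fun x y => (hb i (N x - N y)).trans (hN.2 x y)⟩
  refine ⟨fun x => ∑ i ∈ s, mollify (ℓ i) (u i) x, fun x => ∑ i ∈ s, mollifyDeriv (ℓ i) (u i) x,
    fun x => ?_, ?_, fun x hx => ⟨?_, ?_⟩⟩
  · refine HasFDerivAt.fun_sum fun i hi => ?_
    exact hasFDerivAt_mollify (hs hi) ((hu i).continuous hα0) (hu i).1 x
  · rw [Finset.sum_mul]
    refine BoundedHolder.sum s fun i _ => ?_
    rw [mul_assoc]
    exact boundedHolder_mollifyDeriv (ℓ i) hα0 hα1 (hu i)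
  · exact Finset.sum_eq_zero fun i _ => by simp [mollify, ℓ, hx]
  · calc ∑ i ∈ s, mollifyDeriv (ℓ i) (u i) x = ∑ i ∈ s, (ℓ i).smulRight (u i x) :=
          Finset.sum_congr rfl fun i hi =>
            mollifyDeriv_of_eq_zero (hs hi) _ (by simp [ℓ, hx])
      _ = ∑ i, (ℓ i).smulRight (u i x) := by
          refine Finset.sum_subset (Finset.subset_univ _) fun i _ hi => ?_
          have : ℓ i = 0 := by simpa [s] using hi
          ext; simp [this]
      _ = (N x).comp Q := by
          ext w
          rw [ContinuousLinearMap.comp_apply]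
          conv_rhs => rw [← b.sum_repr' (Q w), map_sum]
          simp [ℓ, u]

theorem BoundedHolder.tsum {E V : Type*} [NormedAddCommGroup E] [NormedAddCommGroup V]
    [CompleteSpace V] {α : ℝ} {h : ℕ → E → V} {c : ℕ → ℝ} (hc : Summable c)
    (hh : ∀ n, BoundedHolder α (c n) (h n)) :
    BoundedHolder α (∑' n, c n) (fun x => ∑' n, h n x) := by
  have hs : ∀ x, Summable fun n => h n x := fun x => hc.of_norm_bounded fun n => (hh n).1 x
  refine ⟨fun x => tsum_of_norm_bounded hc.hasSum fun n => (hh n).1 x, fun x y => ?_⟩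
  rw [← (hs x).tsum_sub (hs y)]
  exact tsum_of_norm_bounded (hc.hasSum.mul_right _) fun n => (hh n).2 x y

section Cohomological

theorem norm_orbitSeries_term_le {E 𝔸 : Type*} [NormedRing 𝔸] {P Q : ℕ → 𝔸} {φ : E → E}
    {m : ℕ → ℝ} (hm1 : ∀ n, 1 ≤ m n) {R : E → 𝔸} {D : ℝ} (hD : 0 ≤ D) {x : E}
    {n : ℕ} (hR : ‖R (φ^[n] x)‖ ≤ D) :
    ‖P n * R (φ^[n] x) * Q n‖ ≤ ‖P n‖ * ‖Q n‖ * m n * D :=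
  calc ‖P n * R (φ^[n] x) * Q n‖ ≤ ‖P n‖ * ‖R (φ^[n] x)‖ * ‖Q n‖ :=
        (norm_mul_le _ _).trans (by gcongr; exact norm_mul_le _ _)
    _ ≤ ‖P n‖ * D * ‖Q n‖ := by gcongr
    _ = ‖P n‖ * ‖Q n‖ * 1 * D := by ring
    _ ≤ ‖P n‖ * ‖Q n‖ * m n * D := by gcongr; exact hm1 n

variable {E 𝔸 : Type*} [NormedAddCommGroup E] [NormedRing 𝔸]

/-- The series `∑ Pₙ R(φⁿ x) Qₙ`. -/
def orbitSeries (P Q : ℕ → 𝔸) (φ : E → E) (R : E → 𝔸) (x : E) : 𝔸 :=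
  ∑' n, P n * R (φ^[n] x) * Q n

variable {P Q : ℕ → 𝔸} {φ : E → E} {m : ℕ → ℝ}

variable [CompleteSpace 𝔸]

theorem summable_orbitSeries (hm1 : ∀ n, 1 ≤ m n)
    (hs : Summable fun n => ‖P n‖ * ‖Q n‖ * m n) {R : E → 𝔸} {D : ℝ} (hR : ∀ x, ‖R x‖ ≤ D)
    (x : E) : Summable fun n => P n * R (φ^[n] x) * Q n :=
  (hs.mul_right D).of_norm_bounded fun _ =>
    norm_orbitSeries_term_le hm1 ((norm_nonneg _).trans (hR 0)) (hR _)

theorem norm_orbitSeries_sub_le (hm1 : ∀ n, 1 ≤ m n)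
    (hs : Summable fun n => ‖P n‖ * ‖Q n‖ * m n) {R R' : E → 𝔸} {B B' D : ℝ}
    (hR : ∀ x, ‖R x‖ ≤ B) (hR' : ∀ x, ‖R' x‖ ≤ B') (hD : ∀ x, ‖R x - R' x‖ ≤ D) (x : E) :
    ‖orbitSeries P Q φ R x - orbitSeries P Q φ R' x‖ ≤ (∑' n, ‖P n‖ * ‖Q n‖ * m n) * D := by
  rw [orbitSeries, orbitSeries, ← (summable_orbitSeries hm1 hs hR x).tsum_sub
    (summable_orbitSeries hm1 hs hR' x)]
  refine tsum_of_norm_bounded (hs.hasSum.mul_right D) fun n => ?_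
  rw [← sub_mul, ← mul_sub]
  exact norm_orbitSeries_term_le (R := fun x => R x - R' x) hm1 ((norm_nonneg _).trans (hD 0)) (hD _)

theorem BoundedHolder.orbitSeries (hm1 : ∀ n, 1 ≤ m n)
    (hs : Summable fun n => ‖P n‖ * ‖Q n‖ * m n)
    (hm : ∀ n x y, ‖φ^[n] x - φ^[n] y‖ ≤ m n * ‖x - y‖) {α D : ℝ} (hα0 : 0 ≤ α) (hα1 : α ≤ 1)
    {R : E → 𝔸} (hR : BoundedHolder α D R) :
    BoundedHolder α ((∑' n, ‖P n‖ * ‖Q n‖ * m n) * D) (orbitSeries P Q φ R) := by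
  rw [← tsum_mul_right]
  refine BoundedHolder.tsum (hs.mul_right D) fun n => ?_
  have := ((hR.comp_lipschitz hα0 hα1 (hm1 n) (hm n)).const_mul (P n)).mul_const (Q n)
  refine this.mono (le_of_eq (by ring))

end Cohomological

section TwistedEquation

variable {E 𝔸 : Type*} [NormedAddCommGroup E] [NormedRing 𝔸]

/-- The bounded solution `N` of `N (φ x) * a - a * N x = -(c * R x * (s + u))`, where `b = a⁻¹`
and `ψ = φ⁻¹`: a forward series in the block `s` and a backward series in the block `u`. -/
def twistedSolution (a b c s u : 𝔸) (φ ψ : E → E) (R : E → 𝔸) (x : E) : 𝔸 :=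
  orbitSeries (fun n => b ^ (n + 1) * c) (fun n => s * a ^ n) φ R x -
    orbitSeries (fun n => a ^ n * c) (fun n => b ^ (n + 1) * u) ψ (fun y => R (ψ y)) x

/-- Algebraic relations between an invertible `a`, its inverse `b` and commuting idempotents, and
the growth bounds relative to the weight `m` which make the twisted equation solvable. -/
structure IsSplit (a b c s u : 𝔸) (m : ℕ → ℝ) : Prop where
  mul_inv : a * b = 1
  inv_mul : b * a = 1
  comm_c : a * c = c * a
  comm_s : a * s = s * a
  comm_u : a * u = u * a
  idem_c : c * c = c
  idem_s : s * s = s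
  idem_u : u * u = u
  mul_su : s * u = 0
  mul_us : u * s = 0
  one_le : ∀ n, 1 ≤ m n
  summable_s : Summable fun n => ‖b ^ (n + 1) * c‖ * ‖s * a ^ n‖ * m n
  summable_u : Summable fun n => ‖a ^ n * c‖ * ‖b ^ (n + 1) * u‖ * m n

namespace IsSplit

variable {a b c s u : 𝔸} {m : ℕ → ℝ}

theorem comm_inv (h : IsSplit a b c s u m) {p : 𝔸} (hp : a * p = p * a) : b * p = p * b := by
  calc b * p = b * p * (a * b) := by rw [h.mul_inv, mul_one]
    _ = b * (p * a) * b := by noncomm_ring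
    _ = (b * a) * p * b := by rw [← hp]; noncomm_ring
    _ = p * b := by rw [h.inv_mul, one_mul]

theorem mul_inv_pow_succ (h : IsSplit a b c s u m) (n : ℕ) : a * b ^ (n + 1) = b ^ n := by
  rw [pow_succ', ← mul_assoc, h.mul_inv, one_mul]

theorem inv_pow_succ_mul (h : IsSplit a b c s u m) (n : ℕ) : b ^ (n + 1) * a = b ^ n := by
  rw [pow_succ, mul_assoc, h.inv_mul, mul_one]

/-- An operator bound for `twistedSolution`. -/
def bound (a b c s u : 𝔸) (m : ℕ → ℝ) : ℝ :=
  (∑' n, ‖b ^ (n + 1) * c‖ * ‖s * a ^ n‖ * m n) +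
    (∑' n, ‖a ^ n * c‖ * ‖b ^ (n + 1) * u‖ * m n) * m 1

theorem bound_nonneg (h : IsSplit a b c s u m) : 0 ≤ bound a b c s u m := by
  have h0 : ∀ n, 0 ≤ m n := fun n => zero_le_one.trans (h.one_le n)
  refine add_nonneg (tsum_nonneg fun n => ?_) (mul_nonneg (tsum_nonneg fun n => ?_) (h0 1))
  all_goals have := h0 n; positivity

variable [CompleteSpace 𝔸]

theorem boundedHolder_twistedSolution (h : IsSplit a b c s u m) {φ ψ : E → E}
    (hφ : ∀ n x y, ‖φ^[n] x - φ^[n] y‖ ≤ m n * ‖x - y‖)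
    (hψ : ∀ n x y, ‖ψ^[n] x - ψ^[n] y‖ ≤ m n * ‖x - y‖) {α D : ℝ} (hα0 : 0 ≤ α) (hα1 : α ≤ 1)
    {R : E → 𝔸} (hR : BoundedHolder α D R) :
    BoundedHolder α (bound a b c s u m * D) (twistedSolution a b c s u φ ψ R) := by
  rw [bound, add_mul, mul_assoc]
  refine (BoundedHolder.orbitSeries h.one_le h.summable_s hφ hα0 hα1 hR).sub
    (BoundedHolder.orbitSeries h.one_le h.summable_u hψ hα0 hα1 ?_)
  exact hR.comp_lipschitz hα0 hα1 (h.one_le 1) (hψ 1)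

theorem norm_twistedSolution_sub_le (h : IsSplit a b c s u m) {φ ψ : E → E} {R R' : E → 𝔸} {B B' D : ℝ}
    (hR : ∀ x, ‖R x‖ ≤ B) (hR' : ∀ x, ‖R' x‖ ≤ B') (hD : ∀ x, ‖R x - R' x‖ ≤ D) (x : E) :
    ‖twistedSolution a b c s u φ ψ R x - twistedSolution a b c s u φ ψ R' x‖ ≤
      bound a b c s u m * D := by
  have h0 : ∀ n, 0 ≤ m n := fun n => zero_le_one.trans (h.one_le n)
  have hD0 : 0 ≤ D := (norm_nonneg _).trans (hD 0)
  have hS : 0 ≤ ∑' n, ‖a ^ n * c‖ * ‖b ^ (n + 1) * u‖ * m n :=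
    tsum_nonneg fun n => by have := h0 n; positivity
  rw [twistedSolution, twistedSolution, sub_sub_sub_comm, bound, add_mul]
  refine (_root_.norm_sub_le _ _).trans (add_le_add
    (norm_orbitSeries_sub_le h.one_le h.summable_s hR hR' hD x)
    ((norm_orbitSeries_sub_le h.one_le h.summable_u (fun y => hR (ψ y)) (fun y => hR' (ψ y))
      (fun y => hD (ψ y)) x).trans (mul_le_mul_of_nonneg_right ?_ hD0)))
  exact le_mul_of_one_le_right hS (h.one_le 1)

theorem twistedSolution_eq (h : IsSplit a b c s u m) {φ ψ : E → E} (hψφ : ∀ x, ψ (φ x) = x)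
    {R : E → 𝔸} {B : ℝ} (hR : ∀ x, ‖R x‖ ≤ B) (x : E) :
    twistedSolution a b c s u φ ψ R (φ x) * a - a * twistedSolution a b c s u φ ψ R x =
      -(c * R x * (s + u)) := by
  have hs := summable_orbitSeries (φ := φ) h.one_le h.summable_s hR
  have hu := summable_orbitSeries (φ := ψ) h.one_le h.summable_u (fun y => hR (ψ y))
  have hsa : ∀ n, a * (b ^ (n + 1) * c * R (φ^[n] x) * (s * a ^ n)) =
      b ^ n * c * R (φ^[n] x) * (s * a ^ n) := fun n => by
    simp only [← mul_assoc, h.mul_inv_pow_succ]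
  have hua : ∀ n, a ^ n * c * R (ψ (ψ^[n] (φ x))) * (b ^ (n + 1) * u) * a =
      a ^ n * c * R (ψ^[n] x) * (b ^ n * u) := fun n => by
    rw [← Function.iterate_succ_apply' ψ n, Function.iterate_succ_apply, hψφ]
    simp only [mul_assoc, ← h.comm_u]
    rw [← mul_assoc _ a, h.inv_pow_succ_mul]
  have e1 : a * orbitSeries (fun n => b ^ (n + 1) * c) (fun n => s * a ^ n) φ R x =
      c * R x * s +
        orbitSeries (fun n => b ^ (n + 1) * c) (fun n => s * a ^ n) φ R (φ x) * a := by
    have hsum := (hs x).mul_left a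
    simp only [hsa] at hsum
    rw [orbitSeries, orbitSeries, ← (hs x).tsum_mul_left, ← (hs (φ x)).tsum_mul_right]
    simp only [hsa]
    rw [hsum.tsum_eq_zero_add]
    simp [mul_assoc, pow_succ]
  have e2 : orbitSeries (fun n => a ^ n * c) (fun n => b ^ (n + 1) * u) ψ
        (fun y => R (ψ y)) (φ x) * a = c * R x * u +
      a * orbitSeries (fun n => a ^ n * c) (fun n => b ^ (n + 1) * u) ψ
        (fun y => R (ψ y)) x := by
    have hsum := (hu (φ x)).mul_right a
    simp only [hua] at hsum
    rw [orbitSeries, orbitSeries, ← (hu x).tsum_mul_left, ← (hu (φ x)).tsum_mul_right]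
    simp only [hua]
    rw [hsum.tsum_eq_zero_add]
    simp [mul_assoc, pow_succ', Function.iterate_succ_apply', -Function.iterate_succ]
  rw [twistedSolution, twistedSolution, sub_mul, mul_sub, e1, e2]
  noncomm_ring

theorem mul_twistedSolution (h : IsSplit a b c s u m) {φ ψ : E → E} {R : E → 𝔸} {B : ℝ}
    (hR : ∀ x, ‖R x‖ ≤ B) (x : E) :
    c * twistedSolution a b c s u φ ψ R x = twistedSolution a b c s u φ ψ R x := by
  have hs := summable_orbitSeries (φ := φ) h.one_le h.summable_s hR
  have hu := summable_orbitSeries (φ := ψ) h.one_le h.summable_u (fun y => hR (ψ y))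
  have hb : ∀ n, c * (b ^ n * c) = b ^ n * c := fun n => by
    rw [← mul_assoc, ((show Commute b c from h.comm_inv h.comm_c).pow_left n).symm.eq, mul_assoc,
      h.idem_c]
  have ha : ∀ n, c * (a ^ n * c) = a ^ n * c := fun n => by
    rw [← mul_assoc, ((show Commute a c from h.comm_c).pow_left n).symm.eq, mul_assoc, h.idem_c]
  rw [twistedSolution, mul_sub, orbitSeries, orbitSeries, ← (hs x).tsum_mul_left,
    ← (hu x).tsum_mul_left]
  simp only [← mul_assoc]
  simp only [mul_assoc c, ha, hb]

theorem twistedSolution_mul (h : IsSplit a b c s u m) {φ ψ : E → E} {R : E → 𝔸} {B : ℝ}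
    (hR : ∀ x, ‖R x‖ ≤ B) (x : E) :
    twistedSolution a b c s u φ ψ R x * (s + u) = twistedSolution a b c s u φ ψ R x := by
  have hs := summable_orbitSeries (φ := φ) h.one_le h.summable_s hR
  have hu := summable_orbitSeries (φ := ψ) h.one_le h.summable_u (fun y => hR (ψ y))
  have hb : ∀ n v, v * (b ^ n * u) * (s + u) = v * (b ^ n * u) := fun n v => by
    rw [mul_assoc, mul_assoc, mul_add, h.mul_us, h.idem_u, zero_add]
  have ha : ∀ n v, v * (s * a ^ n) * (s + u) = v * (s * a ^ n) := fun n v => by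
    rw [mul_assoc, ← ((show Commute a s from h.comm_s).pow_left n).eq, mul_assoc, mul_add, h.idem_s, h.mul_su,
      add_zero]
  rw [twistedSolution, sub_mul, orbitSeries, orbitSeries, ← (hs x).tsum_mul_right,
    ← (hu x).tsum_mul_right]
  simp only [ha, hb]

end IsSplit

/-- The right-hand side of the twisted equation solved by an invariant splitting along an orbit of
`φ`, when the linear cocycle is `a + D x`. -/
def splittingDefect (c q : 𝔸) (φ : E → E) (D N : E → 𝔸) (x : E) : 𝔸 :=
  c * D x * q + N (φ x) * D x * q - c * D x * N x

theorem boundedHolder_splittingDefect {c q : 𝔸} {φ : E → E} {L : ℝ} (hL : 1 ≤ L)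
    (hφ : ∀ x y, ‖φ x - φ y‖ ≤ L * ‖x - y‖) {α δ r : ℝ} (hα0 : 0 ≤ α) (hα1 : α ≤ 1)
    {D N : E → 𝔸} (hD : BoundedHolder α δ D) (hN : BoundedHolder α r N) :
    BoundedHolder α ((‖c‖ * ‖q‖ + 2 * (L * r) * ‖q‖ + 2 * ‖c‖ * r) * δ)
      (splittingDefect c q φ D N) := by
  have h1 := (hD.const_mul c).mul_const q
  have h2 := ((hN.comp_lipschitz hα0 hα1 hL hφ).mul hD).mul_const q
  have h3 := (hD.const_mul c).mul hN
  exact ((h1.add h2).sub h3).mono (le_of_eq (by ring))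

theorem norm_splittingDefect_sub_le {c q : 𝔸} {φ : E → E} {δ e : ℝ} {D N N' : E → 𝔸}
    (hD : ∀ x, ‖D x‖ ≤ δ) (hN : ∀ x, ‖N x - N' x‖ ≤ e) (x : E) :
    ‖splittingDefect c q φ D N x - splittingDefect c q φ D N' x‖ ≤ (‖q‖ + ‖c‖) * δ * e := by
  have hδ : 0 ≤ δ := (norm_nonneg _).trans (hD 0)
  have he : 0 ≤ e := (norm_nonneg _).trans (hN 0)
  have : splittingDefect c q φ D N x - splittingDefect c q φ D N' x =
      (N (φ x) - N' (φ x)) * D x * q - c * D x * (N x - N' x) := by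
    simp only [splittingDefect]; noncomm_ring
  rw [this]
  calc _ ≤ ‖(N (φ x) - N' (φ x)) * D x * q‖ + ‖c * D x * (N x - N' x)‖ := norm_sub_le _ _
    _ ≤ ‖N (φ x) - N' (φ x)‖ * ‖D x‖ * ‖q‖ + ‖c‖ * ‖D x‖ * ‖N x - N' x‖ := by
      gcongr
      · exact (norm_mul_le _ _).trans (by gcongr; exact norm_mul_le _ _)
      · exact (norm_mul_le _ _).trans (by gcongr; exact norm_mul_le _ _)
    _ ≤ e * δ * ‖q‖ + ‖c‖ * δ * e := by
      gcongr
      exacts [hN _, hD x, hD x, hN x]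
    _ = _ := by ring

theorem IsSplit.exists_twisted_fixedPoint [CompleteSpace 𝔸] {a b c s u : 𝔸} {m : ℕ → ℝ}
    (h : IsSplit a b c s u m) {φ ψ : E → E}
    (hφ : ∀ n x y, ‖φ^[n] x - φ^[n] y‖ ≤ m n * ‖x - y‖)
    (hψ : ∀ n x y, ‖ψ^[n] x - ψ^[n] y‖ ≤ m n * ‖x - y‖) {α δ r : ℝ} (hα0 : 0 < α) (hα1 : α ≤ 1)
    (hr : 0 ≤ r) {D : E → 𝔸} (hD : BoundedHolder α δ D)
    (hself : bound a b c s u m *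
      ((‖c‖ * ‖s + u‖ + 2 * (m 1 * r) * ‖s + u‖ + 2 * ‖c‖ * r) * δ) ≤ r)
    (hcontr : bound a b c s u m * ((‖s + u‖ + ‖c‖) * δ) ≤ 1 / 2) :
    ∃ N : E → 𝔸, BoundedHolder α r N ∧
      twistedSolution a b c s u φ ψ (splittingDefect c (s + u) φ D N) = N := by
  let S : Set (BoundedContinuousFunction E 𝔸) := {N | BoundedHolder α r N}
  have hS : IsClosed S := by
    simp only [S, BoundedHolder, Set.ofPred_and, Set.ofPred_forall]
    have he : ∀ x : E, Continuous fun N : BoundedContinuousFunction E 𝔸 => N x :=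
      fun x => continuous_eval_const x
    exact (isClosed_iInter fun x => isClosed_le (he x).norm continuous_const).inter
      (isClosed_iInter fun x => isClosed_iInter fun y =>
        isClosed_le ((he x).sub (he y)).norm continuous_const)
  have hdef : ∀ N ∈ S, BoundedHolder α _ (splittingDefect c (s + u) φ D N) := fun N hN =>
    boundedHolder_splittingDefect (h.one_le 1) (hφ 1) hα0.le hα1 hD hN
  let Γ₀ : BoundedContinuousFunction E 𝔸 → E → 𝔸 := fun N =>
    twistedSolution a b c s u φ ψ (splittingDefect c (s + u) φ D N)
  have hΓ₀ : ∀ N ∈ S, BoundedHolder α r (Γ₀ N) := fun N hN =>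
    (h.boundedHolder_twistedSolution hφ hψ hα0.le hα1 (hdef N hN)).mono hself
  let Γ : S → S := fun N =>
    ⟨.ofNormedAddCommGroup (Γ₀ N) ((hΓ₀ N N.2).continuous hα0) r (hΓ₀ N N.2).1, hΓ₀ N N.2⟩
  have : CompleteSpace S := hS.completeSpace_coe
  have : Nonempty S := ⟨⟨0, fun x => by simpa using hr, fun x y => by simp; positivity⟩⟩
  have hΓ : ContractingWith (1 / 2) Γ := by
    refine ⟨by norm_num, LipschitzWith.of_dist_le_mul fun N N' => ?_⟩
    rw [Subtype.dist_eq, Subtype.dist_eq]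
    refine (BoundedContinuousFunction.dist_le (by positivity)).2 fun x => ?_
    rw [dist_eq_norm]
    refine (h.norm_twistedSolution_sub_le (hdef N N.2).1 (hdef N' N'.2).1
      (norm_splittingDefect_sub_le (e := dist (N : BoundedContinuousFunction E 𝔸) N') hD.1
        fun y => ?_) x).trans ?_
    · rw [← dist_eq_norm]
      exact BoundedContinuousFunction.dist_coe_le_dist y
    · rw [← mul_assoc]
      simpa using mul_le_mul_of_nonneg_right hcontr dist_nonneg
  refine ⟨(hΓ.fixedPoint Γ : S), (hΓ.fixedPoint Γ).2, ?_⟩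
  exact congrArg (fun N : S => ((N : BoundedContinuousFunction E 𝔸) : E → 𝔸)) hΓ.fixedPoint_isFixedPt

/-- A cocycle `a + D` over `φ` close to a split linear map `a` has an invariant complement to the
block `c`, given by the graph of a small bounded Hölder field. -/
theorem IsSplit.exists_invariant_graph [CompleteSpace 𝔸] {a b c s u : 𝔸} {m : ℕ → ℝ}
    (h : IsSplit a b c s u m) {r : ℝ} (hr : 0 < r) :
    ∃ δ₀ > (0 : ℝ), ∀ {φ ψ : E → E} {α δ : ℝ} {D : E → 𝔸}, (∀ x, ψ (φ x) = x) →
      (∀ n x y, ‖φ^[n] x - φ^[n] y‖ ≤ m n * ‖x - y‖) →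
      (∀ n x y, ‖ψ^[n] x - ψ^[n] y‖ ≤ m n * ‖x - y‖) → 0 < α → α ≤ 1 → δ ≤ δ₀ →
      BoundedHolder α δ D → φ 0 = 0 → D 0 = 0 →
      ∃ N : E → 𝔸, BoundedHolder α r N ∧ N 0 = 0 ∧ (∀ x, c * N x = N x) ∧
        (∀ x, N x * (s + u) = N x) ∧
        ∀ x, c * D x * (s + u) + N (φ x) * (a + D x) * (s + u) = c * (a + D x) * N x := by
  set C := bound a b c s u m
  have hC : 0 ≤ C := h.bound_nonneg
  have hm := zero_le_one.trans (h.one_le 1)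
  set B₁ := C * (‖c‖ * ‖s + u‖ + 2 * (m 1 * r) * ‖s + u‖ + 2 * ‖c‖ * r)
  set B₂ := C * (‖s + u‖ + ‖c‖)
  have hB₁ : 0 ≤ B₁ := by positivity
  have hB₂ : 0 ≤ B₂ := by positivity
  refine ⟨min (r / (B₁ + 1)) (1 / 2 / (B₂ + 1)), by positivity, ?_⟩
  intro φ ψ α δ D hψφ hφ hψ hα0 hα1 hδ hD hφ0 hD0
  have hδ0 := hD.const_nonneg
  have hself : B₁ * δ ≤ r := by
    have := (le_div_iff₀ (by positivity)).1 (hδ.trans (min_le_left _ _))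
    nlinarith
  have hcontr : B₂ * δ ≤ 1 / 2 := by
    have := (le_div_iff₀ (by positivity)).1 (hδ.trans (min_le_right _ _))
    nlinarith
  obtain ⟨N, hN, hfix⟩ := h.exists_twisted_fixedPoint hφ hψ hα0 hα1 hr.le hD
    (by rw [← mul_assoc]; exact hself) (by rw [← mul_assoc]; exact hcontr)
  have hR := (boundedHolder_splittingDefect (φ := φ) (c := c) (q := s + u) (h.one_le 1) (hφ 1) hα0.le hα1
    hD hN).1
  have hcN : ∀ x, c * N x = N x := fun x => by
    rw [← hfix]; exact h.mul_twistedSolution hR x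
  have hNq : ∀ x, N x * (s + u) = N x := fun x => by
    rw [← hfix]; exact h.twistedSolution_mul hR x
  refine ⟨N, hN, ?_, hcN, hNq, fun x => ?_⟩
  · have hψ0 : ψ 0 = 0 := by rw [← hφ0, hψφ, hφ0]
    have hφn : ∀ n, φ^[n] 0 = 0 := fun n => Function.iterate_fixed hφ0 n
    have hψn : ∀ n, ψ^[n] 0 = 0 := fun n => Function.iterate_fixed hψ0 n
    rw [← hfix]
    simp [twistedSolution, orbitSeries, splittingDefect, hφn, hψn, hψ0, hD0]
  · have hq : (s + u) * (s + u) = s + u := by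
      rw [mul_add, add_mul, add_mul, h.idem_s, h.idem_u, h.mul_su, h.mul_us, add_zero, zero_add]
    have hqa : a * (s + u) = (s + u) * a := by rw [mul_add, add_mul, h.comm_s, h.comm_u]
    have e := h.twistedSolution_eq (φ := φ) (ψ := ψ) hψφ hR x
    rw [hfix] at e
    have e1 : c * splittingDefect c (s + u) φ D N x * (s + u) =
        c * D x * (s + u) + N (φ x) * D x * (s + u) - c * D x * N x := by
      simp only [splittingDefect, mul_sub, mul_add c, sub_mul, add_mul _ _ (s + u)]
      simp only [mul_assoc, hq, hNq]
      simp only [← mul_assoc, h.idem_c, hcN]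
    have e2 : N (φ x) * (a + D x) * (s + u) = N (φ x) * a + N (φ x) * D x * (s + u) := by
      rw [mul_add _ a, add_mul _ _ (s + u), mul_assoc (N _) a, hqa, ← mul_assoc, hNq]
    have e3 : c * (a + D x) * N x = a * N x + c * D x * N x := by
      rw [mul_add, add_mul, ← h.comm_c, mul_assoc a, hcN]
    rw [e1, sub_eq_iff_eq_add] at e
    rw [e2, e3, e]
    abel

end TwistedEquation

section NearLinear

variable {E : Type*} [NormedAddCommGroup E] [NormedSpace ℝ E]

/-- A map which differs from a linear map `B` by a Lipschitz map with small constant grows at a rate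
close to that of the powers of `B`. -/
theorem norm_iterate_sub_le {B : E →L[ℝ] E} {φ : E → E} {K ν η : ℝ} (_ : 0 ≤ ν) (hη : 0 ≤ η)
    (hB : ∀ n : ℕ, ‖B ^ n‖ ≤ K * ν ^ n)
    (hφ : ∀ x y, ‖(φ x - φ y) - B (x - y)‖ ≤ η * ‖x - y‖) (n : ℕ) (x y : E) :
    ‖φ^[n] x - φ^[n] y‖ ≤ K * (ν + K * η) ^ n * ‖x - y‖ := by
  have hK : 0 ≤ K := by simpa using (norm_nonneg _).trans (hB 0)
  suffices h : ∀ m : ℕ, ‖(B ^ m) (φ^[n] x - φ^[n] y)‖ ≤ K * ν ^ m * (ν + K * η) ^ n * ‖x - y‖ by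
    simpa using h 0
  induction n with
  | zero =>
    intro m
    simpa using (B ^ m).le_of_opNorm_le (hB m) (x - y)
  | succ n ih =>
    intro m
    rw [Function.iterate_succ_apply', Function.iterate_succ_apply']
    set p := φ^[n] x
    set q := φ^[n] y
    have h0 : ‖p - q‖ ≤ K * (ν + K * η) ^ n * ‖x - y‖ := by simpa using ih 0
    have heq : (B ^ m) (φ p - φ q) =
        (B ^ (m + 1)) (p - q) + (B ^ m) ((φ p - φ q) - B (p - q)) := by
      rw [pow_succ, mul_apply_eq_comp, ← map_add]
      congr 1
      abel
    rw [heq]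
    calc _ ≤ ‖(B ^ (m + 1)) (p - q)‖ + ‖(B ^ m) ((φ p - φ q) - B (p - q))‖ := norm_add_le _ _
      _ ≤ K * ν ^ (m + 1) * (ν + K * η) ^ n * ‖x - y‖ +
          K * ν ^ m * (η * (K * (ν + K * η) ^ n * ‖x - y‖)) := by
        gcongr
        · exact ih (m + 1)
        · refine (B ^ m).le_of_opNorm_le_of_le (hB m) ((hφ p q).trans ?_)
          gcongr
      _ = _ := by ring

/-- A map Lipschitz close to an invertible linear map is invertible, with an inverse Lipschitz close
to the inverse linear map. -/
theorem exists_inverse_of_near_linear [CompleteSpace E] {B B' : E →L[ℝ] E} (hBB' : B * B' = 1)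
    (hB'B : B' * B = 1) {φ : E → E} {η : ℝ} (hη0 : 0 ≤ η)
    (hφ : ∀ x y, ‖(φ x - φ y) - B (x - y)‖ ≤ η * ‖x - y‖) (hη : ‖B'‖ * η ≤ 1 / 2) :
    ∃ ψ : E → E, (∀ x, ψ (φ x) = x) ∧ (∀ x, φ (ψ x) = x) ∧
      (∀ x y, ‖ψ x - ψ y‖ ≤ 2 * ‖B'‖ * ‖x - y‖) ∧
      ∀ x y, ‖(ψ x - ψ y) - B' (x - y)‖ ≤ 2 * ‖B'‖ ^ 2 * η * ‖x - y‖ := by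
  lift η to NNReal using hη0
  let e : E ≃L[ℝ] E := ContinuousLinearEquiv.equivOfInverse B B'
    (fun x => by simpa using congrArg (fun T : E →L[ℝ] E => T x) hB'B)
    (fun x => by simpa using congrArg (fun T : E →L[ℝ] E => T x) hBB')
  have happ : ApproximatesLinearOn φ (e : E →L[ℝ] E) Set.univ η :=
    fun x _ y _ => hφ x y
  have hc : Subsingleton E ∨ η < ‖(e.symm : E →L[ℝ] E)‖₊⁻¹ := by
    refine (subsingleton_or_nontrivial E).imp_right fun (_ : Nontrivial E) => ?_
    have hpos : 0 < ‖(e.symm : E →L[ℝ] E)‖₊ := e.nnnorm_symm_pos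
    rw [← one_div, lt_div_iff₀ hpos, ← NNReal.coe_lt_coe]
    have : (e.symm : E →L[ℝ] E) = B' := rfl
    simp only [NNReal.coe_mul, coe_nnnorm, this, NNReal.coe_one]
    linarith
  let H := happ.toHomeomorph φ hc
  have hφψ : ∀ x, φ (H.symm x) = x := H.apply_symm_apply
  have key : ∀ x y, ‖(H.symm x - H.symm y) - B' (x - y)‖ ≤
      ‖B'‖ * (η * ‖H.symm x - H.symm y‖) := fun x y => by
    have h := hφ (H.symm x) (H.symm y)
    rw [hφψ, hφψ] at h
    have heq : (H.symm x - H.symm y) - B' (x - y) =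
        -B' ((x - y) - B (H.symm x - H.symm y)) := by
      have : B' (B (H.symm x - H.symm y)) = H.symm x - H.symm y :=
        congrArg (fun T : E →L[ℝ] E => T (H.symm x - H.symm y)) hB'B
      rw [map_sub B' (x - y), this]
      abel
    rw [heq, norm_neg]
    exact B'.le_opNorm_of_le h
  have hlip : ∀ x y, ‖H.symm x - H.symm y‖ ≤ 2 * ‖B'‖ * ‖x - y‖ := fun x y => by
    have h1 := key x y
    have h2 := B'.le_opNorm (x - y)
    have h3 := norm_sub_norm_le (H.symm x - H.symm y) (B' (x - y))
    nlinarith [norm_nonneg (H.symm x - H.symm y)]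
  refine ⟨H.symm, H.symm_apply_apply, hφψ, hlip, fun x y => (key x y).trans ?_⟩
  calc ‖B'‖ * (η * ‖H.symm x - H.symm y‖) ≤ ‖B'‖ * (η * (2 * ‖B'‖ * ‖x - y‖)) := by
        gcongr
        exact hlip x y
    _ = _ := by ring

theorem norm_sub_le_of_hasFDerivAt {V : Type*} [NormedAddCommGroup V] [NormedSpace ℝ V]
    {g : E → V} {g' : E → E →L[ℝ] V} {C : ℝ} (hg : ∀ x, HasFDerivAt g (g' x) x)
    (hC : ∀ x, ‖g' x‖ ≤ C) (x y : E) : ‖g x - g y‖ ≤ C * ‖x - y‖ :=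
  convex_univ.norm_image_sub_le_of_norm_hasFDerivWithin_le
    (fun x _ => (hg x).hasFDerivWithinAt) (fun x _ => hC x) (Set.mem_univ y) (Set.mem_univ x)

theorem exists_inverse_id_add [CompleteSpace E] {g : E → E} {g' : E → E →L[ℝ] E} {α η : ℝ}
    (hα0 : 0 < α) (hα1 : α ≤ 1) (hg : ∀ x, HasFDerivAt g (g' x) x) (hη : η ≤ 1 / 2)
    (hg' : BoundedHolder α η g') :
    ∃ (W : E → E) (W' : E → E →L[ℝ] E), (∀ x, W (x + g x) = x) ∧ (∀ x, W x + g (W x) = x) ∧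
      (∀ x, HasFDerivAt W (W' x) x) ∧ (∀ x, W' x * (1 + g' (W x)) = 1) ∧
      (∀ x y, ‖W x - W y‖ ≤ 2 * ‖x - y‖) ∧
      BoundedHolder α (8 * η) (fun x => W' x - 1) := by
  have hη0 := hg'.const_nonneg
  have h1 : ‖(1 : E →L[ℝ] E)‖ ≤ 1 := ContinuousLinearMap.norm_id_le
  obtain ⟨W, hW1, hW2, hW3, -⟩ := exists_inverse_of_near_linear (B := (1 : E →L[ℝ] E)) (B' := 1)
    (φ := fun x => x + g x) (η := η) (mul_one 1) (mul_one 1) hη0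
    (fun x y => by
      have : x + g x - (y + g y) - (1 : E →L[ℝ] E) (x - y) = g x - g y := by
        simp only [one_apply_eq_self]
        abel
      rw [this]
      exact norm_sub_le_of_hasFDerivAt hg hg'.1 x y)
    (by nlinarith)
  have hW : ∀ x y, ‖W x - W y‖ ≤ 2 * ‖x - y‖ := fun x y =>
    (hW3 x y).trans (by gcongr; linarith)
  have hWcont : Continuous W := by
    refine (LipschitzWith.of_dist_le_mul (K := 2) fun x y => ?_).continuous
    simpa [dist_eq_norm] using hW x y
  have hu : ∀ x, ‖-g' x‖ < 1 := fun x => by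
    rw [norm_neg]
    linarith [hg'.1 x]
  let U : E → (E →L[ℝ] E)ˣ := fun x => Units.oneSub (-g' (W x)) (hu _)
  have hU : ∀ x, ((U x : (E →L[ℝ] E)ˣ) : E →L[ℝ] E) = 1 + g' (W x) := fun x => by
    simp [U]
  have hWd : ∀ x, HasFDerivAt W (((U x)⁻¹ : (E →L[ℝ] E)ˣ) : E →L[ℝ] E) x := fun x => by
    refine HasFDerivAt.of_local_left_inverse (f := fun x => x + g x)
      (f' := ContinuousLinearEquiv.unitsEquiv ℝ E (U x)) hWcont.continuousAt ?_
      (Eventually.of_forall hW2)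
    have : ((ContinuousLinearEquiv.unitsEquiv ℝ E (U x) : E ≃L[ℝ] E) : E →L[ℝ] E) =
        1 + g' (W x) := by
      rw [← hU x]
      rfl
    rw [this]
    exact (hasFDerivAt_id _).add (hg _)
  set W' : E → E →L[ℝ] E := fun x => (((U x)⁻¹ : (E →L[ℝ] E)ˣ) : E →L[ℝ] E)
  have hl : ∀ x, W' x * (1 + g' (W x)) = 1 := fun x => by rw [← hU]; exact (U x).inv_mul
  have hr : ∀ x, (1 + g' (W x)) * W' x = 1 := fun x => by rw [← hU]; exact (U x).mul_inv
  have hle : ∀ x, ‖W' x‖ ≤ 2 := fun x => by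
    have heq : W' x = 1 - W' x * g' (W x) := by rw [eq_sub_iff_add_eq, ← hl x]; noncomm_ring
    have h := norm_sub_le (1 : E →L[ℝ] E) (W' x * g' (W x))
    rw [← heq] at h
    have h2 := norm_mul_le (W' x) (g' (W x))
    nlinarith [hg'.1 (W x), norm_nonneg (W' x)]
  refine ⟨W, W', hW1, hW2, hWd, hl, hW, fun x => ?_, fun x y => ?_⟩
  · have heq : W' x - 1 = -(W' x * g' (W x)) := by rw [← hl x]; noncomm_ring
    simp only [heq, norm_neg]
    refine (norm_mul_le_of_le (hle x) (hg'.1 _)).trans (by linarith)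
  · have heq : W' x - 1 - (W' y - 1) = W' x * ((g' (W y) - g' (W x)) * W' y) := by
      calc W' x - 1 - (W' y - 1) = W' x * 1 - 1 * W' y := by noncomm_ring
        _ = W' x * ((1 + g' (W y)) * W' y) - (W' x * (1 + g' (W x))) * W' y := by rw [hl, hr]
        _ = _ := by noncomm_ring
    simp only [heq]
    have hgW := (hg'.comp_lipschitz hα0.le hα1 one_le_two hW).2 y x
    rw [norm_sub_rev y x] at hgW
    refine (norm_mul_le_of_le (hle x) (norm_mul_le_of_le hgW (hle y))).trans_eq (by ring)

end NearLinear

section Rates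

theorem exists_isSplit {𝔸 : Type*} [NormedRing 𝔸] {a b c s u : 𝔸} {κ τ : ℝ}
    (hab : a * b = 1) (hba : b * a = 1) (hac : a * c = c * a) (has : a * s = s * a)
    (hau : a * u = u * a) (hcc : c * c = c) (hss : s * s = s) (huu : u * u = u) (hsu : s * u = 0)
    (hus : u * s = 0) (hκ0 : 0 < κ) (hκ1 : κ < 1) (hτ0 : 0 < τ) (hτ1 : τ < 1)
    (hS : ∃ K : ℝ, ∀ n : ℕ, ‖a ^ n * s‖ ≤ K * κ ^ n)
    (hU : ∃ K : ℝ, ∀ n : ℕ, ‖b ^ n * u‖ ≤ K * τ ^ n)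
    (hC : ∀ ε > (0 : ℝ), ∃ K : ℝ, ∀ n : ℕ,
      ‖a ^ n * c‖ ≤ K * (1 + ε) ^ n ∧ ‖b ^ n * c‖ ≤ K * (1 + ε) ^ n) :
    ∃ e > (0 : ℝ), ∃ K : ℝ,
      (∀ n : ℕ, ‖a ^ n * c‖ ≤ K * (1 + e) ^ n ∧ ‖b ^ n * c‖ ≤ K * (1 + e) ^ n) ∧
      ∀ K' ≥ (1 : ℝ), IsSplit a b c s u fun n => K' * (1 + e + e) ^ n := by
  set θ := max κ τ
  have hθ0 : 0 < θ := lt_max_of_lt_left hκ0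
  have hθ1 : θ < 1 := max_lt hκ1 hτ1
  set e := (1 - θ) / 8 with he_def
  have he : 0 < e := by linarith
  obtain ⟨K, hK⟩ := hC e he
  obtain ⟨K₁, hK₁⟩ := hS
  obtain ⟨K₂, hK₂⟩ := hU
  have hK0 : 0 ≤ K := by simpa using (norm_nonneg _).trans (hK 0).1
  have hK₁0 : 0 ≤ K₁ := by simpa using (norm_nonneg _).trans (hK₁ 0)
  have hK₂0 : 0 ≤ K₂ := by simpa using (norm_nonneg _).trans (hK₂ 0)
  set ρ := (1 + e) * θ * (1 + e + e)
  have hρ0 : 0 ≤ ρ := by positivity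
  have hρ1 : ρ < 1 := by
    have : θ = 1 - 8 * e := by linarith
    simp only [ρ, this]
    nlinarith [pow_pos he 2, pow_pos he 3]
  have hgeo := summable_geometric_of_lt_one hρ0 hρ1
  refine ⟨e, he, K, hK, fun K' hK' => ?_⟩
  have hK'0 : 0 ≤ K' := zero_le_one.trans hK'
  refine ⟨hab, hba, hac, has, hau, hcc, hss, huu, hsu, hus, fun n => ?_, ?_, ?_⟩
  · exact one_le_mul_of_one_le_of_one_le hK' (one_le_pow₀ (by linarith))
  · refine Summable.of_nonneg_of_le (fun n => by positivity) (fun n => ?_)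
      (hgeo.mul_left (K * (1 + e) * K₁ * K'))
    rw [← (show Commute a s from has).pow_left n]
    calc _ ≤ (K * (1 + e) ^ (n + 1)) * (K₁ * θ ^ n) * (K' * (1 + e + e) ^ n) := by
          gcongr
          · exact (hK _).2
          · exact (hK₁ n).trans (by gcongr; exact le_max_left _ _)
      _ = _ := by simp only [ρ, mul_pow]; ring
  · refine Summable.of_nonneg_of_le (fun n => by positivity) (fun n => ?_)
      (hgeo.mul_left (K * K₂ * θ * K'))
    calc _ ≤ (K * (1 + e) ^ n) * (K₂ * θ ^ (n + 1)) * (K' * (1 + e + e) ^ n) := by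
          gcongr
          · exact (hK _).1
          · exact (hK₂ _).trans (by gcongr; exact le_max_right _ _)
      _ = _ := by simp only [ρ, mul_pow]; ring

end Rates

section CenterDynamics

variable {E : Type*} [NormedAddCommGroup E] [NormedSpace ℝ E]

theorem pow_mul_add_one_sub {𝔸 : Type*} [Ring 𝔸] {a c : 𝔸} (hac : a * c = c * a)
    (hcc : c * c = c) (n : ℕ) : (a * c + (1 - c)) ^ n = a ^ n * c + (1 - c) := by
  induction n with
  | zero => simp
  | succ n ih =>
    have h : c * (a * c) = a * c := by rw [← mul_assoc, ← hac, mul_assoc, hcc]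
    calc (a * c + (1 - c)) ^ (n + 1)
        = a ^ n * (c * (a * c)) + a ^ n * (c - c * c) + (a * c - c * (a * c)) +
          (1 - c - c + c * c) := by rw [pow_succ, ih]; noncomm_ring
      _ = a ^ (n + 1) * c + (1 - c) := by rw [h, hcc, pow_succ]; noncomm_ring

/-- A small perturbation `a + f` of a linear map `a` which is neutral on the range of the
projection `c` agrees on this range with a homeomorphism of the whole space whose iterates grow
slowly in both time directions. -/
theorem exists_center_dynamics [CompleteSpace E] {a b c : E →L[ℝ] E} (hab : a * b = 1)
    (hba : b * a = 1) (hac : a * c = c * a) (hcc : c * c = c) {K e : ℝ} (he : 0 < e)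
    (hK : ∀ n : ℕ, ‖a ^ n * c‖ ≤ K * (1 + e) ^ n ∧ ‖b ^ n * c‖ ≤ K * (1 + e) ^ n) :
    ∃ K' ≥ (1 : ℝ), ∃ δ₀ > (0 : ℝ), ∀ {f : E → E} {δ : ℝ}, 0 ≤ δ → δ ≤ δ₀ →
      (∀ x y, ‖f x - f y‖ ≤ δ * ‖x - y‖) → f 0 = 0 →
      ∃ φ ψ : E → E, (∀ x, ψ (φ x) = x) ∧
        (∀ n x y, ‖φ^[n] x - φ^[n] y‖ ≤ K' * (1 + e + e) ^ n * ‖x - y‖) ∧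
        (∀ n x y, ‖ψ^[n] x - ψ^[n] y‖ ≤ K' * (1 + e + e) ^ n * ‖x - y‖) ∧
        φ 0 = 0 ∧ ∀ x, c x = x → φ x = a x + f x := by
  have hbc : b * c = c * b := by
    calc b * c = b * (c * a) * b := by rw [mul_assoc, mul_assoc, hab, mul_one]
      _ = c * b := by rw [← hac, ← mul_assoc, hba, one_mul]
  set B : E →L[ℝ] E := a * c + (1 - c)
  set B' : E →L[ℝ] E := b * c + (1 - c)
  have hinv : ∀ {x y : E →L[ℝ] E}, x * y = 1 → y * c = c * y →
      (x * c + (1 - c)) * (y * c + (1 - c)) = 1 := fun {x y} hxy hy => by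
    have h : c * (y * c) = y * c := by rw [← mul_assoc, ← hy, mul_assoc, hcc]
    calc (x * c + (1 - c)) * (y * c + (1 - c))
        = x * (c * (y * c)) + x * (c - c * c) + (y * c - c * (y * c)) + (1 - c - c + c * c) := by
          noncomm_ring
      _ = 1 := by rw [h, hcc, ← mul_assoc, hxy]; noncomm_ring
  have hBB' : B * B' = 1 := hinv hab hbc
  have hB'B : B' * B = 1 := hinv hba hac
  set K' := max 1 (K + ‖1 - c‖)
  have hK'1 : 1 ≤ K' := le_max_left _ _
  have hpow : ∀ {x : E →L[ℝ] E}, x * c = c * x → (∀ n : ℕ, ‖x ^ n * c‖ ≤ K * (1 + e) ^ n) →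
      ∀ n : ℕ, ‖(x * c + (1 - c)) ^ n‖ ≤ K' * (1 + e) ^ n := fun hx hxK n => by
    rw [pow_mul_add_one_sub hx hcc]
    have h1 : (1 : ℝ) ≤ (1 + e) ^ n := one_le_pow₀ (by linarith)
    calc _ ≤ K * (1 + e) ^ n + ‖1 - c‖ * (1 + e) ^ n :=
          (norm_add_le _ _).trans
            (add_le_add (hxK n) (le_mul_of_one_le_right (norm_nonneg _) h1))
      _ ≤ _ := by
        rw [← add_mul]
        gcongr
        exact le_max_right _ _
  have hBn := hpow hac fun n => (hK n).1
  have hB'n := hpow hbc fun n => (hK n).2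
  set η₀ := min (e / (K' * (1 + 2 * ‖B'‖ ^ 2))) (1 / 2 / (‖B'‖ + 1))
  refine ⟨K', hK'1, η₀ / (‖c‖ + 1), by positivity, fun {f δ} hδ0 hδ hf hf0 => ?_⟩
  set η := δ * ‖c‖
  have hη0 : 0 ≤ η := by positivity
  have hηη : η ≤ η₀ := by
    rw [le_div_iff₀ (by positivity)] at hδ
    exact (mul_le_mul_of_nonneg_left (by linarith) hδ0).trans hδ
  have hη1 : η * (K' * (1 + 2 * ‖B'‖ ^ 2)) ≤ e :=
    (le_div_iff₀ (by positivity)).1 (hηη.trans (min_le_left _ _))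
  have hη2 : η * (‖B'‖ + 1) ≤ 1 / 2 :=
    (le_div_iff₀ (by positivity)).1 (hηη.trans (min_le_right _ _))
  have hK'η : 0 ≤ K' * η := by positivity
  have hK'η2 : 0 ≤ K' * (2 * ‖B'‖ ^ 2 * η) := by positivity
  set φ : E → E := fun x => B x + f (c x)
  have hφ : ∀ x y, ‖(φ x - φ y) - B (x - y)‖ ≤ η * ‖x - y‖ := fun x y => by
    have : (φ x - φ y) - B (x - y) = f (c x) - f (c y) := by
      simp only [φ, map_sub]
      abel
    rw [this]
    calc _ ≤ δ * ‖c (x - y)‖ := by rw [map_sub]; exact hf _ _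
      _ ≤ δ * (‖c‖ * ‖x - y‖) := by gcongr; exact c.le_opNorm _
      _ = _ := by ring
  obtain ⟨ψ, hψφ, -, -, hψ⟩ := exists_inverse_of_near_linear hBB' hB'B hη0 hφ (by nlinarith)
  refine ⟨φ, ψ, hψφ, fun n x y => ?_, fun n x y => ?_, ?_, fun x hx => ?_⟩
  · refine (norm_iterate_sub_le (by positivity) hη0 hBn hφ n x y).trans ?_
    gcongr
    nlinarith
  · refine (norm_iterate_sub_le (by positivity) (by positivity) hB'n hψ n x y).trans ?_
    gcongr
    nlinarith
  · simp [φ, hf0]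
  · simp [φ, B, hx]

end CenterDynamics

section Conjugation

theorem block_diagonal_of_graph {𝔸 : Type*} [Ring 𝔸] {a c q D N N' : 𝔸} (hac : a * c = c * a)
    (hcq : c * q = 0) (hqc : q * c = 0) (hcN : c * N = N) (hNq : N * q = N) (hcN' : c * N' = N')
    (hNq' : N' * q = N') (hinv : q * (a + D) * c = 0)
    (hgraph : c * D * q + N' * (a + D) * q = c * (a + D) * N) :
    c * ((1 + N') * (a + D) * (1 - N)) * q = 0 ∧ q * ((1 + N') * (a + D) * (1 - N)) * c = 0 := by
  have hqN : q * N' = 0 := by rw [← hcN', ← mul_assoc, hqc, zero_mul]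
  have hNc : N * c = 0 := by rw [← hNq, mul_assoc, hqc, mul_zero]
  have hcaq : c * a * q = 0 := by rw [← hac, mul_assoc, hcq, mul_zero]
  have hNN : N' * (a + D) * N = 0 := by
    calc N' * (a + D) * N = N' * (q * (a + D) * c) * N := by
          conv_lhs => rw [← hNq', ← hcN]
          noncomm_ring
      _ = 0 := by rw [hinv]; noncomm_ring
  constructor
  · calc c * ((1 + N') * (a + D) * (1 - N)) * q
        = c * a * q + (c * D * q + (c * N') * (a + D) * q) - c * (a + D) * (N * q) -
          (c * N') * (a + D) * (N * q) := by noncomm_ring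
      _ = 0 := by rw [hcaq, hcN', hgraph, hNq, hNN]; noncomm_ring
  · calc q * ((1 + N') * (a + D) * (1 - N)) * c
        = q * (a + D) * c + (q * N') * (a + D) * ((1 - N) * c) - q * (a + D) * (N * c) := by
          noncomm_ring
      _ = 0 := by rw [hinv, hqN, hNc]; noncomm_ring

theorem BoundedHolder.conjugation_sub {E 𝔸 : Type*} [NormedAddCommGroup E] [NormedRing 𝔸]
    {a : 𝔸} {α η : ℝ} {p r D : E → 𝔸} (hη : η ≤ 1 / 2)
    (hp : BoundedHolder α (2 * (‖a‖ + 1) * η) p) (hD : BoundedHolder α (2 * η) D)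
    (hr : BoundedHolder α (8 * η) r) :
    BoundedHolder α (η * (9 * (2 * (‖a‖ + 1) * ‖a‖ + 2 + 4 * (‖a‖ + 1)) + 8 * ‖a‖))
      (fun x => (1 + p x) * (a + D x) * (1 + r x) - a) := by
  have hη0 : 0 ≤ η := by linarith [hD.const_nonneg]
  have ha := norm_nonneg a
  set M := 2 * (‖a‖ + 1) * ‖a‖ + 2 + 4 * (‖a‖ + 1)
  have hM0 : 0 ≤ M := by positivity
  have hm : BoundedHolder α (M * η) fun x => p x * a + D x + p x * D x := by
    refine (((hp.mul_const a).add hD).add (hp.mul hD)).mono ?_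
    have : (‖a‖ + 1) * η * η ≤ (‖a‖ + 1) * η * (1 / 2) := by gcongr
    simp only [M]
    nlinarith
  have h := ((hm.add (hr.const_mul a)).add (hm.mul hr)).mono
    (show _ ≤ η * (9 * M + 8 * ‖a‖) by
      have : M * η * η ≤ M * η * (1 / 2) := by gcongr
      nlinarith)
  convert h using 2 with x
  noncomm_ring

end Conjugation

end SupportingLemmas

/-- Block-diagonalization of `DF` along the (straightened) center manifold
via a `C^{1,α}` change of variables `Υ` fixing `X_c` pointwise. -/
theorem block_diagonalization_along_center
    {d : ℕ} (P : TripleProj d) (A : Euc d ≃L[ℝ] Euc d)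
    (hAs : (A : Euc d →L[ℝ] Euc d).comp P.πs = P.πs.comp (A : Euc d →L[ℝ] Euc d))
    (hAc : (A : Euc d →L[ℝ] Euc d).comp P.πc = P.πc.comp (A : Euc d →L[ℝ] Euc d))
    (hAu : (A : Euc d →L[ℝ] Euc d).comp P.πu = P.πu.comp (A : Euc d →L[ℝ] Euc d))
    (lsm lsp lum lup : ℝ)
    (hl1 : 0 < lsm) (hl2 : lsm < lsp) (hl3 : lsp < 1) (hl4 : 1 < lum) (hl5 : lum < lup)
    (hSf : ∃ K : ℝ, ∀ n : ℕ, ‖((A : Euc d →L[ℝ] Euc d) ^ n).comp P.πs‖ ≤ K * lsp ^ n)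
    (hSb : ∃ K : ℝ, ∀ n : ℕ, ‖((A.symm : Euc d →L[ℝ] Euc d) ^ n).comp P.πs‖ ≤ K * (1 / lsm) ^ n)
    (hUf : ∃ K : ℝ, ∀ n : ℕ, ‖((A : Euc d →L[ℝ] Euc d) ^ n).comp P.πu‖ ≤ K * lup ^ n)
    (hUb : ∃ K : ℝ, ∀ n : ℕ, ‖((A.symm : Euc d →L[ℝ] Euc d) ^ n).comp P.πu‖ ≤ K * (1 / lum) ^ n)
    (hC : ∀ ε > (0 : ℝ), ∃ K : ℝ, ∀ n : ℕ,
      ‖((A : Euc d →L[ℝ] Euc d) ^ n).comp P.πc‖ ≤ K * (1 + ε) ^ n ∧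
      ‖((A.symm : Euc d →L[ℝ] Euc d) ^ n).comp P.πc‖ ≤ K * (1 + ε) ^ n)
    (α : ℝ) (hα0 : 0 < α) (hα1 : α ≤ 1)
    -- target smallness for the new nonlinearity ("small δ' > 0")
    (ε : ℝ) (hε : 0 < ε) :
    ∃ δ₀ > (0 : ℝ), ∀ (F f : Euc d → Euc d) (δf : ℝ), 0 < δf → δf ≤ δ₀ →
      (∀ x, F x = A x + f x) → Function.Bijective F →
      f 0 = 0 → fderiv ℝ f 0 = 0 → ContDiff ℝ 1 f →
      (∀ x, ‖fderiv ℝ f x‖ ≤ δf) →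
      (∀ x y, ‖fderiv ℝ f x - fderiv ℝ f y‖ ≤ δf * ‖x - y‖ ^ α) →
      -- the center manifold is straightened: `X_c` is invariant and `∂_{x_c}(π_su F)(x_c) = 0`
      (∀ xc : Euc d, P.πc xc = xc → P.πc (F xc) = F xc) →
      (∀ xc : Euc d, P.πc xc = xc →
        ((P.πs + P.πu).comp (fderiv ℝ F xc)).comp P.πc = 0) →
      ∃ Υ Υinv : Euc d → Euc d,
        -- `Υ` is a `C^{1,α}` diffeomorphism of `ℝ^d`
        ContDiff ℝ 1 Υ ∧ ContDiff ℝ 1 Υinv ∧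
        (∀ x, Υinv (Υ x) = x) ∧ (∀ x, Υ (Υinv x) = x) ∧
        (∃ C : ℝ, ∀ x y, ‖fderiv ℝ Υ x - fderiv ℝ Υ y‖ ≤ C * ‖x - y‖ ^ α) ∧
        (∀ xc : Euc d, P.πc xc = xc → Υ xc = xc) ∧
        fderiv ℝ Υ 0 = ContinuousLinearMap.id ℝ (Euc d) ∧
        -- the new map `F' = Υ ∘ F ∘ Υ⁻¹` satisfies `∂_{x_s}(π_c F')(x_c) = ∂_{x_u}(π_c F')(x_c) = 0`
        (∀ xc : Euc d, P.πc xc = xc →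
          (P.πc.comp (fderiv ℝ (fun y => Υ (F (Υinv y))) xc)).comp P.πs = 0 ∧
          (P.πc.comp (fderiv ℝ (fun y => Υ (F (Υinv y))) xc)).comp P.πu = 0) ∧
        -- `F' = A + f'` with `f'` small in the `C^{1,α}` sense
        (∀ x, ‖fderiv ℝ (fun y => Υ (F (Υinv y)) - A y) x‖ ≤ ε) ∧
        (∀ x y, ‖fderiv ℝ (fun z => Υ (F (Υinv z)) - A z) x
                  - fderiv ℝ (fun z => Υ (F (Υinv z)) - A z) y‖ ≤ ε * ‖x - y‖ ^ α) ∧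
        -- `X_c` remains invariant under `F'` and `∂_{x_c}(π_su F')(x_c) = 0`
        (∀ xc : Euc d, P.πc xc = xc → P.πc (Υ (F (Υinv xc))) = Υ (F (Υinv xc))) ∧
        (∀ xc : Euc d, P.πc xc = xc →
          ((P.πs + P.πu).comp (fderiv ℝ (fun y => Υ (F (Υinv y))) xc)).comp P.πc = 0) := by
  set a : Euc d →L[ℝ] Euc d := (A : Euc d →L[ℝ] Euc d) with ha_def
  set b : Euc d →L[ℝ] Euc d := (A.symm : Euc d →L[ℝ] Euc d)
  have hab : a * b = 1 := by ext1 x; exact A.apply_symm_apply x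
  have hba : b * a = 1 := by ext1 x; exact A.symm_apply_apply x
  have hcc : P.πc * P.πc = P.πc := P.idem_c
  have hlum : 0 < lum := zero_lt_one.trans hl4
  obtain ⟨e, he, K, hK, hsplit⟩ := exists_isSplit hab hba hAc hAs hAu hcc P.idem_s P.idem_u
    P.comp_su P.comp_us (hl1.trans hl2) hl3 (by positivity) ((div_lt_one hlum).2 hl4) hSf hUb hC
  obtain ⟨K', hK'1, δ₁, hδ₁, hcenter⟩ := exists_center_dynamics hab hba hAc hcc he hK
  set q : Euc d →L[ℝ] Euc d := P.πs + P.πu with hq_def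
  have hcq : P.πc * q = 0 := by
    have h1 : P.πc * P.πs = 0 := P.comp_cs
    have h2 : P.πc * P.πu = 0 := P.comp_cu
    rw [hq_def, mul_add, h1, h2, add_zero]
  have hqc : q * P.πc = 0 := by
    have h1 : P.πs * P.πc = 0 := P.comp_sc
    have h2 : P.πu * P.πc = 0 := P.comp_uc
    rw [hq_def, add_mul, h1, h2, add_zero]
  have hqs : q * P.πs = P.πs := by
    have h1 : P.πs * P.πs = P.πs := P.idem_s
    have h2 : P.πu * P.πs = 0 := P.comp_us
    rw [hq_def, add_mul, h1, h2, add_zero]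
  have hqu : q * P.πu = P.πu := by
    have h1 : P.πs * P.πu = 0 := P.comp_su
    have h2 : P.πu * P.πu = P.πu := P.idem_u
    rw [hq_def, add_mul, h1, h2, zero_add]
  have hqx : ∀ x, P.πc x = x → q x = 0 := fun x hx => by
    have := congrArg (fun T : Euc d →L[ℝ] Euc d => T x) hqc
    simpa [hx] using this
  obtain ⟨Kx, hKx⟩ := exists_extension_of_jet (V := Euc d) q
  set T := 9 * (2 * (‖a‖ + 1) * ‖a‖ + 2 + 4 * (‖a‖ + 1)) + 8 * ‖a‖
  have hT : 0 < T := by positivity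
  set η := min (1 / 2) (ε / T)
  have hη : 0 < η := by positivity
  have hη2 : η ≤ 1 / 2 := min_le_left _ _
  have hηε : η * T ≤ ε := (le_div_iff₀ hT).1 (min_le_right _ _)
  have hr : 0 < η / (|Kx| + 1) := by positivity
  obtain ⟨δ₂, hδ₂, hgraph⟩ := (hsplit K' hK'1).exists_invariant_graph (E := Euc d) hr
  refine ⟨min (min δ₁ δ₂) η, by positivity, ?_⟩
  intro F f δf hδf0 hδf hF _ hf0 hDf0 hfc hfb hfh hXc hDXc
  have hδf1 : δf ≤ δ₁ := hδf.trans ((min_le_left _ _).trans (min_le_left _ _))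
  have hδf2 : δf ≤ δ₂ := hδf.trans ((min_le_left _ _).trans (min_le_right _ _))
  have hδfη : δf ≤ η := hδf.trans (min_le_right _ _)
  have hfd : ∀ x, HasFDerivAt f (fderiv ℝ f x) x := fun x =>
    ((hfc.differentiable one_ne_zero) x).hasFDerivAt
  have hFd : ∀ x, HasFDerivAt F (a + fderiv ℝ f x) x := fun x => by
    rw [show F = fun x => A x + f x from funext hF]
    exact A.hasFDerivAt.add (hfd x)
  have hDBH : BoundedHolder α δf (fderiv ℝ f) := ⟨hfb, hfh⟩
  obtain ⟨φ, ψ, hψφ, hφit, hψit, hφ0, hφF⟩ := hcenter hδf0.le hδf1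
    (norm_sub_le_of_hasFDerivAt hfd hfb) hf0
  obtain ⟨N, hN, hN0, hcN, hNq, hNeq⟩ := hgraph hψφ hφit hψit hα0 hα1 hδf2 hDBH hφ0 hDf0
  obtain ⟨g, g', hg, hg', hgX⟩ := hKx N hα0 hα1 hN
  replace hg' : BoundedHolder α η g' := hg'.mono <| by
    rw [mul_div_assoc', div_le_iff₀ (by positivity), mul_comm]
    exact mul_le_mul_of_nonneg_left (by linarith [le_abs_self Kx]) hη.le
  obtain ⟨W, W', hWl, hWr, hW, hW'l, hWlip, hW'⟩ := exists_inverse_id_add hα0 hα1 hg hη2 hg'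
  have hΥ : ∀ x, HasFDerivAt (fun x => x + g x) (1 + g' x) x := fun x =>
    (hasFDerivAt_id x).add (hg x)
  have hgc : ∀ x, P.πc x = x → g x = 0 ∧ g' x = N x := fun x hx => by
    obtain ⟨h1, h2⟩ := hgX x (hqx x hx)
    exact ⟨h1, h2.trans (hNq x)⟩
  have hWc : ∀ x, P.πc x = x → W x = x := fun x hx => by
    simpa [(hgc x hx).1] using hWl x
  have hW'c : ∀ x, P.πc x = x → W' x = 1 - N x := fun x hx => by
    have hNN : N x * N x = 0 := by
      calc N x * N x = N x * (q * P.πc) * N x := by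
            conv_lhs => rw [← hNq x]
            rw [mul_assoc, mul_assoc, mul_assoc, hNq, hcN]
        _ = 0 := by rw [hqc, mul_zero, zero_mul]
    have h := hW'l x
    rw [hWc x hx, (hgc x hx).2] at h
    calc W' x = W' x * (1 + N x) * (1 - N x) + W' x * (N x * N x) := by noncomm_ring
      _ = 1 - N x := by rw [h, hNN, one_mul, mul_zero, add_zero]
  have hG : ∀ x, HasFDerivAt (fun y => F (W y) + g (F (W y)))
      ((1 + g' (F (W x))) * (a + fderiv ℝ f (W x)) * W' x) x := fun x =>
    ((hΥ (F (W x))).comp (W x) (hFd (W x))).comp x (hW x)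
  have hGc : ∀ x, P.πc x = x → fderiv ℝ (fun y => F (W y) + g (F (W y))) x =
      (1 + N (F x)) * (a + fderiv ℝ f x) * (1 - N x) := fun x hx => by
    rw [(hG x).fderiv, hWc x hx, hW'c x hx, (hgc _ (hXc x hx)).2]
  have hblock : ∀ x, P.πc x = x →
      P.πc * ((1 + N (F x)) * (a + fderiv ℝ f x) * (1 - N x)) * q = 0 ∧
      q * ((1 + N (F x)) * (a + fderiv ℝ f x) * (1 - N x)) * P.πc = 0 := fun x hx => by
    refine block_diagonal_of_graph hAc hcq hqc (hcN x) (hNq x) (hcN _) (hNq _) ?_ ?_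
    · rw [← (hFd x).fderiv]
      exact hDXc x hx
    · have hφx : φ x = F x := (hφF x hx).trans (hF x).symm
      rw [← hφx]
      exact hNeq x
  have hFlip : ∀ x y, ‖F x - F y‖ ≤ (‖a‖ + 1) * ‖x - y‖ :=
    norm_sub_le_of_hasFDerivAt hFd fun x => norm_add_le_of_le le_rfl ((hfb x).trans (by linarith))
  have hFW : ∀ x y, ‖F (W x) - F (W y)‖ ≤ 2 * (‖a‖ + 1) * ‖x - y‖ := fun x y => by
    calc _ ≤ (‖a‖ + 1) * (2 * ‖x - y‖) := (hFlip _ _).trans (by gcongr; exact hWlip x y)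
      _ = _ := by ring
  have hsmall : BoundedHolder α ε
      (fun x => fderiv ℝ (fun y => F (W y) + g (F (W y)) - A y) x) := by
    have hfd' : ∀ x, fderiv ℝ (fun y => F (W y) + g (F (W y)) - A y) x =
        (1 + g' (F (W x))) * (a + fderiv ℝ f (W x)) * (1 + (W' x - 1)) - a := fun x => by
      rw [add_sub_cancel]
      exact ((hG x).sub A.hasFDerivAt).fderiv
    simp only [hfd']
    refine (BoundedHolder.conjugation_sub hη2 ?_ ?_ hW').mono hηε
    · exact hg'.comp_lipschitz hα0.le hα1 (by linarith [norm_nonneg a]) hFW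
    · exact (hDBH.mono hδfη).comp_lipschitz hα0.le hα1 one_le_two hWlip
  have hΥfd : ∀ x, fderiv ℝ (fun x => x + g x) x = 1 + g' x := fun x => (hΥ x).fderiv
  refine ⟨fun x => x + g x, W, ?_, ?_, hWl, hWr, ⟨η, fun x y => ?_⟩, fun x hx => ?_, ?_,
    fun x hx => ?_, hsmall.1, hsmall.2, fun x hx => ?_, fun x hx => ?_⟩
  · exact contDiff_one_iff_hasFDerivAt.2
      ⟨fun x => 1 + g' x, continuous_const.add (hg'.continuous hα0), hΥ⟩
  · refine contDiff_one_iff_hasFDerivAt.2 ⟨W', ?_, hW⟩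
    exact ((hW'.continuous hα0).add (continuous_const (y := (1 : Euc d →L[ℝ] Euc d)))).congr
      fun x => sub_add_cancel _ _
  · rw [hΥfd, hΥfd, add_sub_add_left_eq_sub]
    exact hg'.2 x y
  · simp [(hgc x hx).1]
  · rw [hΥfd, (hgc 0 (map_zero _)).2, hN0, add_zero]
    rfl
  · rw [hGc x hx]
    have h := (hblock x hx).1
    constructor
    · rw [← hqs]
      change P.πc * _ * (q * P.πs) = 0
      rw [← mul_assoc, h, zero_mul]
    · rw [← hqu]
      change P.πc * _ * (q * P.πu) = 0
      rw [← mul_assoc, h, zero_mul]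
  · simp only [hWc x hx, (hgc _ (hXc x hx)).1, add_zero]
    exact hXc x hx
  · rw [hGc x hx]
    exact (hblock x hx).2
end
end

section
/- Existence of C^{1,α} center-stable and center-unstable invariant manifolds: there exist C^{1,α} maps ϖ_cs : X_cs → X_u and ϖ_cu : X_cu → X_s such that the graphs ℳ_cs := {x_cs + ϖ_cs(x_cs) : x_cs ∈ X_cs} and ℳ_cu := {x_cu + ϖ_cu(x_cu) : x_cu ∈ X_cu} are invariant under F, ϖ_cs(x_c) = ϖ_cu(x_c) = 0 for all x_c ∈ X_c, the derivatives Dϖ_cs and Dϖ_cu are globally small in norm, and Dϖ_cs(0) = Dϖ_cu(0) = 0. -/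
noncomputable section

open Filter Topology

/-- A differentiable map vanishing to first order at the origin, whose derivative is bounded by `ε`
and is `α`-Hölder with constant `H`. -/
structure IsHolderC1 {E F : Type*} [NormedAddCommGroup E] [NormedSpace ℝ E]
    [NormedAddCommGroup F] [NormedSpace ℝ F] (α ε H : ℝ) (f : E → F) : Prop where
  differentiable : Differentiable ℝ f
  norm_fderiv_le : ∀ x, ‖fderiv ℝ f x‖ ≤ ε
  holder : ∀ x y, ‖fderiv ℝ f x - fderiv ℝ f y‖ ≤ H * ‖x - y‖ ^ α
  map_zero : f 0 = 0
  fderiv_zero : fderiv ℝ f 0 = 0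

namespace IsHolderC1

variable {E F G : Type*} [NormedAddCommGroup E] [NormedSpace ℝ E]
  [NormedAddCommGroup F] [NormedSpace ℝ F] [NormedAddCommGroup G] [NormedSpace ℝ G]
  {α ε H : ℝ} {f : E → F}

theorem norm_map_sub_le (hf : IsHolderC1 α ε H f) (x y : E) : ‖f x - f y‖ ≤ ε * ‖x - y‖ :=
  convex_univ.norm_image_sub_le_of_norm_fderiv_le (𝕜 := ℝ)
    (fun z _ => hf.differentiable z) (fun z _ => hf.norm_fderiv_le z) trivial trivial

theorem norm_le (hf : IsHolderC1 α ε H f) (x : E) : ‖f x‖ ≤ ε * ‖x‖ := by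
  simpa [hf.map_zero] using hf.norm_map_sub_le x 0

theorem mono (hf : IsHolderC1 α ε H f) {ε' H' : ℝ} (hε : ε ≤ ε') (hH : H ≤ H') :
    IsHolderC1 α ε' H' f where
  differentiable := hf.differentiable
  norm_fderiv_le x := (hf.norm_fderiv_le x).trans hε
  holder x y := (hf.holder x y).trans (by gcongr)
  map_zero := hf.map_zero
  fderiv_zero := hf.fderiv_zero

theorem contDiff (hf : IsHolderC1 α ε H f) (hα : 0 < α) : ContDiff ℝ 1 f := by
  refine contDiff_one_iff_fderiv.2 ⟨hf.differentiable, continuous_iff_continuousAt.2 fun x => ?_⟩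
  rw [ContinuousAt, tendsto_iff_norm_sub_tendsto_zero]
  refine squeeze_zero (fun _ => norm_nonneg _) (fun y => hf.holder y x) ?_
  have h : Continuous fun y : E => H * ‖y - x‖ ^ α :=
    continuous_const.mul ((continuous_id.sub continuous_const).norm.rpow_const
      fun _ => Or.inr hα.le)
  simpa [Real.zero_rpow hα.ne'] using h.tendsto x

theorem norm_sub_sub_le (hf : IsHolderC1 α ε H f) (hα : 0 ≤ α) (hH : 0 ≤ H) (x y : E) :
    ‖f y - f x - fderiv ℝ f x (y - x)‖ ≤ H * ‖y - x‖ ^ α * ‖y - x‖ := by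
  refine (convex_closedBall x ‖y - x‖).norm_image_sub_le_of_norm_fderiv_le' (𝕜 := ℝ)
    (fun z _ => hf.differentiable z) (fun z hz => (hf.holder z x).trans ?_)
    (by simp) (by simp [dist_eq_norm])
  rw [Metric.mem_closedBall, dist_eq_norm] at hz
  gcongr

theorem zero (hε : 0 ≤ ε) (hH : 0 ≤ H) : IsHolderC1 α ε H (fun _ : E => (0 : F)) where
  differentiable := differentiable_const _
  norm_fderiv_le x := by simpa using hε
  holder x y := by simp; positivity
  map_zero := rfl
  fderiv_zero := by simp

theorem clm_comp (hf : IsHolderC1 α ε H f) (L : F →L[ℝ] G) :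
    IsHolderC1 α (‖L‖ * ε) (‖L‖ * H) (fun x => L (f x)) := by
  have hd : ∀ x, fderiv ℝ (fun x => L (f x)) x = L.comp (fderiv ℝ f x) := fun x =>
    (L.hasFDerivAt.comp x (hf.differentiable x).hasFDerivAt).fderiv
  refine ⟨fun x => L.differentiableAt.comp x (hf.differentiable x), fun x => ?_, fun x y => ?_,
    by simp [hf.map_zero], by simp [hd, hf.fderiv_zero]⟩
  · rw [hd]
    exact (L.opNorm_comp_le _).trans (by gcongr; exact hf.norm_fderiv_le x)
  · rw [hd, hd, ← ContinuousLinearMap.comp_sub, mul_assoc]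
    exact (L.opNorm_comp_le _).trans (by gcongr; exact hf.holder x y)

theorem comp_clm (hf : IsHolderC1 α ε H f) (hα : 0 ≤ α) (hH : 0 ≤ H) (R : G →L[ℝ] E) :
    IsHolderC1 α (ε * ‖R‖) (H * ‖R‖ ^ α * ‖R‖) (fun x => f (R x)) := by
  have hd : ∀ x, fderiv ℝ (fun x => f (R x)) x = (fderiv ℝ f (R x)).comp R := fun x =>
    ((hf.differentiable (R x)).hasFDerivAt.comp x R.hasFDerivAt).fderiv
  refine ⟨fun x => (hf.differentiable _).comp x R.differentiableAt, fun x => ?_, fun x y => ?_,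
    by simp [hf.map_zero], by simp [hd, hf.fderiv_zero]⟩
  · rw [hd]
    exact (ContinuousLinearMap.opNorm_comp_le _ _).trans (by gcongr; exact hf.norm_fderiv_le _)
  · rw [hd, hd, ← ContinuousLinearMap.sub_comp]
    calc _ ≤ _ := ContinuousLinearMap.opNorm_comp_le _ _
      _ ≤ (H * ‖R x - R y‖ ^ α) * ‖R‖ := by gcongr; exact hf.holder _ _
      _ ≤ (H * (‖R‖ * ‖x - y‖) ^ α) * ‖R‖ := by
        rw [← map_sub]
        gcongr
        exact R.le_opNorm _
      _ = _ := by rw [Real.mul_rpow (norm_nonneg _) (norm_nonneg _)]; ring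

theorem of_tendsto [FiniteDimensional ℝ E] [FiniteDimensional ℝ F] (hα : 0 < α) (hH : 0 ≤ H)
    {W : ℕ → E → F} (hW : ∀ n, IsHolderC1 α ε H (W n))
    (hlim : ∀ x, Tendsto (fun n => W n x) atTop (𝓝 (f x))) : IsHolderC1 α ε H f := by
  set u : Ultrafilter ℕ := hyperfilter ℕ
  have hu : (u : Filter ℕ) ≤ atTop := Nat.hyperfilter_le_atTop
  have hL : ∀ x, ∃ L : E →L[ℝ] F, Tendsto (fun n => fderiv ℝ (W n) x) u (𝓝 L) := by
    intro x
    have : ProperSpace (E →L[ℝ] F) := FiniteDimensional.proper ℝ _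
    have hK : IsCompact (Metric.closedBall (0 : E →L[ℝ] F) ε) := isCompact_closedBall _ _
    obtain ⟨L, -, hL⟩ := hK.ultrafilter_le_nhds (u.map fun n => fderiv ℝ (W n) x) (by
      rw [le_principal_iff]
      exact Filter.Eventually.of_forall (f := (u : Filter ℕ)) fun n => by
        simpa using (hW n).norm_fderiv_le x)
    exact ⟨L, hL⟩
  choose L hL using hL
  have hf : ∀ x, HasFDerivAt f (L x) x := by
    intro x
    have hT : ∀ y, ‖f y - f x - L x (y - x)‖ ≤ H * ‖y - x‖ ^ α * ‖y - x‖ := fun y =>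
      le_of_tendsto
        ((((hlim y).mono_left hu).sub ((hlim x).mono_left hu)).sub
          (((ContinuousLinearMap.apply ℝ F (y - x)).continuous.tendsto _).comp (hL x))).norm
        (Eventually.of_forall fun n => (hW n).norm_sub_sub_le hα.le hH x y)
    rw [hasFDerivAt_iff_isLittleO]
    have h1 : (fun y => f y - f x - L x (y - x)) =O[𝓝 x] fun y => ‖y - x‖ ^ α * ‖y - x‖ := by
      refine Asymptotics.IsBigO.of_bound H (Eventually.of_forall fun y => (hT y).trans_eq ?_)
      rw [Real.norm_of_nonneg (by positivity)]; ring
    have h2 : (fun y => ‖y - x‖ ^ α * ‖y - x‖) =o[𝓝 x] fun y => 1 * ‖y - x‖ := by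
      refine Asymptotics.IsLittleO.mul_isBigO ?_ (Asymptotics.isBigO_refl _ _)
      rw [Asymptotics.isLittleO_one_iff]
      have h : Continuous fun y : E => ‖y - x‖ ^ α :=
        (continuous_id.sub continuous_const).norm.rpow_const fun _ => Or.inr hα.le
      simpa [Real.zero_rpow hα.ne'] using h.tendsto x
    exact (h1.trans_isLittleO (by simpa using h2.norm_right)).trans_isBigO
      (Asymptotics.isBigO_refl _ _)
  refine ⟨fun x => (hf x).differentiableAt, fun x => ?_, fun x y => ?_, ?_, ?_⟩
  · rw [(hf x).fderiv]
    exact le_of_tendsto (hL x).norm (Eventually.of_forall fun n => (hW n).norm_fderiv_le x)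
  · rw [(hf x).fderiv, (hf y).fderiv]
    exact le_of_tendsto ((hL x).sub (hL y)).norm
      (Eventually.of_forall fun n => (hW n).holder x y)
  · refine tendsto_nhds_unique (hlim 0) ?_
    simp [(hW _).map_zero]
  · rw [(hf 0).fderiv]
    refine tendsto_nhds_unique (hL 0) ?_
    simp [(hW _).fderiv_zero]

end IsHolderC1

/-- The backward graph transform of the skew map
`(x, y) ↦ (B x + g (x, y), C⁻¹ y + h (x, y))`. -/
def graphTransform {X Y : Type*} [NormedAddCommGroup X] [NormedSpace ℝ X]
    [NormedAddCommGroup Y] [NormedSpace ℝ Y] (B : X →L[ℝ] X) (C : Y →L[ℝ] Y)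
    (g : X × Y → X) (h : X × Y → Y) (W : X → Y) (x : X) : Y :=
  C (W (B x + g (x, W x)) - h (x, W x))

section GraphTransform

variable {X Y : Type*} [NormedAddCommGroup X] [NormedSpace ℝ X]
  [NormedAddCommGroup Y] [NormedSpace ℝ Y] {α ε δ b c : ℝ}
  {B : X →L[ℝ] X} {C : Y →L[ℝ] Y} {g : X × Y → X} {h : X × Y → Y} {W V : X → Y}

theorem norm_graph_sub_le (hε1 : ε ≤ 1) (hW : IsHolderC1 α ε 1 W) (x y : X) :
    ‖(x, W x) - (y, W y)‖ ≤ ‖x - y‖ := by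
  have h1 := hW.norm_map_sub_le x y
  have : ε * ‖x - y‖ ≤ ‖x - y‖ := mul_le_of_le_one_left (norm_nonneg _) hε1
  simpa [Prod.norm_def] using h1.trans this

theorem IsHolderC1.comp_graph {F : Type*} [NormedAddCommGroup F] [NormedSpace ℝ F]
    {k : X × Y → F} (hα : 0 ≤ α) (hε1 : ε ≤ 1) (hδ : 0 ≤ δ) (hk : IsHolderC1 α δ δ k)
    (hW : IsHolderC1 α ε 1 W) : IsHolderC1 α δ (2 * δ) (fun x => k (x, W x)) := by
  have hd : ∀ x, HasFDerivAt (fun x => k (x, W x))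
      ((fderiv ℝ k (x, W x)).comp ((ContinuousLinearMap.id ℝ X).prod (fderiv ℝ W x))) x :=
    fun x => HasFDerivAt.comp x (g := k) (hk.differentiable _).hasFDerivAt
      ((hasFDerivAt_id x).prodMk (hW.differentiable x).hasFDerivAt)
  have hI : ∀ x, ‖(ContinuousLinearMap.id ℝ X).prod (fderiv ℝ W x)‖ ≤ 1 := fun x => by
    rw [ContinuousLinearMap.opNorm_prod, Prod.norm_def]
    exact max_le ContinuousLinearMap.norm_id_le ((hW.norm_fderiv_le x).trans hε1)
  refine ⟨fun x => (hd x).differentiableAt, fun x => ?_, fun x y => ?_, ?_, ?_⟩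
  · rw [(hd x).fderiv]
    calc _ ≤ _ := ContinuousLinearMap.opNorm_comp_le _ _
      _ ≤ δ * 1 := by
        gcongr
        exacts [hk.norm_fderiv_le _, hI x]
      _ = δ := mul_one δ
  · rw [(hd x).fderiv, (hd y).fderiv]
    have e : (fderiv ℝ k (x, W x)).comp ((ContinuousLinearMap.id ℝ X).prod (fderiv ℝ W x)) -
        (fderiv ℝ k (y, W y)).comp ((ContinuousLinearMap.id ℝ X).prod (fderiv ℝ W y)) =
        (fderiv ℝ k (x, W x) - fderiv ℝ k (y, W y)).comp
          ((ContinuousLinearMap.id ℝ X).prod (fderiv ℝ W x)) +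
        (fderiv ℝ k (y, W y)).comp
          ((0 : X →L[ℝ] X).prod (fderiv ℝ W x - fderiv ℝ W y)) := by
      ext v
      simp only [ContinuousLinearMap.comp_apply, sub_apply,
        add_apply, ContinuousLinearMap.prod_apply, ContinuousLinearMap.id_apply, zero_apply]
      rw [sub_add, ← map_sub]
      simp
    have hO : ‖(0 : X →L[ℝ] X).prod (fderiv ℝ W x - fderiv ℝ W y)‖ ≤ ‖x - y‖ ^ α := by
      rw [ContinuousLinearMap.opNorm_prod, Prod.norm_def]
      exact max_le (by simp; positivity) ((hW.holder x y).trans_eq (one_mul _))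
    rw [e]
    calc _ ≤ _ := norm_add_le _ _
      _ ≤ _ := add_le_add (ContinuousLinearMap.opNorm_comp_le _ _)
        (ContinuousLinearMap.opNorm_comp_le _ _)
      _ ≤ (δ * ‖x - y‖ ^ α) * 1 + δ * ‖x - y‖ ^ α := by
        gcongr
        · refine (hk.holder _ _).trans ?_
          gcongr
          exact norm_graph_sub_le hε1 hW x y
        · exact hI x
        · exact hk.norm_fderiv_le _
      _ = 2 * δ * ‖x - y‖ ^ α := by ring
  · rw [hW.map_zero]
    exact hk.map_zero
  · rw [(hd 0).fderiv, hW.map_zero]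
    have := hk.fderiv_zero
    rw [Prod.zero_eq_mk] at this
    simp [this]

theorem IsHolderC1.graphTransform (hα : 0 ≤ α) (hα1 : α ≤ 1) (hε : 0 ≤ ε) (hε1 : ε ≤ 1)
    (hδ : 0 ≤ δ) (hb : 1 ≤ b) (hc : 0 ≤ c) (hB : ‖B‖ ≤ b) (hC : ‖C‖ ≤ c)
    (hg : IsHolderC1 α δ δ g) (hh : IsHolderC1 α δ δ h)
    (h1 : c * ((b + δ) ^ 2 + 4 * δ) ≤ 1) (h2 : c * (ε * (b + δ) + δ) ≤ ε)
    (hW : IsHolderC1 α ε 1 W) : IsHolderC1 α ε 1 (graphTransform B C g h W) := by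
  have hG := hg.comp_graph hα hε1 hδ hW
  have hK := hh.comp_graph hα hε1 hδ hW
  set G := fun x => g (x, W x)
  set K := fun x => h (x, W x)
  set φ : X → X := fun x => B x + G x with hφ
  have hφd : ∀ x, HasFDerivAt φ (B + fderiv ℝ G x) x := fun x =>
    B.hasFDerivAt.add (hG.differentiable x).hasFDerivAt
  have hφn : ∀ x, ‖B + fderiv ℝ G x‖ ≤ b + δ := fun x =>
    (norm_add_le _ _).trans (add_le_add hB (hG.norm_fderiv_le x))
  have hφ0 : φ 0 = 0 := by simp [hφ, hG.map_zero]
  have hβ : 0 ≤ b + δ := by linarith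
  have hφl : ∀ x y, ‖φ x - φ y‖ ≤ (b + δ) * ‖x - y‖ := fun x y => by
    have : φ x - φ y = B (x - y) + (G x - G y) := by simp only [hφ, map_sub]; abel
    rw [this, add_mul]
    exact (norm_add_le _ _).trans (add_le_add (B.le_of_opNorm_le hB _) (hG.norm_map_sub_le x y))
  have hd : ∀ x, HasFDerivAt (_root_.graphTransform B C g h W)
      (C.comp ((fderiv ℝ W (φ x)).comp (B + fderiv ℝ G x) - fderiv ℝ K x)) x := fun x =>
    C.hasFDerivAt.comp x (((hW.differentiable (φ x)).hasFDerivAt.comp x (hφd x)).sub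
      (hK.differentiable x).hasFDerivAt)
  refine ⟨fun x => (hd x).differentiableAt, fun x => ?_, fun x y => ?_, ?_, ?_⟩
  · rw [(hd x).fderiv]
    calc _ ≤ _ := ContinuousLinearMap.opNorm_comp_le _ _
      _ ≤ c * (ε * (b + δ) + δ) := by
        gcongr
        refine (norm_sub_le _ _).trans (add_le_add ?_ (hK.norm_fderiv_le x))
        refine (ContinuousLinearMap.opNorm_comp_le _ _).trans ?_
        gcongr
        exacts [hW.norm_fderiv_le _, hφn x]
      _ ≤ ε := h2
  · rw [(hd x).fderiv, (hd y).fderiv]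
    have e : C.comp ((fderiv ℝ W (φ x)).comp (B + fderiv ℝ G x) - fderiv ℝ K x) -
        C.comp ((fderiv ℝ W (φ y)).comp (B + fderiv ℝ G y) - fderiv ℝ K y) =
        C.comp ((fderiv ℝ W (φ x) - fderiv ℝ W (φ y)).comp (B + fderiv ℝ G x) +
          (fderiv ℝ W (φ y)).comp (fderiv ℝ G x - fderiv ℝ G y) -
          (fderiv ℝ K x - fderiv ℝ K y)) := by
      rw [← ContinuousLinearMap.comp_sub]
      congr 1
      simp only [ContinuousLinearMap.sub_comp, ContinuousLinearMap.comp_add,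
        ContinuousLinearMap.comp_sub]
      abel
    have hW' : ‖fderiv ℝ W (φ x) - fderiv ℝ W (φ y)‖ ≤ (b + δ) * ‖x - y‖ ^ α :=
      calc _ ≤ _ := hW.holder _ _
        _ ≤ ((b + δ) * ‖x - y‖) ^ α := by
          rw [one_mul]
          gcongr
          exact hφl x y
        _ = (b + δ) ^ α * ‖x - y‖ ^ α := Real.mul_rpow hβ (norm_nonneg _)
        _ ≤ (b + δ) * ‖x - y‖ ^ α := by
          gcongr
          exact Real.rpow_le_self_of_one_le (by linarith) hα1
    rw [e]
    calc _ ≤ _ := ContinuousLinearMap.opNorm_comp_le _ _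
      _ ≤ c * ((b + δ) * ‖x - y‖ ^ α * (b + δ) + 1 * (2 * δ * ‖x - y‖ ^ α) +
          2 * δ * ‖x - y‖ ^ α) := by
        gcongr
        refine (norm_sub_le _ _).trans (add_le_add ((norm_add_le _ _).trans (add_le_add ?_ ?_))
          (hK.holder x y))
        · refine (ContinuousLinearMap.opNorm_comp_le _ _).trans ?_
          gcongr
          exact hφn x
        · refine (ContinuousLinearMap.opNorm_comp_le _ _).trans ?_
          gcongr
          exacts [(hW.norm_fderiv_le _).trans hε1, hG.holder x y]
      _ = c * ((b + δ) ^ 2 + 4 * δ) * ‖x - y‖ ^ α := by ring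
      _ ≤ 1 * ‖x - y‖ ^ α := by gcongr
  · have : _root_.graphTransform B C g h W 0 = C (W (φ 0) - K 0) := rfl
    rw [this, hφ0, hW.map_zero, hK.map_zero]
    simp
  · rw [(hd 0).fderiv, hφ0, hW.fderiv_zero, hK.fderiv_zero]
    simp

theorem norm_graphTransform_sub_le (hε1 : ε ≤ 1) (hδ : 0 ≤ δ) (hc : 0 ≤ c) (hB : ‖B‖ ≤ b) (hC : ‖C‖ ≤ c)
    (hg : IsHolderC1 α δ δ g) (hh : IsHolderC1 α δ δ h)
    (hW : IsHolderC1 α ε 1 W) (hV : IsHolderC1 α ε 1 V) {M : ℝ} (hM : 0 ≤ M)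
    (hWV : ∀ x, ‖W x - V x‖ ≤ M * ‖x‖) (x : X) :
    ‖graphTransform B C g h W x - graphTransform B C g h V x‖ ≤
      c * (b + 3 * δ) * M * ‖x‖ := by
  have hp : ‖(x, W x) - (x, V x)‖ ≤ M * ‖x‖ := by
    simpa [Prod.norm_def] using hWV x
  have hgx := (hg.norm_map_sub_le (x, W x) (x, V x)).trans (mul_le_mul_of_nonneg_left hp hδ)
  have hhx := (hh.norm_map_sub_le (x, W x) (x, V x)).trans (mul_le_mul_of_nonneg_left hp hδ)
  have hφ : ‖B x + g (x, V x)‖ ≤ (b + δ) * ‖x‖ := by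
    have h0 : ‖(x, V x)‖ ≤ ‖x‖ := by
      have := norm_graph_sub_le hε1 hV x 0
      rwa [hV.map_zero, ← Prod.zero_eq_mk, sub_zero, sub_zero] at this
    rw [add_mul]
    exact (norm_add_le _ _).trans (add_le_add (B.le_of_opNorm_le hB _)
      ((hg.norm_le _).trans (by gcongr)))
  have e : graphTransform B C g h W x - graphTransform B C g h V x =
      C ((W (B x + g (x, W x)) - W (B x + g (x, V x))) +
        (W (B x + g (x, V x)) - V (B x + g (x, V x))) - (h (x, W x) - h (x, V x))) := by
    rw [graphTransform, graphTransform, ← map_sub]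
    congr 1
    abel
  rw [e]
  calc _ ≤ c * _ := C.le_of_opNorm_le hC _
    _ ≤ c * (1 * (δ * (M * ‖x‖)) + M * ((b + δ) * ‖x‖) + δ * (M * ‖x‖)) := by
      gcongr
      refine (norm_sub_le _ _).trans (add_le_add ((norm_add_le _ _).trans (add_le_add ?_ ?_)) hhx)
      · refine (hW.norm_map_sub_le _ _).trans ?_
        gcongr
        simpa using hgx
      · exact (hWV _).trans (by gcongr)
    _ = _ := by ring

theorem exists_graphTransform_fixed [FiniteDimensional ℝ X] [FiniteDimensional ℝ Y]
    (hα : 0 < α) (hα1 : α ≤ 1) (hε : 0 < ε) (hε1 : ε ≤ 1)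
    (hδ : 0 ≤ δ) (hb : 1 ≤ b) (hc : 0 ≤ c) (hB : ‖B‖ ≤ b) (hC : ‖C‖ ≤ c)
    (hg : IsHolderC1 α δ δ g) (hh : IsHolderC1 α δ δ h)
    (h1 : c * ((b + δ) ^ 2 + 4 * δ) ≤ 1) (h2 : c * (ε * (b + δ) + δ) ≤ ε)
    (h3 : c * (b + 3 * δ) < 1) {Z : Set X} (hZh : ∀ x ∈ Z, h (x, 0) = 0)
    (hZg : ∀ x ∈ Z, B x + g (x, 0) ∈ Z) :
    ∃ W : X → Y, IsHolderC1 α ε 1 W ∧ (∀ x ∈ Z, W x = 0) ∧ graphTransform B C g h W = W := by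
  set T := graphTransform B C g h with hT
  set W : ℕ → X → Y := fun n => T^[n] fun _ => 0 with hWdef
  have hsucc : ∀ n, W (n + 1) = T (W n) := fun n => Function.iterate_succ_apply' _ _ _
  have hW : ∀ n, IsHolderC1 α ε 1 (W n) := by
    intro n
    induction n with
    | zero => exact IsHolderC1.zero hε.le zero_le_one
    | succ n ih =>
      rw [hsucc]
      exact hg.graphTransform hα.le hα1 hε.le hε1 hδ hb hc hB hC hh h1 h2 ih
  have hZ : ∀ n, ∀ x ∈ Z, W n x = 0 := by
    intro n
    induction n with
    | zero => exact fun _ _ => rfl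
    | succ n ih =>
      intro x hx
      rw [hsucc, hT, graphTransform, ih x hx, ih _ (hZg x hx), hZh x hx]
      simp
  have hb0 : 0 ≤ b := by linarith
  have hk0 : 0 ≤ c * (b + 3 * δ) := by positivity
  have hstep : ∀ n x, ‖W (n + 1) x - W n x‖ ≤ ((c * (b + 3 * δ)) ^ n * ε) * ‖x‖ := by
    intro n
    induction n with
    | zero =>
      intro x
      have : W 0 x = 0 := rfl
      simpa [this] using (hW 1).norm_le x
    | succ n ih =>
      intro x
      rw [hsucc (n + 1), hsucc n, pow_succ', mul_assoc (c * (b + 3 * δ))]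
      refine norm_graphTransform_sub_le hε1 hδ hc hB hC hg hh ?_ (hW n)
        (by positivity) (fun x => by rw [← hsucc]; exact ih x) x
      rw [← hsucc]
      exact hW _
  have hlim : ∀ x, ∃ y, Tendsto (fun n => W n x) atTop (𝓝 y) := fun x => by
    have : CompleteSpace Y := FiniteDimensional.complete ℝ Y
    refine cauchySeq_tendsto_of_complete
      (cauchySeq_of_le_geometric (c * (b + 3 * δ)) (ε * ‖x‖) h3 fun n => ?_)
    rw [dist_comm, dist_eq_norm]
    exact (hstep n x).trans_eq (by ring)
  choose V hV using hlim
  have hV' : IsHolderC1 α ε 1 V := IsHolderC1.of_tendsto hα zero_le_one hW hV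
  refine ⟨V, hV', fun x hx => tendsto_nhds_unique (hV x) ?_, funext fun x => ?_⟩
  · simp [hZ _ x hx]
  · refine tendsto_nhds_unique ?_ ((tendsto_add_atTop_iff_nat 1).2 (hV x))
    have hp : Tendsto (fun n => (x, W n x)) atTop (𝓝 (x, V x)) :=
      tendsto_const_nhds.prodMk_nhds (hV x)
    have hgp := (hg.differentiable.continuous.tendsto _).comp hp
    have hhp := (hh.differentiable.continuous.tendsto _).comp hp
    have hφ : Tendsto (fun n => B x + g (x, W n x)) atTop (𝓝 (B x + g (x, V x))) :=
      tendsto_const_nhds.add hgp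
    have hWφ : Tendsto (fun n => W n (B x + g (x, W n x))) atTop
        (𝓝 (V (B x + g (x, V x)))) := by
      have h0 : Tendsto (fun n => W n (B x + g (x, W n x)) - W n (B x + g (x, V x))) atTop
          (𝓝 0) := by
        refine squeeze_zero_norm (fun n => (hW n).norm_map_sub_le _ _) ?_
        simpa using (tendsto_iff_norm_sub_tendsto_zero.1 hφ).const_mul ε
      simpa using h0.add (hV (B x + g (x, V x)))
    simp only [hsucc]
    exact (C.continuous.tendsto _).comp (hWφ.sub hhp)

end GraphTransform

/-- A linear map `L` commuting with a projection `p` on whose range its powers grow at a rate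
smaller than `ρ` has norm at most `ρ` there, for some norm on the range. -/
theorem exists_adapted_norm {E : Type} [NormedAddCommGroup E] [NormedSpace ℝ E]
    [FiniteDimensional ℝ E] (L p : E →L[ℝ] E) (hp : ∀ x, p (p x) = p x)
    (hL : ∀ x, L (p x) = p (L x)) {K r ρ : ℝ} (hr : 0 ≤ r) (hrρ : r < ρ)
    (hK : ∀ n : ℕ, ‖(L ^ n).comp p‖ ≤ K * r ^ n) :
    ∃ (X : Type) (_ : NormedAddCommGroup X) (_ : NormedSpace ℝ X) (_ : FiniteDimensional ℝ X)
      (i : X →L[ℝ] E) (j : E →L[ℝ] X),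
      (∀ x, i (j x) = p x) ∧ (∀ x, j (i x) = x) ∧ ‖j.comp (L.comp i)‖ ≤ ρ := by
  have hρ : 0 < ρ := hr.trans_lt hrρ
  obtain ⟨N, hN⟩ : ∃ N : ℕ, K * (r / ρ) ^ (N + 1) ≤ 1 := by
    have h : Tendsto (fun n : ℕ => K * (r / ρ) ^ (n + 1)) atTop (𝓝 (K * 0)) :=
      ((tendsto_add_atTop_iff_nat 1).2 (tendsto_pow_atTop_nhds_zero_of_lt_one (by positivity)
        ((div_lt_one hρ).2 hrρ))).const_mul K
    rw [mul_zero] at h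
    exact (h.eventually (ge_mem_nhds one_pos)).exists
  have hNx : ∀ x, ‖(ρ⁻¹) ^ (N + 1) • (L ^ (N + 1)) (p x)‖ ≤ ‖x‖ := fun x => by
    rw [norm_smul, Real.norm_of_nonneg (by positivity)]
    calc _ ≤ (ρ⁻¹) ^ (N + 1) * (K * r ^ (N + 1) * ‖x‖) := by
          gcongr
          exact ((L ^ (N + 1)).comp p).le_of_opNorm_le (hK _) x
      _ = K * (r / ρ) ^ (N + 1) * ‖x‖ := by rw [div_pow, inv_pow]; ring
      _ ≤ 1 * ‖x‖ := by gcongr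
      _ = ‖x‖ := one_mul _
  let J : E →L[ℝ] (Fin (N + 1) → E) :=
    ContinuousLinearMap.pi fun n => (ρ⁻¹) ^ (n : ℕ) • (L ^ (n : ℕ)).comp p
  have hJ : ∀ x n, J x n = (ρ⁻¹) ^ (n : ℕ) • (L ^ (n : ℕ)) (p x) := fun _ _ => rfl
  let i : J.range →L[ℝ] E :=
    (ContinuousLinearMap.proj (0 : Fin (N + 1))).comp J.range.subtypeL
  let j : E →L[ℝ] J.range := J.codRestrict J.range fun x => ⟨x, rfl⟩
  have hij : ∀ x, i (j x) = p x := fun x => by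
    change J x 0 = p x
    simp [hJ]
  have hJp : ∀ x, J (p x) = J x := fun x => by
    ext1 n
    rw [hJ, hJ, hp]
  have hji : ∀ x, j (i x) = x := by
    rintro ⟨_, x, rfl⟩
    have h : i ⟨J x, x, rfl⟩ = p x := hij x
    rw [Subtype.ext_iff]
    change J (i ⟨J x, x, rfl⟩) = J x
    rw [h, hJp]
  refine ⟨J.range, inferInstance, inferInstance, inferInstance, i, j, hij, hji,
    ContinuousLinearMap.opNorm_le_bound _ hρ.le ?_⟩
  rintro ⟨_, x, rfl⟩
  have h : i ⟨J x, x, rfl⟩ = p x := hij x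
  change ‖J (L (i ⟨J x, x, rfl⟩))‖ ≤ ρ * ‖J x‖
  rw [h, pi_norm_le_iff_of_nonneg (by positivity)]
  intro n
  have e : J (L (p x)) n = ρ • ((ρ⁻¹) ^ ((n : ℕ) + 1) • (L ^ ((n : ℕ) + 1)) (p x)) := by
    rw [hJ, ← hL, hp, smul_smul, pow_succ' ρ⁻¹, mul_inv_cancel_left₀ hρ.ne', pow_succ]
    rfl
  rw [e, norm_smul, Real.norm_of_nonneg hρ.le]
  gcongr
  rcases Nat.lt_or_ge ((n : ℕ) + 1) (N + 1) with hn | hn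
  · exact norm_le_pi_norm (J x) ⟨(n : ℕ) + 1, hn⟩
  · have hn' : (n : ℕ) + 1 = N + 1 := le_antisymm n.2 hn
    have h0 : J x 0 = p x := by simp [hJ]
    rw [hn', ← hp x]
    refine (hNx (p x)).trans ?_
    rw [← h0]
    exact norm_le_pi_norm (J x) 0

theorem surjective_add_of_small_lipschitz {E : Type*} [NormedAddCommGroup E] [NormedSpace ℝ E]
    [CompleteSpace E] (A : E ≃L[ℝ] E) (r : E → E) {k : ℝ}
    (hr : ∀ x y, ‖r x - r y‖ ≤ k * ‖x - y‖)
    (hk : ‖(A.symm : E →L[ℝ] E)‖ * k ≤ 1 / 2) :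
    Function.Surjective fun x => A x + r x := by
  intro z
  have hT : ContractingWith (1 / 2) fun x => A.symm (z - r x) := by
    refine ⟨by rw [← NNReal.coe_lt_coe]; norm_num, LipschitzWith.of_dist_le_mul fun x y => ?_⟩
    rw [dist_eq_norm, dist_eq_norm, ← map_sub, sub_sub_sub_cancel_left]
    calc _ ≤ ‖(A.symm : E →L[ℝ] E)‖ * ‖r y - r x‖ := (A.symm : E →L[ℝ] E).le_opNorm _
      _ ≤ ‖(A.symm : E →L[ℝ] E)‖ * (k * ‖x - y‖) := by
        gcongr
        rw [norm_sub_rev x]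
        exact hr y x
      _ = ‖(A.symm : E →L[ℝ] E)‖ * k * ‖x - y‖ := by ring
      _ ≤ 1 / 2 * ‖x - y‖ := by gcongr
      _ = _ := by simp
  refine ⟨hT.fixedPoint, ?_⟩
  have h := congrArg A hT.fixedPoint_isFixedPt
  simp only [A.apply_symm_apply] at h
  exact (sub_eq_iff_eq_add.1 h).symm

/-- A perturbation of a linear isomorphism which is small in `C^{1,α}` is invertible, and its inverse
is a similar perturbation of the inverse isomorphism. -/
theorem IsHolderC1.exists_inverse {E : Type*} [NormedAddCommGroup E] [NormedSpace ℝ E]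
    [FiniteDimensional ℝ E] (A : E ≃L[ℝ] E) {α : ℝ} (hα : 0 ≤ α) :
    ∃ M > (0 : ℝ), ∃ δ₀ > (0 : ℝ), ∀ (F f : E → E) (δ : ℝ), 0 < δ → δ ≤ δ₀ →
      (∀ x, F x = A x + f x) → IsHolderC1 α δ δ f →
      ∃ G g : E → E, Function.LeftInverse G F ∧ Function.RightInverse G F ∧
        (∀ x, G x = A.symm x + g x) ∧ IsHolderC1 α (M * δ) (M * δ) g := by
  set a := ‖(A.symm : E →L[ℝ] E)‖
  have ha : 0 ≤ a := norm_nonneg _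
  refine ⟨1 + 2 * a ^ 2 + 2 * a * (2 * a) ^ α * (2 * a), by positivity, 1 / (2 * a + 1),
    by positivity, fun F f δ hδ0 hδ hF hf => ?_⟩
  have haδ : a * δ ≤ 1 / 2 := by
    rw [le_div_iff₀ (by positivity)] at hδ
    linarith
  have hFsurj : Function.Surjective F := by
    have h := surjective_add_of_small_lipschitz A f hf.norm_map_sub_le haδ
    rwa [← funext hF] at h
  have hanti : ∀ x y, ‖x - y‖ ≤ 2 * a * ‖F x - F y‖ := fun x y => by
    have e : x - y = A.symm (F x - F y) - A.symm (f x - f y) := by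
      rw [← map_sub, hF, hF, ← A.symm_apply_apply (x - y), map_sub A]
      congr 1
      abel
    have h1 : ‖x - y‖ ≤ a * ‖F x - F y‖ + a * ‖f x - f y‖ := by
      conv_lhs => rw [e]
      exact (norm_sub_le _ _).trans (add_le_add ((A.symm : E →L[ℝ] E).le_opNorm _)
        ((A.symm : E →L[ℝ] E).le_opNorm _))
    have h2 : a * ‖f x - f y‖ ≤ 1 / 2 * ‖x - y‖ :=
      calc _ ≤ a * (δ * ‖x - y‖) := by gcongr; exact hf.norm_map_sub_le x y
        _ = a * δ * ‖x - y‖ := by ring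
        _ ≤ _ := by gcongr
    linarith
  have hFinj : Function.Injective F := fun x y hxy => by
    have := hanti x y
    rw [hxy, sub_self, norm_zero, mul_zero] at this
    exact sub_eq_zero.1 (norm_le_zero_iff.1 this)
  obtain ⟨G, hGF, hFG⟩ := Function.bijective_iff_has_inverse.1 ⟨hFinj, hFsurj⟩
  have hGl : ∀ x y, ‖G x - G y‖ ≤ 2 * a * ‖x - y‖ := fun x y => by
    simpa only [hFG x, hFG y] using hanti (G x) (G y)
  have hGlip : LipschitzWith ⟨2 * a, by positivity⟩ G :=
    LipschitzWith.of_dist_le_mul fun x y => by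
      rw [dist_eq_norm, dist_eq_norm]
      exact hGl x y
  have hF0 : F 0 = 0 := by simp [hF, hf.map_zero]
  have hG0 : G 0 = 0 := by rw [← hF0, hGF, hF0]
  have hGe : ∀ x, G x = A.symm x + -(A.symm (f (G x))) := fun x => by
    have h := hF (G x)
    rw [hFG] at h
    rw [← sub_eq_add_neg, ← map_sub, eq_comm, A.symm_apply_eq]
    exact sub_eq_iff_eq_add.2 h
  have hGd : Differentiable ℝ G := fun x => by
    set D := (A : E →L[ℝ] E) + fderiv ℝ f (G x)
    have hD : HasFDerivAt F D (G x) := by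
      have h := (A : E →L[ℝ] E).hasFDerivAt.add (hf.differentiable (G x)).hasFDerivAt
      exact h.congr_of_eventuallyEq (Eventually.of_forall hF)
    have hDinj : Function.Injective D := by
      rw [injective_iff_map_eq_zero]
      intro v hv
      have h1 : A v + fderiv ℝ f (G x) v = 0 := hv
      have h2 : v = -A.symm (fderiv ℝ f (G x) v) := by
        rw [← map_neg, ← eq_neg_of_add_eq_zero_left h1, A.symm_apply_apply]
      have h3 : ‖v‖ ≤ 1 / 2 * ‖v‖ :=
        calc ‖v‖ = ‖A.symm (fderiv ℝ f (G x) v)‖ := by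
              conv_lhs => rw [h2]
              exact norm_neg _
          _ ≤ a * (δ * ‖v‖) := (A.symm : E →L[ℝ] E).le_opNorm_of_le
              ((fderiv ℝ f (G x)).le_of_opNorm_le (hf.norm_fderiv_le _) v)
          _ = a * δ * ‖v‖ := by ring
          _ ≤ _ := by gcongr
      have h4 := norm_nonneg v
      exact norm_le_zero_iff.1 (by linarith)
    let e : E ≃L[ℝ] E :=
      (LinearEquiv.ofInjectiveEndo (D : E →ₗ[ℝ] E) hDinj).toContinuousLinearEquiv
    have he : (e : E →L[ℝ] E) = D := by
      ext v
      rfl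
    rw [← he] at hD
    exact (HasFDerivAt.of_local_left_inverse hGlip.continuous.continuousAt hD
      (Eventually.of_forall hFG)).differentiableAt
  have hGn : ∀ x, ‖fderiv ℝ G x‖ ≤ 2 * a := fun x =>
    norm_fderiv_le_of_lipschitz ℝ hGlip
  set g : E → E := fun x => -(A.symm (f (G x))) with hg
  have hgd : ∀ x, HasFDerivAt g (-((A.symm : E →L[ℝ] E).comp
      ((fderiv ℝ f (G x)).comp (fderiv ℝ G x)))) x := fun x =>
    ((A.symm : E →L[ℝ] E).hasFDerivAt.comp x
      ((hf.differentiable (G x)).hasFDerivAt.comp x (hGd x).hasFDerivAt)).neg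
  have hGg : ∀ x y, fderiv ℝ G x - fderiv ℝ G y = fderiv ℝ g x - fderiv ℝ g y := by
    have h : ∀ x, fderiv ℝ G x = A.symm + fderiv ℝ g x := fun x => by
      have h := (A.symm : E →L[ℝ] E).hasFDerivAt.add (hgd x).differentiableAt.hasFDerivAt
      exact (h.congr_of_eventuallyEq (Eventually.of_forall hGe)).fderiv
    intro x y
    rw [h, h, add_sub_add_left_eq_sub]
  refine ⟨G, g, hGF, hFG, hGe, fun x => (hgd x).differentiableAt, fun x => ?_, fun x y => ?_,
    by simp [hg, hG0, hf.map_zero], by simp [(hgd 0).fderiv, hG0, hf.fderiv_zero]⟩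
  · rw [(hgd x).fderiv, norm_neg]
    calc _ ≤ a * (δ * (2 * a)) := by
          refine (ContinuousLinearMap.opNorm_comp_le _ _).trans ?_
          gcongr
          refine (ContinuousLinearMap.opNorm_comp_le _ _).trans ?_
          gcongr
          exacts [hf.norm_fderiv_le _, hGn x]
      _ = 2 * a ^ 2 * δ := by ring
      _ ≤ _ := by
        have : 0 ≤ 2 * a * (2 * a) ^ α * (2 * a) := by positivity
        gcongr
        linarith
  · set Δ := ‖fderiv ℝ g x - fderiv ℝ g y‖ with hΔ
    have key : Δ ≤ a * ((δ * (2 * a * ‖x - y‖) ^ α) * (2 * a) + δ * Δ) := by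
      have e : fderiv ℝ g x - fderiv ℝ g y = -((A.symm : E →L[ℝ] E).comp
          ((fderiv ℝ f (G x) - fderiv ℝ f (G y)).comp (fderiv ℝ G x) +
            (fderiv ℝ f (G y)).comp (fderiv ℝ G x - fderiv ℝ G y))) := by
        rw [(hgd x).fderiv, (hgd y).fderiv, ← neg_sub', ← ContinuousLinearMap.comp_sub]
        congr 2
        simp only [ContinuousLinearMap.sub_comp, ContinuousLinearMap.comp_sub]
        abel
      conv_lhs => rw [hΔ, e, norm_neg]
      refine (ContinuousLinearMap.opNorm_comp_le _ _).trans ?_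
      gcongr
      refine (norm_add_le _ _).trans (add_le_add ?_ ?_)
      · refine (ContinuousLinearMap.opNorm_comp_le _ _).trans ?_
        gcongr
        · refine (hf.holder _ _).trans ?_
          gcongr
          exact hGl x y
        · exact hGn x
      · rw [hGg]
        refine (ContinuousLinearMap.opNorm_comp_le _ _).trans ?_
        gcongr
        exact hf.norm_fderiv_le _
    have hΔ0 : 0 ≤ Δ := norm_nonneg _
    have h1 : a * δ * Δ ≤ 1 / 2 * Δ := by gcongr
    rw [Real.mul_rpow (by positivity) (norm_nonneg _)] at key
    have h2 : Δ ≤ 2 * a * (2 * a) ^ α * (2 * a) * (δ * ‖x - y‖ ^ α) := by linarith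
    refine h2.trans ?_
    rw [mul_assoc _ δ]
    gcongr
    have : 0 ≤ 2 * a ^ 2 := by positivity
    linarith

/-- Smallness of the perturbation required by the graph transform. -/
theorem exists_graphTransform_threshold {b c ε : ℝ} (hb : 1 ≤ b) (hc : 0 ≤ c)
    (hbc : c * b ^ 2 < 1) (hε : 0 < ε) :
    ∃ δ > (0 : ℝ), c * ((b + δ) ^ 2 + 4 * δ) ≤ 1 ∧ c * (ε * (b + δ) + δ) ≤ ε ∧
      c * (b + 3 * δ) < 1 := by
  have hcb : c * b < 1 := lt_of_le_of_lt (by gcongr; exact le_self_pow₀ hb two_ne_zero) hbc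
  have hp : ∀ {u : ℝ → ℝ} {t : ℝ}, Continuous u → u 0 < t → ∀ᶠ δ in 𝓝[>] (0 : ℝ), u δ < t :=
    fun hu h0 => (hu.continuousAt.eventually_lt continuousAt_const h0).filter_mono
      nhdsWithin_le_nhds
  have e1 := hp (u := fun δ => c * ((b + δ) ^ 2 + 4 * δ)) (t := 1) (by fun_prop) (by simpa)
  have e2 := hp (u := fun δ => c * (ε * (b + δ) + δ)) (t := ε) (by fun_prop)
    (by simp only [add_zero]; nlinarith)
  have e3 := hp (u := fun δ => c * (b + 3 * δ)) (t := 1) (by fun_prop) (by simpa)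
  obtain ⟨δ, h0, h1, h2, h3⟩ := (eventually_mem_nhdsWithin.and (e1.and (e2.and e3))).exists
  exact ⟨δ, h0, h1.le, h2.le, h3⟩

theorem exists_invariant_graph {E : Type} [NormedAddCommGroup E] [NormedSpace ℝ E]
    [FiniteDimensional ℝ E] (A : E ≃L[ℝ] E) (p q : E →L[ℝ] E)
    (hp : ∀ x, p (p x) = p x) (hq : ∀ x, q (q x) = q x) (hpq : ∀ x, p (q x) = 0)
    (hqp : ∀ x, q (p x) = 0) (hadd : ∀ x, p x + q x = x)
    (hAp : ∀ x, A (p x) = p (A x)) (hAq : ∀ x, A (q x) = q (A x))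
    (hPf : ∀ η > (0 : ℝ), ∃ K : ℝ, ∀ n : ℕ, ‖((A : E →L[ℝ] E) ^ n).comp p‖ ≤ K * (1 + η) ^ n)
    {K r : ℝ} (hr : 0 ≤ r) (hr1 : r < 1)
    (hQb : ∀ n : ℕ, ‖((A.symm : E →L[ℝ] E) ^ n).comp q‖ ≤ K * r ^ n)
    (Z : Set E) (hZ : ∀ x ∈ Z, p x = x) {α ε : ℝ} (hα : 0 < α) (hα1 : α ≤ 1) (hε : 0 < ε) :
    ∃ δ₀ > (0 : ℝ), ∀ (F f : E → E) (δ : ℝ), 0 < δ → δ ≤ δ₀ → (∀ x, F x = A x + f x) →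
      IsHolderC1 α δ δ f → (∀ x ∈ Z, F x ∈ Z) →
      ∃ (w : E → E) (C : ℝ), IsHolderC1 α ε C w ∧ (∀ x, q (w x) = w x) ∧
        (∀ x, w x = w (p x)) ∧ (∀ x ∈ Z, w x = 0) ∧
        F '' ((fun y => y + w y) '' Set.range p) = (fun y => y + w y) '' Set.range p := by
  obtain ⟨c, hrc, hc1⟩ := exists_between hr1
  have hc0 : 0 < c := hr.trans_lt hrc
  obtain ⟨η, hη, hbc⟩ : ∃ η > (0 : ℝ), c * (1 + 2 * η) ^ 2 < 1 := by
    refine ⟨(1 - c) / 8, by linarith, ?_⟩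
    nlinarith [mul_pos hc0 (sub_pos.2 hc1), mul_pos (mul_pos hc0 (sub_pos.2 hc1)) (sub_pos.2 hc1)]
  obtain ⟨K', hK'⟩ := hPf η hη
  have hAq' : ∀ x, A.symm (q x) = q (A.symm x) := fun x => by
    rw [A.symm_apply_eq, hAq, A.apply_symm_apply]
  obtain ⟨X, _, _, _, iX, jX, hijX, hjiX, hB⟩ := exists_adapted_norm (A : E →L[ℝ] E) p hp hAp
    (by linarith : 0 ≤ 1 + η) (by linarith : 1 + η < 1 + 2 * η) hK'
  obtain ⟨Y, _, _, _, iY, jY, hijY, hjiY, hC⟩ := exists_adapted_norm (A.symm : E →L[ℝ] E) q hq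
    hAq' hr hrc hQb
  set B := jX.comp ((A : E →L[ℝ] E).comp iX)
  set C := jY.comp ((A.symm : E →L[ℝ] E).comp iY)
  set ε' := min 1 (ε / (‖iY‖ * ‖jX‖ + 1))
  have hε'0 : 0 < ε' := lt_min one_pos (by positivity)
  have hε'1 : ε' ≤ 1 := min_le_left _ _
  have hε'ε : ‖iY‖ * ε' * ‖jX‖ ≤ ε := by
    have h : ε' * (‖iY‖ * ‖jX‖ + 1) ≤ ε :=
      (le_div_iff₀ (by positivity)).1 (min_le_right _ _)
    nlinarith
  obtain ⟨δ₁, hδ₁, h1, h2, h3⟩ := exists_graphTransform_threshold (by linarith : 1 ≤ 1 + 2 * η)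
    hc0.le hbc hε'0
  set R : X × Y →L[ℝ] E := iX.coprod iY with hR
  set m := ‖R‖ + ‖R‖ ^ α * ‖R‖ + 1
  set M := (‖jX‖ + ‖jY‖ + 1) * m
  set a := ‖(A.symm : E →L[ℝ] E)‖
  have hm : 0 < m := by positivity
  have hM : 0 < M := by positivity
  refine ⟨min (δ₁ / M) (1 / (2 * (a * (‖p‖ * (‖p‖ + ε)) + 1))), by positivity,
    fun F f δ hδ0 hδ hF hf hFZ => ?_⟩
  have hMδ : M * δ ≤ δ₁ := by
    have := (le_div_iff₀ hM).1 (hδ.trans (min_le_left _ _))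
    linarith
  have haδ : a * (‖p‖ * (δ * (‖p‖ + ε))) ≤ 1 / 2 := by
    have h := (le_div_iff₀ (by positivity)).1 (hδ.trans (min_le_right _ _))
    linarith
  have hfR : ∀ {G : Type} [NormedAddCommGroup G] [NormedSpace ℝ G] (L : E →L[ℝ] G),
      ‖L‖ ≤ ‖jX‖ + ‖jY‖ + 1 → IsHolderC1 α δ₁ δ₁ (fun v => L (f (R v))) := fun L hL => by
    have hmδ : 0 ≤ m * δ := by positivity
    have hLM : ‖L‖ * (m * δ) ≤ δ₁ := by
      refine le_trans ?_ hMδ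
      rw [← mul_assoc]
      exact mul_le_mul_of_nonneg_right (mul_le_mul_of_nonneg_right hL hm.le) hδ0.le
    have hR0 : 0 ≤ ‖R‖ ^ α * ‖R‖ := by positivity
    refine ((hf.comp_clm hα.le hδ0.le R).clm_comp L).mono (le_trans ?_ hLM) (le_trans ?_ hLM)
    · rw [mul_comm δ]
      gcongr
      simp only [m]
      linarith
    · rw [mul_assoc δ, mul_comm δ]
      gcongr
      simp only [m]
      linarith [norm_nonneg R]
  have hZh : ∀ x ∈ iX ⁻¹' Z, jY (f (R (x, 0))) = 0 := fun x hx => by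
    have hz := hZ _ (hFZ _ hx)
    have e : q (f (iX x)) = 0 := by
      have h1 : f (iX x) = F (iX x) - A (iX x) := by rw [hF]; abel
      rw [h1, ← hz, ← hZ _ hx, hAp, ← map_sub, hqp]
    have h2 : jY (f (iX x)) = jY (q (f (iX x))) := by rw [← hijY, hjiY]
    simp [hR, h2, e]
  have hZg : ∀ x ∈ iX ⁻¹' Z, B x + jX (f (R (x, 0))) ∈ iX ⁻¹' Z := fun x hx => by
    have h1 : B x + jX (f (R (x, 0))) = jX (F (iX x)) := by
      rw [hF, map_add, hR, ContinuousLinearMap.coprod_apply, map_zero, add_zero]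
      rfl
    rw [Set.mem_preimage, h1, hijX, hZ _ (hFZ _ hx)]
    exact hFZ _ hx
  obtain ⟨W, hW, hWZ, hTW⟩ := exists_graphTransform_fixed hα hα1 hε'0 hε'1
    hδ₁.le (by linarith) hc0.le hB hC (hfR jX (by linarith [norm_nonneg jY]))
    (hfR jY (by linarith [norm_nonneg jX])) h1 h2 h3 hZh hZg
  set w : E → E := fun v => iY (W (jX v)) with hw
  have hqi : ∀ y, q (iY y) = iY y := fun y => by rw [← hijY, hjiY]
  have hjp : ∀ v, jX (p v) = jX v := fun v => by rw [← hijX, hjiX]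
  have hwq : ∀ v, q (w v) = w v := fun v => hqi _
  have hwp : ∀ v, w v = w (p v) := fun v => by simp only [hw, hjp]
  have hpw : ∀ v, p (w v) = 0 := fun v => by rw [← hwq, hpq]
  have hwH := ((hW.comp_clm hα.le zero_le_one jX).clm_comp iY).mono
    (by linarith : ‖iY‖ * (ε' * ‖jX‖) ≤ ε) le_rfl
  have hinv : ∀ v, p v = v → q (F (v + w v)) = w (F (v + w v)) := fun v hv => by
    have hRv : R (jX v, W (jX v)) = v + w v := by
      rw [hR, ContinuousLinearMap.coprod_apply, hijX, hv]
    have hφ : B (jX v) + jX (f (v + w v)) = jX (F (v + w v)) := by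
      have h1 : B (jX v) = jX (A v) := by
        change jX (A (iX (jX v))) = _
        rw [hijX, hv]
      have h2 : jX (A (w v)) = 0 := by rw [← hjp, ← hAp, hpw, map_zero, map_zero]
      rw [hF, map_add A, map_add jX, map_add jX, h1, h2, add_zero]
    have hfix := congrFun hTW (jX v)
    simp only [graphTransform, hRv, hφ] at hfix
    have h3 : A (w v) = w (F (v + w v)) - q (f (v + w v)) := by
      have h4 : w v = q (A.symm (iY (W (jX (F (v + w v))) - jY (f (v + w v))))) := by
        rw [← hijY]
        exact congrArg iY hfix.symm
      conv_lhs => rw [h4]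
      rw [hAq, A.apply_symm_apply, hqi, map_sub, hijY]
    have h5 : q v = 0 := by rw [← hv, hqp]
    have h6 : q (F (v + w v)) = A (w v) + q (f (v + w v)) := by
      rw [hF, map_add A, map_add q, map_add q, ← hAq, ← hAq, hwq, h5, map_zero, zero_add]
    rw [h6, h3, sub_add_cancel]
  have hmaps : ∀ v, F (p v + w (p v)) = p (F (p v + w (p v))) + w (p (F (p v + w (p v)))) :=
    fun v => by
      rw [← hwp (F _), ← hinv (p v) (hp v), hadd]
  have hlip : ∀ x y, ‖p (f (p x + w x)) - p (f (p y + w y))‖ ≤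
      ‖p‖ * (δ * (‖p‖ + ε)) * ‖x - y‖ := fun x y => by
    rw [← map_sub]
    refine (p.le_opNorm _).trans ?_
    rw [mul_assoc, mul_assoc]
    gcongr
    refine (hf.norm_map_sub_le _ _).trans ?_
    gcongr
    rw [add_sub_add_comm, ← map_sub, add_mul]
    exact (norm_add_le _ _).trans (add_le_add (p.le_opNorm _) (hwH.norm_map_sub_le x y))
  have hsurj : ∀ z, p z = z → ∃ v, p (F (p v + w (p v))) = z := fun z hz => by
    obtain ⟨v, hv⟩ := surjective_add_of_small_lipschitz A (fun v => p (f (p v + w v))) hlip haδ z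
    refine ⟨v, ?_⟩
    have h := congrArg p hv
    simp only [map_add, hp, hz] at h
    rw [← hwp, hF, map_add A, map_add p, map_add p, ← hAp (w v), hpw, map_zero, add_zero, hAp, hp,
      h]
  refine ⟨w, _, hwH, hwq, hwp, fun x hx => ?_, Set.Subset.antisymm ?_ ?_⟩
  · have h : jX x ∈ iX ⁻¹' Z := by rwa [Set.mem_preimage, hijX, hZ x hx]
    simp only [hw, hWZ _ h, map_zero]
  · rintro _ ⟨_, ⟨_, ⟨v, rfl⟩, rfl⟩, rfl⟩
    exact ⟨_, ⟨_, rfl⟩, (hmaps v).symm⟩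
  · rintro _ ⟨_, ⟨u, rfl⟩, rfl⟩
    obtain ⟨v, hv⟩ := hsurj (p u) (hp u)
    refine ⟨_, ⟨_, ⟨v, rfl⟩, rfl⟩, ?_⟩
    have h := hmaps v
    rw [hv] at h
    exact h

theorem exists_forall_norm_comp_add_le {E : Type*} [NormedAddCommGroup E] [NormedSpace ℝ E]
    (L p q : E →L[ℝ] E) {K r K' r' : ℝ} (hr : 0 ≤ r) (hr1 : r ≤ r')
    (hp : ∀ n : ℕ, ‖(L ^ n).comp p‖ ≤ K' * r' ^ n) (hq : ∀ n : ℕ, ‖(L ^ n).comp q‖ ≤ K * r ^ n) :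
    ∃ K'' : ℝ, ∀ n : ℕ, ‖(L ^ n).comp (p + q)‖ ≤ K'' * r' ^ n := by
  have hK : 0 ≤ K := by simpa using (norm_nonneg _).trans (hq 0)
  refine ⟨K' + K, fun n => ?_⟩
  rw [ContinuousLinearMap.comp_add, add_mul]
  refine (norm_add_le _ _).trans (add_le_add (hp n) ((hq n).trans ?_))
  gcongr

/-- Existence of `C^{1,α}` center-stable and center-unstable invariant
manifolds, given as graphs over `X_cs` and `X_cu`, containing `X_c`. -/
theorem center_stable_unstable_manifolds_exist
    {d : ℕ} (P : TripleProj d) (A : Euc d ≃L[ℝ] Euc d)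
    (hAs : (A : Euc d →L[ℝ] Euc d).comp P.πs = P.πs.comp (A : Euc d →L[ℝ] Euc d))
    (hAc : (A : Euc d →L[ℝ] Euc d).comp P.πc = P.πc.comp (A : Euc d →L[ℝ] Euc d))
    (hAu : (A : Euc d →L[ℝ] Euc d).comp P.πu = P.πu.comp (A : Euc d →L[ℝ] Euc d))
    (lsm lsp lum lup : ℝ)
    (hl1 : 0 < lsm) (hl2 : lsm < lsp) (hl3 : lsp < 1) (hl4 : 1 < lum) (hl5 : lum < lup)
    (hSf : ∃ K : ℝ, ∀ n : ℕ, ‖((A : Euc d →L[ℝ] Euc d) ^ n).comp P.πs‖ ≤ K * lsp ^ n)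
    (hSb : ∃ K : ℝ, ∀ n : ℕ, ‖((A.symm : Euc d →L[ℝ] Euc d) ^ n).comp P.πs‖ ≤ K * (1 / lsm) ^ n)
    (hUf : ∃ K : ℝ, ∀ n : ℕ, ‖((A : Euc d →L[ℝ] Euc d) ^ n).comp P.πu‖ ≤ K * lup ^ n)
    (hUb : ∃ K : ℝ, ∀ n : ℕ, ‖((A.symm : Euc d →L[ℝ] Euc d) ^ n).comp P.πu‖ ≤ K * (1 / lum) ^ n)
    (hC : ∀ ε > (0 : ℝ), ∃ K : ℝ, ∀ n : ℕ,
      ‖((A : Euc d →L[ℝ] Euc d) ^ n).comp P.πc‖ ≤ K * (1 + ε) ^ n ∧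
      ‖((A.symm : Euc d →L[ℝ] Euc d) ^ n).comp P.πc‖ ≤ K * (1 + ε) ^ n)
    (α : ℝ) (hα0 : 0 < α) (hα1 : α ≤ 1)
    -- target smallness for the derivatives ("globally small")
    (ε : ℝ) (hε : 0 < ε) :
    ∃ δ₀ > (0 : ℝ), ∀ (F f : Euc d → Euc d) (δf : ℝ), 0 < δf → δf ≤ δ₀ →
      (∀ x, F x = A x + f x) → Function.Bijective F →
      f 0 = 0 → fderiv ℝ f 0 = 0 → ContDiff ℝ 1 f →
      (∀ x, ‖fderiv ℝ f x‖ ≤ δf) →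
      (∀ x y, ‖fderiv ℝ f x - fderiv ℝ f y‖ ≤ δf * ‖x - y‖ ^ α) →
      -- `X_c` is invariant under `F`
      (∀ xc : Euc d, P.πc xc = xc → P.πc (F xc) = F xc) →
      ∃ wcs wcu : Euc d → Euc d,
        -- `wcs : X_cs → X_u` and `wcu : X_cu → X_s`
        (∀ x, P.πu (wcs x) = wcs x) ∧ (∀ x, wcs x = wcs ((P.πc + P.πs) x)) ∧
        (∀ x, P.πs (wcu x) = wcu x) ∧ (∀ x, wcu x = wcu ((P.πc + P.πu) x)) ∧
        -- both are `C^{1,α}`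
        ContDiff ℝ 1 wcs ∧
        (∃ C : ℝ, ∀ x y, ‖fderiv ℝ wcs x - fderiv ℝ wcs y‖ ≤ C * ‖x - y‖ ^ α) ∧
        ContDiff ℝ 1 wcu ∧
        (∃ C : ℝ, ∀ x y, ‖fderiv ℝ wcu x - fderiv ℝ wcu y‖ ≤ C * ‖x - y‖ ^ α) ∧
        -- they vanish on `X_c`
        (∀ xc : Euc d, P.πc xc = xc → wcs xc = 0 ∧ wcu xc = 0) ∧
        -- globally small derivatives, vanishing at the origin
        (∀ x, ‖fderiv ℝ wcs x‖ ≤ ε) ∧ (∀ x, ‖fderiv ℝ wcu x‖ ≤ ε) ∧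
        fderiv ℝ wcs 0 = 0 ∧ fderiv ℝ wcu 0 = 0 ∧
        -- the graphs are invariant under `F`
        F '' ((fun y => y + wcs y) '' Set.range ⇑(P.πc + P.πs))
          = (fun y => y + wcs y) '' Set.range ⇑(P.πc + P.πs) ∧
        F '' ((fun y => y + wcu y) '' Set.range ⇑(P.πc + P.πu))
          = (fun y => y + wcu y) '' Set.range ⇑(P.πc + P.πu) := by
  obtain ⟨Ks, hKs⟩ := hSf
  obtain ⟨Ku, hKu⟩ := hUb
  have ap : ∀ {L M N : Euc d →L[ℝ] Euc d}, L.comp M = N → ∀ x, L (M x) = N x :=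
    fun h x => DFunLike.congr_fun h x
  have iss := ap P.idem_s
  have icc := ap P.idem_c
  have iuu := ap P.idem_u
  have isc := ap P.comp_sc
  have ics := ap P.comp_cs
  have isu := ap P.comp_su
  have ius := ap P.comp_us
  have icu := ap P.comp_cu
  have iuc := ap P.comp_uc
  have hsum : ∀ x, P.πs x + P.πc x + P.πu x = x := fun x => DFunLike.congr_fun P.sum_eq x
  have cs : ∀ x, A (P.πs x) = P.πs (A x) := ap hAs
  have cc : ∀ x, A (P.πc x) = P.πc (A x) := ap hAc
  have cu : ∀ x, A (P.πu x) = P.πu (A x) := ap hAu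
  have hlum : 0 < lum := one_pos.trans hl4
  have hlum1 : 1 / lum < 1 := (div_lt_one hlum).2 hl4
  have hsymm : ∀ {p : Euc d →L[ℝ] Euc d}, (∀ x, A (p x) = p (A x)) →
      ∀ x, A.symm (p x) = p (A.symm x) := fun h x => by
    rw [A.symm_apply_eq, h, A.apply_symm_apply]
  obtain ⟨δ₁, hδ₁, Hcs⟩ := exists_invariant_graph A (P.πc + P.πs) P.πu
    (fun x => by simp [iss, icc, isc, ics]) iuu (fun x => by simp [isu, icu])
    (fun x => by simp [ius, iuc])
    (fun x => by rw [add_apply, add_comm (P.πc x), hsum])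
    (fun x => by simp [cs, cc]) cu
    (fun η hη => by
      obtain ⟨Kc, hKc⟩ := hC η hη
      exact exists_forall_norm_comp_add_le _ _ _ (by linarith) (by linarith)
        (fun n => (hKc n).1) hKs)
    (by positivity) hlum1 hKu {x | P.πc x = x} (fun x (hx : P.πc x = x) => by
      rw [← hx]; simp [icc, isc]) hα0 hα1 hε
  obtain ⟨δ₂, hδ₂, Hcu⟩ := exists_invariant_graph A.symm (P.πc + P.πu) P.πs
    (fun x => by simp [iuu, icc, iuc, icu]) iss (fun x => by simp [ius, ics])
    (fun x => by simp [isu, isc])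
    (fun x => by
      rw [add_apply]
      conv_rhs => rw [← hsum x]
      abel)
    (fun x => by simp [hsymm cu, hsymm cc]) (hsymm cs)
    (fun η hη => by
      obtain ⟨Kc, hKc⟩ := hC η hη
      exact exists_forall_norm_comp_add_le _ _ _ (by positivity) (by linarith)
        (fun n => (hKc n).2) hKu)
    (by linarith : 0 ≤ lsp) hl3 hKs {x | P.πc x = x} (fun x (hx : P.πc x = x) => by
      rw [← hx]; simp [icc, iuc]) hα0 hα1 hε
  obtain ⟨M, hM, δ₃, hδ₃, Hinv⟩ := IsHolderC1.exists_inverse A hα0.le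
  set a := ‖(A.symm : Euc d →L[ℝ] Euc d)‖
  set b := 2 * (a * (‖P.πc‖ * ‖P.πc‖)) + 1
  refine ⟨min (min δ₁ (δ₂ / M)) (min δ₃ (1 / b)), by positivity,
    fun F f δ hδ hδle hF _ hf0 hdf0 hfC hfb hfH hZ => ?_⟩
  obtain ⟨⟨hle₁, hle₂⟩, hle₃, hle₄⟩ : (δ ≤ δ₁ ∧ δ ≤ δ₂ / M) ∧ δ ≤ δ₃ ∧ δ ≤ 1 / b := by
    simpa only [le_min_iff] using hδle
  have hf : IsHolderC1 α δ δ f := ⟨hfC.differentiable one_ne_zero, hfb, hfH, hf0, hdf0⟩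
  obtain ⟨G, g, hGF, hFG, hG, hg⟩ := Hinv F f δ hδ hle₃ hF hf
  have hZG : ∀ x ∈ {x | P.πc x = x}, G x ∈ {x | P.πc x = x} := by
    intro z (hz : P.πc z = z)
    have hlip : ∀ x y, ‖P.πc (f (P.πc x)) - P.πc (f (P.πc y))‖ ≤
        ‖P.πc‖ * (δ * ‖P.πc‖) * ‖x - y‖ := fun x y => by
      rw [← map_sub]
      refine (P.πc.le_opNorm _).trans ?_
      rw [mul_assoc, mul_assoc]
      gcongr
      refine (hf.norm_map_sub_le _ _).trans ?_
      gcongr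
      rw [← map_sub]
      exact P.πc.le_opNorm _
    have hsmall : a * (‖P.πc‖ * (δ * ‖P.πc‖)) ≤ 1 / 2 := by
      have h := (le_div_iff₀ (by positivity)).1 hle₄
      simp only [b] at h
      linarith
    obtain ⟨x, hx⟩ := surjective_add_of_small_lipschitz A (fun x => P.πc (f (P.πc x)))
      hlip hsmall z
    have h1 : F (P.πc x) = z := by
      have h := congrArg P.πc hx
      simp only [map_add, icc, hz] at h
      rw [← hZ _ (icc x), hF, map_add, ← cc, icc, cc, h]
    rw [← h1, hGF]
    exact icc x
  obtain ⟨wcs, Ccs, hcs, hcsu, hcsp, hcsZ, hcsF⟩ := Hcs F f δ hδ hle₁ hF hf hZ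
  obtain ⟨wcu, Ccu, hcu, hcus, hcup, hcuZ, hcuG⟩ := Hcu G g (M * δ) (by positivity)
    (by rw [mul_comm]; exact (le_div_iff₀ hM).1 hle₂) hG hg hZG
  refine ⟨wcs, wcu, hcsu, hcsp, hcus, hcup, hcs.contDiff hα0, ⟨Ccs, hcs.holder⟩,
    hcu.contDiff hα0, ⟨Ccu, hcu.holder⟩, fun x hx => ⟨hcsZ x hx, hcuZ x hx⟩,
    hcs.norm_fderiv_le, hcu.norm_fderiv_le, hcs.fderiv_zero, hcu.fderiv_zero, hcsF, ?_⟩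
  conv_lhs => rw [← hcuG]
  rw [← Set.image_comp, hFG.comp_eq_id, Set.image_id]
end
end
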